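/- Let u ∈ C(C̄₁) ∩ W^{1,2}_{d+1,loc}(C₁). Then there exist constants γ ∈ (0,1] and N, depending only on δ, d, and K, such that for any L ∈ 𝔏_{δ,K} one has ∫_{C₁} |D²u|^γ dx dt ≤ N sup_{∂'C₁} |u|^γ + N (∫_{C₁} |Lu|^{d+1} dx dt)^{γ/(d+1)}. -/

import Mathlib

open MeasureTheory ENNReal Set

noncomputable section

/-- The Frobenius norm of a matrix, used as `|D²u|`. -/
def frobNorm {d : ℕ} (m : Matrix (Fin d) (Fin d) ℝ) : ℝ :=
  Real.sqrt (∑ i, ∑ j, (m i j) ^ 2)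

/-- Euclidean space of dimension `d`. -/
abbrev EE (d : ℕ) := EuclideanSpace ℝ (Fin d)

/-- Space-time. -/
abbrev ZZ (d : ℕ) := ℝ × EuclideanSpace ℝ (Fin d)

/-- ellipticity of a constant matrix -/
def Ell {d : ℕ} (δ : ℝ) (a : Matrix (Fin d) (Fin d) ℝ) : Prop :=
  ∀ ξ : EE d, δ * ‖ξ‖ ^ 2 ≤ ∑ i, ∑ j, a i j * ξ i * ξ j ∧
          ∑ i, ∑ j, a i j * ξ i * ξ j ≤ δ⁻¹ * ‖ξ‖ ^ 2

open scoped MatrixOrder in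
lemma psd_sqrt {d : ℕ} {B : Matrix (Fin d) (Fin d) ℝ} (hB : B.PosSemidef) :
    ∃ C : Matrix (Fin d) (Fin d) ℝ, B = C.conjTranspose * C :=
  CStarAlgebra.nonneg_iff_eq_star_mul_self.mp hB.nonneg

lemma Ell.diag_le {d : ℕ} {δ : ℝ} {a : Matrix (Fin d) (Fin d) ℝ} (ha : Ell δ a) (i : Fin d) :
    a i i ≤ δ⁻¹ := by
  have := (ha (EuclideanSpace.single i 1)).2
  simpa [PiLp.single_apply, Finset.sum_ite_eq] using this

lemma Ell.trace_mul {d : ℕ} {δ : ℝ} {a B : Matrix (Fin d) (Fin d) ℝ} (ha : Ell δ a)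
    (hB : B.PosSemidef) : δ * B.trace ≤ ∑ i, ∑ j, a i j * B i j := by
  obtain ⟨C, rfl⟩ : ∃ C : Matrix (Fin d) (Fin d) ℝ, B = C.conjTranspose * C := psd_sqrt hB
  have h1 : ∀ k, δ * ∑ i, C k i ^ 2 ≤ ∑ i, ∑ j, a i j * C k i * C k j := by
    intro k
    have := (ha (WithLp.toLp 2 (C k))).1
    simpa [EuclideanSpace.norm_sq_eq] using this
  calc δ * (C.conjTranspose * C).trace = ∑ k, δ * ∑ i, C k i ^ 2 := by
        rw [Matrix.trace, ← Finset.mul_sum, Finset.sum_comm]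
        simp [Matrix.mul_apply, pow_two]
    _ ≤ ∑ k, ∑ i, ∑ j, a i j * C k i * C k j := Finset.sum_le_sum fun k _ => h1 k
    _ = _ := by
        rw [Finset.sum_comm]
        refine Finset.sum_congr rfl fun i _ => ?_
        rw [Finset.sum_comm]
        refine Finset.sum_congr rfl fun j _ => ?_
        simp [Matrix.mul_apply, Finset.mul_sum, mul_assoc]

lemma psd_det_le {d : ℕ} {B : Matrix (Fin d) (Fin d) ℝ} (hB : B.PosSemidef) :
    B.det ≤ B.trace ^ d := by
  rw [hB.1.det_eq_prod_eigenvalues, hB.1.trace_eq_sum_eigenvalues]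
  simp only [RCLike.ofReal_real_eq_id, id]
  calc ∏ i, hB.1.eigenvalues i ≤ ∏ i : Fin d, ∑ j, hB.1.eigenvalues j := by
        apply Finset.prod_le_prod
        · intro i _; exact hB.eigenvalues_nonneg i
        · intro i _
          exact Finset.single_le_sum (f := fun j => hB.1.eigenvalues j)
            (fun j _ => hB.eigenvalues_nonneg j) (Finset.mem_univ i)
    _ = _ := by simp

lemma psd_det_nonneg {d : ℕ} {B : Matrix (Fin d) (Fin d) ℝ} (hB : B.PosSemidef) :
    0 ≤ B.det := hB.det_nonneg

lemma psd_entry {d : ℕ} {B : Matrix (Fin d) (Fin d) ℝ} (hB : B.PosSemidef) (i j : Fin d) :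
    |B i j| ≤ B.trace := by
  obtain ⟨C, rfl⟩ : ∃ C : Matrix (Fin d) (Fin d) ℝ, B = C.conjTranspose * C := psd_sqrt hB
  have h1 : ∀ i, ∑ k, C k i ^ 2 ≤ (C.conjTranspose * C).trace := by
    intro i
    have : (C.conjTranspose * C).trace = ∑ i, ∑ k, C k i ^ 2 := by
      simp [Matrix.trace, Matrix.mul_apply, pow_two]
    rw [this]
    exact Finset.single_le_sum (f := fun i => ∑ k, C k i ^ 2)
      (fun j _ => Finset.sum_nonneg fun _ _ => sq_nonneg _) (Finset.mem_univ i)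
  have h2 : |(C.conjTranspose * C) i j| ≤ ∑ k, (C k i ^ 2 + C k j ^ 2) / 2 := by
    simp only [Matrix.mul_apply, Matrix.conjTranspose_apply, star_trivial]
    refine (Finset.abs_sum_le_sum_abs _ _).trans (Finset.sum_le_sum fun k _ => ?_)
    rw [abs_mul]
    nlinarith [sq_nonneg (|C k i| - |C k j|), sq_abs (C k i), sq_abs (C k j)]
  rw [← Finset.sum_div, Finset.sum_add_distrib] at h2
  linarith [h1 i, h1 j]

lemma frobNorm_nonneg {d : ℕ} (m : Matrix (Fin d) (Fin d) ℝ) : 0 ≤ frobNorm m := Real.sqrt_nonneg _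

lemma frobNorm_le {d : ℕ} {m : Matrix (Fin d) (Fin d) ℝ} {A : ℝ} (hA : 0 ≤ A)
    (h : ∀ i j, |m i j| ≤ A) : frobNorm m ≤ d * A := by
  unfold frobNorm
  apply Real.sqrt_le_iff.2
  refine ⟨by positivity, ?_⟩
  calc ∑ i, ∑ j, (m i j) ^ 2 ≤ ∑ i : Fin d, ∑ j : Fin d, A ^ 2 :=
        Finset.sum_le_sum fun i _ => Finset.sum_le_sum fun j _ => sq_le_sq' (abs_le.1 (h i j)).1 (abs_le.1 (h i j)).2
    _ = _ := by simp; ring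

lemma abs_entry_le_frobNorm {d : ℕ} (m : Matrix (Fin d) (Fin d) ℝ) (i j : Fin d) :
    |m i j| ≤ frobNorm m := by
  unfold frobNorm
  apply Real.abs_le_sqrt
  calc (m i j)^2 ≤ ∑ j, (m i j) ^ 2 :=
        Finset.single_le_sum (f := fun j => (m i j) ^ 2) (fun _ _ => sq_nonneg _) (Finset.mem_univ j)
    _ ≤ _ := Finset.single_le_sum (f := fun i => ∑ j, (m i j) ^ 2)
        (fun _ _ => Finset.sum_nonneg fun _ _ => sq_nonneg _) (Finset.mem_univ i)

/-- determinant of the block triangular map -/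
lemma det_block {d : ℕ} (α : ℝ) (k x : EE d) (m : Matrix (Fin d) (Fin d) ℝ)
    (T : ZZ d →ₗ[ℝ] ZZ d)
    (hT : ∀ τ η, T (τ, η) = (inner ℝ x (Matrix.toEuclideanLin m η + τ • k) - α * τ,
      Matrix.toEuclideanLin m η + τ • k)) :
    |LinearMap.det T| = |α| * |m.det| := by
  let A : ZZ d →ₗ[ℝ] ZZ d :=
    LinearMap.prod (LinearMap.fst ℝ ℝ (EE d) + (innerₛₗ ℝ x).comp (LinearMap.snd ℝ ℝ (EE d))) (LinearMap.snd ℝ ℝ (EE d))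
  let B : ZZ d →ₗ[ℝ] ZZ d :=
    LinearMap.prod ((-α) • LinearMap.fst ℝ ℝ (EE d))
      ((Matrix.toEuclideanLin m).comp (LinearMap.snd ℝ ℝ (EE d)) + (LinearMap.fst ℝ ℝ (EE d)).smulRight k)
  have hTAB : T = A ∘ₗ B := by
    apply LinearMap.ext
    rintro ⟨τ, η⟩
    rw [hT]
    simp only [LinearMap.comp_apply, A, B, LinearMap.prod_apply]
    simp
    ring
  let b := (Module.Basis.singleton Unit ℝ).prod (EuclideanSpace.basisFun (Fin d) ℝ).toBasis
  have hA : LinearMap.det A = 1 := by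
    rw [← LinearMap.det_toMatrix b]
    have : LinearMap.toMatrix b b A = Matrix.fromBlocks 1 (Matrix.of fun _ j => x j) 0 1 := by
      ext i j
      rcases i with i | i <;> rcases j with j | j <;>
      simp [LinearMap.toMatrix_apply, b, A, Matrix.one_apply, EuclideanSpace.inner_single_right, PiLp.single_apply]
    rw [this, Matrix.det_fromBlocks_zero₂₁]; simp
  have hB : LinearMap.det B = -α * m.det := by
    rw [← LinearMap.det_toMatrix b]
    have : LinearMap.toMatrix b b B = Matrix.fromBlocks (Matrix.of fun _ _ => -α) 0 (Matrix.of fun i _ => k i) m := by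
      ext i j
      rcases i with i | i <;> rcases j with j | j <;>
      simp [LinearMap.toMatrix_apply, b, B, Matrix.toEuclideanLin]
    rw [this, Matrix.det_fromBlocks_zero₁₂]; simp
  rw [hTAB, LinearMap.det_comp, hA, hB, one_mul, abs_mul, abs_neg]
end

open MeasureTheory ENNReal Set

noncomputable section

/-- A twice differentiable function with explicit derivatives. -/
structure Sm {d : ℕ} (v vt : ZZ d → ℝ) (G : ZZ d → EE d) (m : ZZ d → Matrix (Fin d) (Fin d) ℝ)
    (k : ZZ d → EE d) : Prop where
  hv : ∀ z, HasFDerivAt v (vt z • ContinuousLinearMap.fst ℝ ℝ (EE d) +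
    (innerSL ℝ (G z)).comp (ContinuousLinearMap.snd ℝ ℝ (EE d))) z
  hG : ∀ z, HasFDerivAt G ((Matrix.toEuclideanLin (m z)).toContinuousLinearMap.comp
    (ContinuousLinearMap.snd ℝ ℝ (EE d)) + (ContinuousLinearMap.fst ℝ ℝ (EE d)).smulRight (k z)) z
  hm : ∀ z, (m z).IsSymm

namespace Sm
variable {d : ℕ} {v vt : ZZ d → ℝ} {G : ZZ d → EE d} {m : ZZ d → Matrix (Fin d) (Fin d) ℝ}
    {k : ZZ d → EE d}

lemma cont (h : Sm v vt G m k) : Continuous v :=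
  continuous_iff_continuousAt.2 fun z => (h.hv z).continuousAt

lemma contG (h : Sm v vt G m k) : Continuous G :=
  continuous_iff_continuousAt.2 fun z => (h.hG z).continuousAt

/-- affine change `α v + β` -/
lemma aff (h : Sm v vt G m k) (α β : ℝ) :
    Sm (fun z => α * v z + β) (fun z => α * vt z) (fun z => α • G z) (fun z => α • m z)
      (fun z => α • k z) where
  hv z := by
    have := ((h.hv z).const_mul α).add_const β
    refine this.congr_fderiv ?_
    ext <;> simp
  hG z := by
    have := (h.hG z).const_smul α
    refine this.congr_fderiv ?_
    ext <;> simp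
  hm z := by
    have := h.hm z
    unfold Matrix.IsSymm at *
    rw [Matrix.transpose_smul, this]

/-- adding a paraboloid -/
lemma para (h : Sm v vt G m k) (M : ℝ) :
    Sm (fun z => v z + M * (‖z.2‖ ^ 2 / 2 + z.1)) (fun z => vt z + M) (fun z => G z + M • z.2)
      (fun z => m z + M • (1 : Matrix (Fin d) (Fin d) ℝ)) k where
  hv z := by
    have h1 : HasFDerivAt (fun z : ZZ d => ‖z.2‖ ^ 2) _ z :=
      (hasFDerivAt_snd (𝕜 := ℝ) (p := z)).norm_sq
    have h2 : HasFDerivAt (fun z : ZZ d => z.1) _ z := hasFDerivAt_fst (𝕜 := ℝ) (p := z)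
    have := (h.hv z).add (((h1.mul_const (2⁻¹ : ℝ)).add h2).const_mul M)
    simp only [← div_eq_mul_inv] at this
    refine this.congr_fderiv ?_
    ext <;> simp [inner_add_left, inner_smul_left]
  hG z := by
    have := (h.hG z).add ((hasFDerivAt_snd (𝕜 := ℝ) (p := z)).const_smul M)
    refine this.congr_fderiv ?_
    ext <;> simp [Matrix.toEuclideanLin]
  hm z := by
    have := h.hm z
    unfold Matrix.IsSymm at *
    rw [Matrix.transpose_add, Matrix.transpose_smul, this, Matrix.transpose_one]

/-- derivative along a segment in `x` -/
lemma derivx (h : Sm v vt G m k) (t : ℝ) (x η : EE d) (s : ℝ) :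
    HasDerivAt (fun s : ℝ => v (t, x + s • η)) (inner ℝ (G (t, x + s • η)) η) s := by
  have h1 : HasDerivAt (fun s : ℝ => ((t, x + s • η) : ZZ d)) ((0 : ℝ), η) s := by
    apply HasDerivAt.prodMk (hasDerivAt_const _ _)
    simpa using ((hasDerivAt_id s).smul_const η).const_add x
  have := (h.hv (t, x + s • η)).comp_hasDerivAt s h1
  simpa using! this

lemma derivGx (h : Sm v vt G m k) (t : ℝ) (x η : EE d) (s : ℝ) :
    HasDerivAt (fun s : ℝ => inner ℝ (G (t, x + s • η)) η)
      (inner ℝ (Matrix.toEuclideanLin (m (t, x + s • η)) η) η) s := by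
  have h1 : HasDerivAt (fun s : ℝ => ((t, x + s • η) : ZZ d)) ((0 : ℝ), η) s := by
    apply HasDerivAt.prodMk (hasDerivAt_const _ _)
    simpa using ((hasDerivAt_id s).smul_const η).const_add x
  have := (h.hG (t, x + s • η)).comp_hasDerivAt s h1
  have := this.inner ℝ (hasDerivAt_const s η)
  simpa using! this

lemma derivt (h : Sm v vt G m k) (t : ℝ) (x : EE d) :
    HasDerivAt (fun s : ℝ => v (s, x)) (vt (t, x)) t := by
  have h1 : HasDerivAt (fun s : ℝ => ((s, x) : ZZ d)) ((1 : ℝ), (0 : EE d)) t :=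
    HasDerivAt.prodMk (hasDerivAt_id t) (hasDerivAt_const _ _)
  have := (h.hv (t, x)).comp_hasDerivAt t h1
  simpa using! this

end Sm

instance instHaarZZ (d : ℕ) : (volume : Measure (ZZ d)).IsAddHaarMeasure :=
  inferInstanceAs ((volume : Measure ℝ).prod (volume : Measure (EE d))).IsAddHaarMeasure

/-- closed cylinder -/
def QQ (d : ℕ) (t0 t1 R : ℝ) : Set (ZZ d) := Icc t0 t1 ×ˢ Metric.closedBall (0 : EE d) R

/-- cylinder open laterally and at the top -/
def DD (d : ℕ) (t0 t1 R : ℝ) : Set (ZZ d) := Ico t0 t1 ×ˢ Metric.ball (0 : EE d) R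

lemma QQ_compact (d : ℕ) (t0 t1 R : ℝ) : IsCompact (QQ d t0 t1 R) :=
  isCompact_Icc.prod (isCompact_closedBall _ _)

lemma DD_meas (d : ℕ) (t0 t1 R : ℝ) : MeasurableSet (DD d t0 t1 R) :=
  measurableSet_Ico.prod measurableSet_ball

lemma DD_sub (d : ℕ) (t0 t1 R : ℝ) : DD d t0 t1 R ⊆ QQ d t0 t1 R :=
  prod_mono Ico_subset_Icc_self Metric.ball_subset_closedBall

/-- contact points with affine functions -/
def Ct {d : ℕ} (w : ZZ d → ℝ) (G : ZZ d → EE d) (t0 t1 R : ℝ) : Set (ZZ d) :=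
  {z | z ∈ DD d t0 t1 R ∧ ∀ z' ∈ QQ d t0 t1 R, z.1 < z'.1 → w z + inner ℝ (G z) (z'.2 - z.2) ≤ w z'}

section
variable {d : ℕ} {w wt : ZZ d → ℝ} {G : ZZ d → EE d} {m : ZZ d → Matrix (Fin d) (Fin d) ℝ}
    {k : ZZ d → EE d} {t0 t1 R : ℝ}

lemma Ct_meas (h : Sm w wt G m k) : MeasurableSet (Ct w G t0 t1 R) := by
  have : Ct w G t0 t1 R = DD d t0 t1 R ∩
      (⋃ z' ∈ QQ d t0 t1 R, {z : ZZ d | z.1 < z'.1 ∧ w z' < w z + inner ℝ (G z) (z'.2 - z.2)})ᶜ := by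
    ext z
    simp [Ct]
  rw [this]
  apply (DD_meas _ _ _ _).inter
  apply MeasurableSet.compl
  apply IsOpen.measurableSet
  refine isOpen_biUnion fun z' _ => ?_
  have := h.cont
  have := h.contG
  have e1 : IsOpen {z : ZZ d | z.1 < z'.1} := isOpen_lt (by fun_prop) (by fun_prop)
  have e2 : IsOpen {z : ZZ d | w z' < w z + inner ℝ (G z) (z'.2 - z.2)} :=
    isOpen_lt (by fun_prop) (by fun_prop)
  exact e1.inter e2

lemma Ct_le (h : Sm w wt G m k) {z : ZZ d} (hz : z ∈ Ct w G t0 t1 R) :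
    ∀ z' ∈ QQ d t0 t1 R, z.1 ≤ z'.1 → w z + inner ℝ (G z) (z'.2 - z.2) ≤ w z' := by
  intro z' hz' hle
  rcases hle.lt_or_eq with hlt | heq
  · exact hz.2 z' hz' hlt
  have hz1 : z.1 < t1 := hz.1.1.2
  have hc : Filter.Tendsto (fun s : ℝ => w (s, z'.2)) (nhdsWithin z'.1 (Ioi z'.1)) (nhds (w (z'.1, z'.2))) := by
    have := h.cont
    have : Continuous (fun s : ℝ => w (s, z'.2)) := by fun_prop
    exact (this.tendsto z'.1).mono_left nhdsWithin_le_nhds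
  refine ge_of_tendsto hc ?_
  have : Ioo z'.1 t1 ∈ nhdsWithin z'.1 (Ioi z'.1) := Ioo_mem_nhdsGT (by rw [← heq]; exact hz1)
  filter_upwards [this] with s hs
  refine hz.2 (s, z'.2) ⟨⟨?_, hs.2.le⟩, hz'.2⟩ ?_
  · exact hz'.1.1.trans hs.1.le
  · rw [heq]; exact hs.1

lemma Ct_wt (h : Sm w wt G m k) {z : ZZ d} (hz : z ∈ Ct w G t0 t1 R) : 0 ≤ wt z := by
  have hd := (h.derivt z.1 z.2).hasDerivWithinAt (s := Ioi z.1)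
  have := hasDerivWithinAt_iff_tendsto_slope' (self_notMem_Ioi) |>.1 hd
  refine ge_of_tendsto this ?_
  have : Ioo z.1 t1 ∈ nhdsWithin z.1 (Ioi z.1) := Ioo_mem_nhdsGT hz.1.1.2
  filter_upwards [this] with s hs
  have h1 := hz.2 (s, z.2) ⟨⟨hz.1.1.1.trans hs.1.le, hs.2.le⟩, Metric.ball_subset_closedBall hz.1.2⟩ hs.1
  simp only [sub_self, inner_zero_right, add_zero] at h1
  rw [slope_def_field]
  exact div_nonneg (by simpa using h1) (by linarith [hs.1])

lemma Ct_psd (h : Sm w wt G m k) {z : ZZ d} (hz : z ∈ Ct w G t0 t1 R) : (m z).PosSemidef := by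
  have key : ∀ η : EE d, 0 ≤ inner ℝ (Matrix.toEuclideanLin (m z) η) η := by
    intro η
    by_contra hneg
    push Not at hneg
    -- φ s = w (t, x + s η) - s ⟪G z, η⟫
    set φ : ℝ → ℝ := fun s => w (z.1, z.2 + s • η) - s * inner ℝ (G z) η with hφ
    have hφd : ∀ s, HasDerivAt φ (inner ℝ (G (z.1, z.2 + s • η)) η - inner ℝ (G z) η) s := by
      intro s
      have := (h.derivx z.1 z.2 η s).sub ((hasDerivAt_id s).mul_const (inner ℝ (G z) η))
      simpa using! this
    have hφ' : deriv φ = fun s => inner ℝ (G (z.1, z.2 + s • η)) η - inner ℝ (G z) η :=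
      funext fun s => (hφd s).deriv
    have h2 : HasDerivAt (deriv φ) (inner ℝ (Matrix.toEuclideanLin (m z) η) η) 0 := by
      rw [hφ']
      have := (h.derivGx z.1 z.2 η 0).sub_const (inner ℝ (G z) η)
      simpa using! this
    -- strict local max contradiction: derivative negative on right
    have h3 : ∀ᶠ s in nhdsWithin 0 (Ioi (0:ℝ)), deriv φ s < 0 := by
      have h4 := hasDerivWithinAt_iff_tendsto_slope' (self_notMem_Ioi) |>.1 (h2.hasDerivWithinAt (s := Ioi 0))
      have h5 := h4.eventually (Iio_mem_nhds hneg)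
      filter_upwards [h5, self_mem_nhdsWithin] with s hs hs0
      have hs0' : (0:ℝ) < s := hs0
      have h6 : deriv φ 0 = 0 := by rw [hφ']; simp
      simp only [mem_Iio, slope_def_field, h6, sub_zero] at hs
      by_contra hc
      push Not at hc
      exact absurd hs (not_lt.2 (div_nonneg hc hs0'.le))
    have hball : ∀ᶠ s in nhdsWithin 0 (Ioi (0:ℝ)), z.2 + s • η ∈ Metric.ball (0 : EE d) R := by
      apply nhdsWithin_le_nhds
      have hc : Continuous fun s : ℝ => z.2 + s • η := by fun_prop
      apply hc.continuousAt.eventually_mem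
      simpa using! Metric.isOpen_ball.mem_nhds hz.1.2
    obtain ⟨ε, hε, hlt⟩ := (mem_nhdsGT_iff_exists_Ioo_subset).1 (h3.and hball)
    have hε' : (0:ℝ) < ε := hε
    have hanti : StrictAntiOn φ (Icc 0 (ε/2)) := by
      apply strictAntiOn_of_deriv_neg (convex_Icc _ _)
      · exact fun s _ => (hφd s).continuousAt.continuousWithinAt
      · intro s hs
        rw [interior_Icc] at hs
        exact (hlt ⟨hs.1, by linarith [hs.2]⟩).1
    have h7 := hanti (left_mem_Icc.2 (by linarith)) (right_mem_Icc.2 (by linarith)) (by linarith : (0:ℝ) < ε/2)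
    have hb := (hlt (⟨by linarith, by linarith⟩ : ε/2 ∈ Ioo 0 ε)).2
    have h8 := Ct_le h hz (z.1, z.2 + (ε/2) • η) ⟨⟨hz.1.1.1, hz.1.1.2.le⟩, Metric.ball_subset_closedBall hb⟩ le_rfl
    simp only [hφ, add_sub_cancel_left, inner_smul_right] at h7 h8
    simp at h7
    linarith
  apply Matrix.PosSemidef.of_dotProduct_mulVec_nonneg
  · have := h.hm z
    unfold Matrix.IsSymm at this
    unfold Matrix.IsHermitian
    rw [Matrix.conjTranspose_eq_transpose_of_trivial, this]
  · intro x
    have := key (WithLp.toLp 2 x)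
    simpa [Matrix.toEuclideanLin, EuclideanSpace.inner_eq_star_dotProduct] using! this

/-- the Legendre-type map -/
def Phi (w : ZZ d → ℝ) (G : ZZ d → EE d) (z : ZZ d) : ZZ d := (inner ℝ z.2 (G z) - w z, G z)

lemma area (h : Sm w wt G m k) {δ : ℝ} (hδ : 0 < δ) {S : Set (ZZ d)} (hS : MeasurableSet S)
    (F : ZZ d → ℝ)
    (hwt : ∀ z ∈ S, 0 ≤ wt z) (hpsd : ∀ z ∈ S, (m z).PosSemidef)
    (heq : ∀ z ∈ S, ∃ a, Ell δ a ∧ wt z + ∑ i, ∑ j, a i j * m z i j ≤ F z) :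
    volume (Phi w G '' S) ≤ ENNReal.ofReal (δ⁻¹ ^ d) * ∫⁻ z in S, ENNReal.ofReal (F z) ^ (d + 1) := by
  set T : ZZ d → (ZZ d →L[ℝ] ZZ d) := fun z =>
    ((innerSL ℝ z.2).comp ((Matrix.toEuclideanLin (m z)).toContinuousLinearMap.comp
    (ContinuousLinearMap.snd ℝ ℝ (EE d)) + (ContinuousLinearMap.fst ℝ ℝ (EE d)).smulRight (k z)) -
     wt z • ContinuousLinearMap.fst ℝ ℝ (EE d)).prod
    ((Matrix.toEuclideanLin (m z)).toContinuousLinearMap.comp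
    (ContinuousLinearMap.snd ℝ ℝ (EE d)) + (ContinuousLinearMap.fst ℝ ℝ (EE d)).smulRight (k z)) with hT
  have hder : ∀ z ∈ S, HasFDerivWithinAt (Phi w G) (T z) S z := by
    intro z _
    apply HasFDerivAt.hasFDerivWithinAt
    have h1 := ((hasFDerivAt_snd (𝕜 := ℝ) (p := z)).inner ℝ (h.hG z)).sub (h.hv z)
    have h2 := h1.prodMk (h.hG z)
    refine h2.congr_fderiv ?_
    rw [hT]
    ext <;> simp [real_inner_comm, fderivInnerCLM_apply]
  refine (addHaar_image_le_lintegral_abs_det_fderiv volume hS hder).trans ?_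
  rw [← lintegral_const_mul' _ _ ENNReal.ofReal_ne_top]
  apply setLIntegral_mono' hS
  intro z hz
  obtain ⟨a, ha, hF⟩ := heq z hz
  have hdet : |(T z).det| = |wt z| * |(m z).det| := by
    apply det_block (wt z) (k z) z.2 (m z)
    intro τ η
    simp [hT, inner_add_right]
  have htr := ha.trace_mul (hpsd z hz)
  have htr0 := (hpsd z hz).trace_nonneg
  have h1 : wt z ≤ F z := by nlinarith
  have h2 : (m z).trace ≤ δ⁻¹ * F z := by
    rw [inv_mul_eq_div, le_div_iff₀ hδ]; nlinarith [hwt z hz]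
  have hF0 : 0 ≤ F z := (hwt z hz).trans h1
  rw [hdet, abs_of_nonneg (hwt z hz), abs_of_nonneg (psd_det_nonneg (hpsd z hz)),
    ← ENNReal.ofReal_pow hF0, ← ENNReal.ofReal_mul (by positivity)]
  apply ENNReal.ofReal_le_ofReal
  calc wt z * (m z).det ≤ F z * (δ⁻¹ * F z) ^ d := by
        apply mul_le_mul h1 _ (psd_det_nonneg (hpsd z hz)) hF0
        exact (psd_det_le (hpsd z hz)).trans (pow_le_pow_left₀ htr0 h2 d)
    _ = _ := by ring

/-- first touching -/
lemma touch (h : Sm w wt G m k) (p : EE d) (hh : ℝ) {z0 : ZZ d} (hz0 : z0 ∈ QQ d t0 t1 R)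
    (h0 : w z0 ≤ inner ℝ p z0.2 - hh)
    (hbd : ∀ z ∈ QQ d t0 t1 R, z0.1 ≤ z.1 → (z.1 = t1 ∨ ‖z.2‖ = R) → inner ℝ p z.2 - hh < w z) :
    ∃ z ∈ Ct w G t0 t1 R, z0.1 ≤ z.1 ∧ Phi w G z = (hh, p) := by
  set S := QQ d t0 t1 R ∩ {z | z0.1 ≤ z.1} ∩ {z | w z ≤ inner ℝ p z.2 - hh} with hS
  have hc := h.cont
  have hScomp : IsCompact S := by
    apply IsCompact.inter_right
    · apply (QQ_compact _ _ _ _).inter_right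
      exact isClosed_le (by fun_prop) (by fun_prop)
    · exact isClosed_le (by fun_prop) (by fun_prop)
  obtain ⟨z, hzS, hmax⟩ := hScomp.exists_isMaxOn ⟨z0, ⟨hz0, le_refl z0.1⟩, h0⟩
    (f := fun z : ZZ d => z.1) (by fun_prop)
  have hzQ := hzS.1.1
  have hz0z : z0.1 ≤ z.1 := hzS.1.2
  have hzw : w z ≤ inner ℝ p z.2 - hh := hzS.2
  have hnot : ¬ (z.1 = t1 ∨ ‖z.2‖ = R) := fun hcon => absurd (hbd z hzQ hz0z hcon) (not_lt.2 hzw)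
  push Not at hnot
  have hzD : z ∈ DD d t0 t1 R := by
    refine ⟨⟨hzQ.1.1, lt_of_le_of_ne hzQ.1.2 hnot.1⟩, ?_⟩
    have := hzQ.2
    rw [mem_closedBall_zero_iff] at this
    rw [mem_ball_zero_iff]
    exact lt_of_le_of_ne this hnot.2
  have hgt : ∀ z' ∈ QQ d t0 t1 R, z.1 < z'.1 → inner ℝ p z'.2 - hh < w z' := by
    intro z' hz' hlt
    by_contra hcon
    push Not at hcon
    have : z'.1 ≤ z.1 := hmax (⟨⟨hz', hz0z.trans hlt.le⟩, hcon⟩ : z' ∈ S)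
    linarith
  have hge : ∀ x ∈ Metric.closedBall (0 : EE d) R, inner ℝ p x - hh ≤ w (z.1, x) := by
    intro x hx
    have hcl : Filter.Tendsto (fun s : ℝ => w (s, x)) (nhdsWithin z.1 (Ioi z.1)) (nhds (w (z.1, x))) := by
      have : Continuous (fun s : ℝ => w (s, x)) := by fun_prop
      exact (this.tendsto z.1).mono_left nhdsWithin_le_nhds
    refine ge_of_tendsto hcl ?_
    have : Ioo z.1 t1 ∈ nhdsWithin z.1 (Ioi z.1) := Ioo_mem_nhdsGT hzD.1.2
    filter_upwards [this] with s hs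
    exact (hgt (s, x) ⟨⟨hzQ.1.1.trans hs.1.le, hs.2.le⟩, hx⟩ hs.1).le
  have heq : w z = inner ℝ p z.2 - hh := le_antisymm hzw (hge z.2 hzQ.2)
  have hGp : G z = p := by
    have hin : inner ℝ (G z) (G z - p) = inner ℝ p (G z - p) := by
      set η := G z - p with hη
      have hd : HasDerivAt (fun s : ℝ => w (z.1, z.2 + s • η) - (inner ℝ p (z.2 + s • η) - hh))
          (inner ℝ (G z) η - inner ℝ p η) 0 := by
        have h1 := h.derivx z.1 z.2 η 0
        have h2 : HasDerivAt (fun s : ℝ => inner ℝ p (z.2 + s • η) - hh) (inner ℝ p η) 0 := by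
          simp only [inner_add_right, inner_smul_right]
          simpa using! ((((hasDerivAt_id (0:ℝ)).mul_const (inner ℝ p η)).const_add (inner ℝ p z.2)).sub_const hh)
        simpa using! h1.sub h2
      have hmin : IsLocalMin (fun s : ℝ => w (z.1, z.2 + s • η) - (inner ℝ p (z.2 + s • η) - hh)) 0 := by
        have hc : Continuous fun s : ℝ => z.2 + s • η := by fun_prop
        have : ∀ᶠ s in nhds (0:ℝ), z.2 + s • η ∈ Metric.ball (0 : EE d) R := by
          apply hc.continuousAt.eventually_mem
          simpa using! Metric.isOpen_ball.mem_nhds hzD.2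
        filter_upwards [this] with s hs
        have h1 := hge _ (Metric.ball_subset_closedBall hs)
        simp only [zero_smul, add_zero, Prod.mk.eta]
        linarith
      have := hmin.hasDerivAt_eq_zero hd
      linarith
    have : inner ℝ (G z - p) (G z - p) = 0 := by rw [inner_sub_left, hin, sub_self]
    exact sub_eq_zero.1 (inner_self_eq_zero.1 this)
  refine ⟨z, ⟨hzD, ?_⟩, hz0z, ?_⟩
  · intro z' hz' hlt
    have := hgt z' hz' hlt
    rw [hGp, heq, inner_sub_right]
    linarith
  · simp only [Phi, hGp, heq, Prod.mk.injEq, and_true]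
    rw [real_inner_comm]; ring
end
end

open MeasureTheory ENNReal Set

noncomputable section

/-- volume of the unit ball -/
def om (d : ℕ) : ℝ := (volume (Metric.ball (0 : EE d) 1)).toReal

lemma om_pos (d : ℕ) : 0 < om d :=
  ENNReal.toReal_pos (Metric.measure_ball_pos volume _ one_pos).ne' measure_ball_lt_top.ne

lemma vol_ball (d : ℕ) {r : ℝ} (hr : 0 < r) :
    volume (Metric.ball (0 : EE d) r) = ENNReal.ofReal (r ^ d * om d) := by
  rw [Measure.addHaar_ball_of_pos volume (0 : EE d) hr, ENNReal.ofReal_mul (by positivity), om,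
    ENNReal.ofReal_toReal measure_ball_lt_top.ne]
  simp

lemma vol_DD (d : ℕ) {t0 t1 R : ℝ} (hR : 0 < R) (ht : t0 ≤ t1) :
    volume (DD d t0 t1 R) = ENNReal.ofReal ((t1 - t0) * (R ^ d * om d)) := by
  have : (volume : Measure (ZZ d)) = (volume : Measure ℝ).prod volume := rfl
  rw [DD, this, Measure.prod_prod, vol_ball d hR, Real.volume_Ico,
    ENNReal.ofReal_mul (p := t1 - t0) (by linarith)]

lemma ennreal_add_pow_le (x y : ℝ≥0∞) (n : ℕ) : (x + y) ^ n ≤ 2 ^ n * (x ^ n + y ^ n) := by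
  rcases le_total x y with h | h
  · calc (x + y) ^ n ≤ (2 * y) ^ n := by gcongr; rw [two_mul]; gcongr
      _ = 2 ^ n * y ^ n := mul_pow _ _ _
      _ ≤ _ := by gcongr; exact le_add_self
  · calc (x + y) ^ n ≤ (2 * x) ^ n := by gcongr; rw [two_mul]; gcongr
      _ = 2 ^ n * x ^ n := mul_pow _ _ _
      _ ≤ _ := by gcongr; exact le_self_add

lemma lint_add_const {d : ℕ} {S D : Set (ZZ d)} (hSD : S ⊆ D) (f : ZZ d → ℝ) (c : ℝ)
    (n : ℕ) :
    ∫⁻ z in S, ENNReal.ofReal (f z + c) ^ n ≤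
      2 ^ n * ((∫⁻ z in D, ENNReal.ofReal (f z) ^ n) + ENNReal.ofReal c ^ n * volume S) := by
  calc ∫⁻ z in S, ENNReal.ofReal (f z + c) ^ n
      ≤ ∫⁻ z in S, 2 ^ n * (ENNReal.ofReal (f z) ^ n + ENNReal.ofReal c ^ n) := by
        apply lintegral_mono
        intro z
        refine le_trans ?_ (ennreal_add_pow_le _ _ n)
        dsimp only
        gcongr
        exact ENNReal.ofReal_add_le
    _ = 2 ^ n * ((∫⁻ z in S, ENNReal.ofReal (f z) ^ n) + ENNReal.ofReal c ^ n * volume S) := by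
        rw [lintegral_const_mul' _ _ (by simp), lintegral_add_right _ measurable_const]
        simp
    _ ≤ _ := by gcongr

lemma abp_strip (d : ℕ) (δ K : ℝ) (hδ : 0 < δ) (hK : 0 ≤ K) :
    ∃ τ N : ℝ, 0 < τ ∧ 0 < N ∧ ∀ (w wt : ZZ d → ℝ) (G : ZZ d → EE d)
      (m : ZZ d → Matrix (Fin d) (Fin d) ℝ) (k : ZZ d → EE d) (t0 t1 R : ℝ) (f : ZZ d → ℝ) (Λ : ℝ),
      Sm w wt G m k → t0 ≤ t1 → t1 - t0 ≤ τ → 0 < R → R ≤ 1 → (∀ z, 0 ≤ f z) → 0 ≤ Λ →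
      (∀ z ∈ QQ d t0 t1 R, (z.1 = t1 ∨ ‖z.2‖ = R) → 0 ≤ w z) →
      (∀ z ∈ DD d t0 t1 R, w z < 0 →
        ∃ a, Ell δ a ∧ wt z + ∑ i, ∑ j, a i j * m z i j ≤ f z + K * ‖G z‖) →
      (∫⁻ z in DD d t0 t1 R, ENNReal.ofReal (f z) ^ (d + 1)) ≤ ENNReal.ofReal (Λ ^ (d + 1)) →
      ∀ z ∈ QQ d t0 t1 R, -(N * Λ) ≤ w z := by
  have hom := om_pos d
  set C : ℝ := 8 ^ (d + 1) * δ⁻¹ ^ d / om d with hC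
  have hC0 : 0 < C := by positivity
  set τ : ℝ := (δ⁻¹ ^ d * 2 ^ (d + 1) * 4 ^ (d + 1) * (K ^ (d + 1) + 1))⁻¹ with hτ
  have hτ0 : 0 < τ := by positivity
  refine ⟨τ, 1 + C, hτ0, by linarith, ?_⟩
  intro w wt G m k t0 t1 R f Λ h ht hτ1 hR hR1 hf hΛ hbd heq hI z hz
  by_contra hcon
  push Not at hcon
  set M0 := - w z with hM0
  have hM : (1 + C) * Λ < M0 := by linarith
  have hM0' : 0 < M0 := lt_of_le_of_lt (by positivity) hM
  set P : Set (ZZ d) := {y | ‖y.2‖ < M0 / 4 ∧ y.1 - inner ℝ y.2 z.2 ∈ Ioo (M0 / 2) M0} with hP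
  set S : Set (ZZ d) := Ct w G t0 t1 R ∩ {y | ‖G y‖ < M0 / 4} ∩ {y | w y < 0} with hS
  have hcG := h.contG
  have hcw := h.cont
  have hSm : MeasurableSet S := by
    apply MeasurableSet.inter
    · apply (Ct_meas h).inter
      exact (isOpen_lt (by fun_prop) (by fun_prop)).measurableSet
    · exact (isOpen_lt (by fun_prop) (by fun_prop)).measurableSet
  have hneg : ∀ (p : EE d) (hh : ℝ), ‖p‖ < M0 / 4 → M0 / 2 < hh - inner ℝ p z.2 →
      ∀ x : EE d, ‖x‖ ≤ R → inner ℝ p x - hh < 0 := by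
    intro p hh hp hhh x hx
    have hz2 : ‖z.2‖ ≤ R := by simpa using hz.2
    have h1 : inner ℝ p (x - z.2) ≤ ‖p‖ * ‖x - z.2‖ := real_inner_le_norm _ _
    have h2 : ‖x - z.2‖ ≤ 2 := (norm_sub_le _ _).trans (by linarith)
    rw [inner_sub_right] at h1
    nlinarith [norm_nonneg p, norm_nonneg (x - z.2)]
  have hPS : P ⊆ Phi w G '' S := by
    rintro ⟨hh, p⟩ ⟨hp, hhh⟩
    simp only at hp hhh
    obtain ⟨y, hy, -, hyP⟩ := touch h p hh hz (by linarith [hhh.2]) (by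
      intro y hy _ hyb
      have hy2 : ‖y.2‖ ≤ R := by simpa using hy.2
      exact (hneg p hh hp hhh.1 y.2 hy2).trans_le (hbd y hy hyb))
    refine ⟨y, ⟨⟨hy, ?_⟩, ?_⟩, hyP⟩
    · have : G y = p := congrArg Prod.snd hyP
      simpa [this] using hp
    · have h1 : G y = p := congrArg Prod.snd hyP
      have h2 : inner ℝ y.2 (G y) - w y = hh := congrArg Prod.fst hyP
      have hy2 : ‖y.2‖ ≤ R := by simpa using (DD_sub _ _ _ _ hy.1).2
      have := hneg p hh hp hhh.1 y.2 hy2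
      rw [h1, real_inner_comm] at h2
      show w y < 0
      linarith
  have hPvol : volume P = ENNReal.ofReal (M0 / 2 * ((M0 / 4) ^ d * om d)) := by
    have hPm : MeasurableSet P := by
      have e1 : MeasurableSet {y : ZZ d | ‖y.2‖ < M0 / 4} :=
        (isOpen_lt (by fun_prop) (by fun_prop)).measurableSet
      have e2 : Measurable (fun y : ZZ d => y.1 - inner ℝ y.2 z.2) :=
        Continuous.measurable (by fun_prop)
      exact e1.inter (e2 measurableSet_Ioo)
    have : (volume : Measure (ZZ d)) = (volume : Measure ℝ).prod volume := rfl
    rw [this, Measure.prod_apply_symm hPm]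
    have h1 : ∀ p : EE d, volume ((fun x => (x, p)) ⁻¹' P) =
        (Metric.ball (0 : EE d) (M0 / 4)).indicator (fun _ => ENNReal.ofReal (M0 / 2)) p := by
      intro p
      by_cases hp : ‖p‖ < M0 / 4
      · rw [indicator_of_mem (by simpa using hp)]
        have : ((fun x => (x, p)) ⁻¹' P) = Ioo (M0 / 2 + inner ℝ p z.2) (M0 + inner ℝ p z.2) := by
          ext s
          simp only [hP, mem_preimage, mem_ofPred_eq, mem_Ioo, hp, true_and]
          constructor <;> rintro ⟨h1, h2⟩ <;> constructor <;> linarith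
        rw [this, Real.volume_Ioo]
        congr 1; ring
      · rw [indicator_of_notMem (by simpa using hp)]
        have : ((fun x => (x, p)) ⁻¹' P) = ∅ := by
          ext s
          simp [hP, hp]
        rw [this, measure_empty]
    simp_rw [h1]
    rw [lintegral_indicator measurableSet_ball, lintegral_const, Measure.restrict_apply_univ,
      vol_ball d (by positivity), ENNReal.ofReal_mul (p := M0 / 2) (by positivity)]
  have harea := area h hδ hSm (fun y => f y + K * (M0 / 4))
    (fun y hy => Ct_wt h hy.1.1) (fun y hy => Ct_psd h hy.1.1) (by
      intro y hy
      obtain ⟨a, ha, hle⟩ := heq y hy.1.1.1 hy.2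
      refine ⟨a, ha, hle.trans ?_⟩
      have : ‖G y‖ < M0 / 4 := hy.1.2
      gcongr)
  have hSD : S ⊆ DD d t0 t1 R := fun y hy => hy.1.1.1
  have h1 := lint_add_const hSD f (K * (M0 / 4)) (d + 1)
  have hvS : volume S ≤ ENNReal.ofReal (τ * om d) := by
    refine (measure_mono hSD).trans ?_
    rw [vol_DD d hR ht]
    apply ENNReal.ofReal_le_ofReal
    have : R ^ d ≤ 1 := pow_le_one₀ hR.le hR1
    have h0 : 0 ≤ t1 - t0 := by linarith
    calc (t1 - t0) * (R ^ d * om d) ≤ τ * (1 * om d) := by gcongr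
      _ = _ := by ring
  have hfin : ENNReal.ofReal (M0 / 2 * ((M0 / 4) ^ d * om d)) ≤
      ENNReal.ofReal (δ⁻¹ ^ d * (2 ^ (d + 1) * (Λ ^ (d + 1) + (K * (M0 / 4)) ^ (d + 1) * (τ * om d)))) := by
    calc _ = volume P := hPvol.symm
      _ ≤ _ := measure_mono hPS
      _ ≤ _ := harea
      _ ≤ ENNReal.ofReal (δ⁻¹ ^ d) * (2 ^ (d + 1) * (ENNReal.ofReal (Λ ^ (d + 1)) +
            ENNReal.ofReal (K * (M0 / 4)) ^ (d + 1) * ENNReal.ofReal (τ * om d))) := by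
          gcongr
          refine h1.trans ?_
          gcongr
      _ = _ := by
          rw [ENNReal.ofReal_mul (p := δ⁻¹ ^ d) (by positivity),
            ENNReal.ofReal_mul (p := 2 ^ (d + 1)) (by positivity),
            ENNReal.ofReal_add (p := Λ ^ (d + 1)) (by positivity) (by positivity),
            ENNReal.ofReal_mul (p := (K * (M0 / 4)) ^ (d + 1)) (by positivity),
            ENNReal.ofReal_pow (p := K * (M0 / 4)) (by positivity) (d + 1),
            ENNReal.ofReal_pow (p := 2) (by norm_num) (d + 1), ENNReal.ofReal_ofNat]
  rw [ENNReal.ofReal_le_ofReal_iff (by positivity)] at hfin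
  have hτK : δ⁻¹ ^ d * 2 ^ (d + 1) * 4 ^ (d + 1) * (K ^ (d + 1) * τ) ≤ 1 := by
    have : δ⁻¹ ^ d * 2 ^ (d + 1) * 4 ^ (d + 1) * ((K ^ (d + 1) + 1) * τ) = 1 := by
      rw [hτ]; field_simp
    refine le_trans ?_ this.le
    gcongr
    linarith
  have hp4 : (M0 / 4) ^ d * 4 ^ d = M0 ^ d := by rw [← mul_pow]; congr 1; ring
  -- multiply by 4^(d+1)
  have e1 : 4 ^ (d + 1) * (M0 / 2 * ((M0 / 4) ^ d * om d)) = 2 * M0 ^ (d + 1) * om d := by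
    rw [pow_succ, pow_succ, ← hp4]; ring
  have e2 : 4 ^ (d + 1) * (δ⁻¹ ^ d * (2 ^ (d + 1) * (Λ ^ (d + 1) + (K * (M0 / 4)) ^ (d + 1) * (τ * om d))))
      ≤ (C * Λ ^ (d + 1) + M0 ^ (d + 1)) * om d := by
    have e3 : (K * (M0 / 4)) ^ (d + 1) ≤ K ^ (d + 1) * M0 ^ (d + 1) := by
      rw [← mul_pow]
      gcongr
      linarith
    calc _ ≤ 4 ^ (d + 1) * (δ⁻¹ ^ d * (2 ^ (d + 1) * (Λ ^ (d + 1) + K ^ (d + 1) * M0 ^ (d + 1) * (τ * om d)))) := by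
          gcongr
      _ = (8 ^ (d + 1) * δ⁻¹ ^ d) * Λ ^ (d + 1) +
          (δ⁻¹ ^ d * 2 ^ (d + 1) * 4 ^ (d + 1) * (K ^ (d + 1) * τ)) * (M0 ^ (d + 1) * om d) := by
          have : (8 : ℝ) ^ (d + 1) = 4 ^ (d + 1) * 2 ^ (d + 1) := by rw [← mul_pow]; norm_num
          rw [this]; ring
      _ ≤ (C * om d) * Λ ^ (d + 1) + 1 * (M0 ^ (d + 1) * om d) := by
          refine add_le_add (mul_le_mul_of_nonneg_right ?_ (by positivity))
            (mul_le_mul_of_nonneg_right hτK (by positivity))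
          exact (div_mul_cancel₀ _ hom.ne').ge
      _ = _ := by ring
  have e4 : 2 * M0 ^ (d + 1) * om d ≤ (C * Λ ^ (d + 1) + M0 ^ (d + 1)) * om d := by
    rw [← e1]
    exact (mul_le_mul_of_nonneg_left hfin (by positivity)).trans e2
  have e5 : M0 ^ (d + 1) ≤ C * Λ ^ (d + 1) := by
    have := le_of_mul_le_mul_right e4 hom
    linarith
  have e6 : ((1 + C) * Λ) ^ (d + 1) < M0 ^ (d + 1) := pow_lt_pow_left₀ hM (by positivity) (by omega)
  have e7 : C * Λ ^ (d + 1) ≤ ((1 + C) * Λ) ^ (d + 1) := by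
    rw [mul_pow]
    gcongr
    calc C ≤ 1 + C := by linarith
      _ ≤ (1 + C) ^ (d + 1) := le_self_pow₀ (by linarith) (by omega)
  linarith

lemma abp (d : ℕ) (δ K : ℝ) (hδ : 0 < δ) (hK : 0 ≤ K) :
    ∃ N : ℝ, 0 < N ∧ ∀ (w wt : ZZ d → ℝ) (G : ZZ d → EE d)
      (m : ZZ d → Matrix (Fin d) (Fin d) ℝ) (k : ZZ d → EE d) (t0 t1 R : ℝ) (f : ZZ d → ℝ) (Λ m0 : ℝ),
      Sm w wt G m k → t0 ≤ t1 → t1 - t0 ≤ 1 → 0 < R → R ≤ 1 → (∀ z, 0 ≤ f z) → 0 ≤ Λ → 0 ≤ m0 →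
      (∀ z ∈ QQ d t0 t1 R, (z.1 = t1 ∨ ‖z.2‖ = R) → -m0 ≤ w z) →
      (∀ z ∈ DD d t0 t1 R, w z < 0 →
        ∃ a, Ell δ a ∧ wt z + ∑ i, ∑ j, a i j * m z i j ≤ f z + K * ‖G z‖) →
      (∫⁻ z in DD d t0 t1 R, ENNReal.ofReal (f z) ^ (d + 1)) ≤ ENNReal.ofReal (Λ ^ (d + 1)) →
      ∀ z ∈ QQ d t0 t1 R, -(m0 + N * Λ) ≤ w z := by
  obtain ⟨τ, N, hτ, hN, hstrip⟩ := abp_strip d δ K hδ hK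
  obtain ⟨n, hn⟩ := exists_nat_gt (1 / τ)
  have hn1 : 1 ≤ n * τ := by rw [div_lt_iff₀ hτ] at hn; exact hn.le
  have hn0 : 0 < n := by
    rcases Nat.eq_zero_or_pos n with h | h
    · subst h; simp at hn1; linarith
    · exact h
  refine ⟨n * N, by positivity, ?_⟩
  intro w wt G m k t0 t1 R f Λ m0 h ht ht1 hR hR1 hf hΛ hm0 hbd heq hI
  have key : ∀ j : ℕ, ∀ s0, t0 ≤ s0 → s0 ≤ t1 → t1 - s0 ≤ j * τ →
      ∀ z ∈ QQ d s0 t1 R, -(m0 + j * N * Λ) ≤ w z := by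
    intro j
    induction j with
    | zero =>
      intro s0 hs0 hs1 hle z hz
      simp only [Nat.cast_zero, zero_mul, add_zero] at hle ⊢
      apply hbd z ⟨⟨hs0.trans hz.1.1, hz.1.2⟩, hz.2⟩
      left
      have := hz.1.1; have := hz.1.2
      linarith
    | succ j ih =>
      intro s0 hs0 hs1 hle z hz
      push_cast at hle ⊢
      have hNΛ : 0 ≤ N * Λ := by positivity
      -- middle time
      set tm := max s0 (t1 - j * τ) with htm
      have htm1 : tm ≤ t1 := max_le hs1 (by have : 0 ≤ (j:ℝ) * τ := by positivity
                                            linarith)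
      have htm0 : s0 ≤ tm := le_max_left _ _
      have hIH := ih tm (hs0.trans htm0) htm1 (by linarith [le_max_right s0 (t1 - j * τ)])
      rcases le_total tm z.1 with hzt | hzt
      · have := hIH z ⟨⟨hzt, hz.1.2⟩, hz.2⟩
        linarith
      · have hm1 : 0 ≤ m0 + j * N * Λ := by positivity
        have hsub : DD d s0 tm R ⊆ DD d t0 t1 R :=
          prod_mono (Ico_subset_Ico hs0 htm1) le_rfl
        have := hstrip _ _ _ _ _ s0 tm R f Λ (h.aff 1 (m0 + j * N * Λ)) htm0
          (by rw [sub_le_iff_le_add]; exact max_le (by linarith) (by linarith)) hR hR1 hf hΛ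
          (by
            intro y hy hyb
            rcases hyb with hyb | hyb
            · have := hIH y ⟨⟨hyb.ge, hyb.le.trans htm1⟩, hy.2⟩
              linarith
            · have := hbd y ⟨⟨hs0.trans hy.1.1, hy.1.2.trans htm1⟩, hy.2⟩ (Or.inr hyb)
              have : 0 ≤ j * N * Λ := by positivity
              linarith)
          (by
            intro y hy hyn
            simpa using heq y (hsub hy) (by linarith))
          ((lintegral_mono_set hsub).trans hI) z ⟨⟨hz.1.1, hzt⟩, hz.2⟩
        linarith
  intro z hz
  exact key n t0 le_rfl ht (by linarith) z hz
end

open MeasureTheory ENNReal Set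

noncomputable section

open Measure in
/-- expanding maps increase the volume (general Haar version) -/
lemma vol_expand {E : Type*} [NormedAddCommGroup E] [NormedSpace ℝ E] [FiniteDimensional ℝ E]
    [MeasurableSpace E] [BorelSpace E] (μ : Measure E) [μ.IsAddHaarMeasure]
    {M : ℝ} (hM : 0 < M) (s : Set E) (P : E → E)
    (hP : ∀ x ∈ s, ∀ y ∈ s, M * ‖x - y‖ ≤ ‖P x - P y‖) :
    μ s ≤ ENNReal.ofReal (M⁻¹ ^ (Module.finrank ℝ E)) * μ (P '' s) := by
  have hinj : InjOn P s := by
    intro x hx y hy hxy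
    have := hP x hx y hy
    rw [hxy, sub_self, norm_zero] at this
    have h2 : ‖x - y‖ ≤ 0 := by
      by_contra hcon
      push Not at hcon
      nlinarith
    exact sub_eq_zero.1 (norm_le_zero_iff.1 h2)
  have hl : LipschitzOnWith (Real.toNNReal M⁻¹) (Function.invFunOn P s) (P '' s) := by
    apply LipschitzOnWith.of_dist_le_mul
    rintro _ ⟨x, hx, rfl⟩ _ ⟨y, hy, rfl⟩
    rw [hinj.leftInvOn_invFunOn hx, hinj.leftInvOn_invFunOn hy, dist_eq_norm, dist_eq_norm,
      Real.coe_toNNReal _ (by positivity), inv_mul_eq_div, le_div_iff₀ hM, mul_comm]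
    exact hP x hx y hy
  have himg : Function.invFunOn P s '' (P '' s) = s := hinj.invFunOn_image le_rfl
  have h1 := hl.hausdorffMeasure_image_le (d := Module.finrank ℝ E) (by positivity)
  rw [himg] at h1
  have e := isAddLeftInvariant_eq_smul μ (μH[Module.finrank ℝ E] : Measure E)
  rw [e]
  simp only [Measure.smul_apply]
  rw [ENNReal.smul_def, smul_eq_mul, ENNReal.smul_def, smul_eq_mul, mul_left_comm]
  gcongr
  refine h1.trans (le_of_eq ?_)
  rw [ENNReal.rpow_natCast, ENNReal.ofReal_pow (by positivity)]
  rfl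

lemma meas_core {d : ℕ} {M R : ℝ} (hM : 0 < M) (hR : 0 ≤ R) (E H : Set (ZZ d)) (hE : MeasurableSet E)
    (S : ℝ → EE d → ℝ) (hS1 : ∀ t p p', S t p ≤ S t p' + R * ‖p - p'‖)
    (hS2 : ∀ t t' p, t ≤ t' → S t' p + M * (t' - t) ≤ S t p)
    (P : ZZ d → EE d) (hP1 : ∀ z ∈ E, (S z.1 (P z), P z) ∈ H)
    (hP2 : ∀ t x x', (t, x) ∈ E → (t, x') ∈ E → M * ‖x - x'‖ ≤ ‖P (t, x) - P (t, x')‖) :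
    volume E ≤ ENNReal.ofReal (M⁻¹ ^ (d + 1)) * volume H := by
  have hprod : (volume : Measure (ZZ d)) = (volume : Measure ℝ).prod volume := rfl
  set H' := toMeasurable volume H with hH'
  have hH'm : MeasurableSet H' := measurableSet_toMeasurable _ _
  have hScont : ∀ t, Continuous (S t) := by
    intro t
    have : LipschitzWith (Real.toNNReal R) (S t) := by
      apply LipschitzWith.of_dist_le_mul
      intro p p'
      rw [Real.coe_toNNReal _ hR, Real.dist_eq, dist_eq_norm, abs_sub_le_iff]
      have h1 := hS1 t p p'
      have h2 := hS1 t p' p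
      rw [norm_sub_rev] at h2
      constructor <;> linarith
    exact this.continuous
  have hSanti : ∀ p, Antitone (fun t => S t p) := by
    intro p t t' htt
    have := hS2 t t' p htt
    have : 0 ≤ M * (t' - t) := mul_nonneg hM.le (by linarith)
    dsimp only
    linarith
  have hSm : Measurable (fun z : EE d × ℝ => S z.2 z.1) :=
    measurable_uncurry_of_continuous_of_measurable (u := fun p t => S t p)
      (fun t => hScont t) (fun p => (hSanti p).measurable)
  have hSm' : Measurable (fun z : ZZ d => (S z.1 z.2, z.2)) :=
    (hSm.comp measurable_swap).prodMk measurable_snd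
  set E2 : Set (ZZ d) := (fun z : ZZ d => (S z.1 z.2, z.2)) ⁻¹' H' with hE2
  have hE2m : MeasurableSet E2 := hSm' hH'm
  have step1 : volume E ≤ ENNReal.ofReal (M⁻¹ ^ d) * volume E2 := by
    rw [hprod, Measure.prod_apply hE, Measure.prod_apply hE2m,
      ← lintegral_const_mul' _ _ ENNReal.ofReal_ne_top]
    apply lintegral_mono
    intro t
    have := vol_expand (volume : Measure (EE d)) hM (Prod.mk t ⁻¹' E) (fun x => P (t, x))
      (fun x hx y hy => hP2 t x y hx hy)
    rw [finrank_euclideanSpace_fin] at this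
    refine this.trans ?_
    dsimp only
    gcongr
    rintro _ ⟨x, hx, rfl⟩
    exact subset_toMeasurable _ _ (hP1 (t, x) hx)
  have step2 : volume E2 ≤ ENNReal.ofReal M⁻¹ * volume H' := by
    rw [hprod, Measure.prod_apply_symm hE2m, Measure.prod_apply_symm hH'm,
      ← lintegral_const_mul' _ _ ENNReal.ofReal_ne_top]
    apply lintegral_mono
    intro p
    have := vol_expand (volume : Measure ℝ) hM ((fun x => (x, p)) ⁻¹' E2) (fun t => S t p)
      (by
        intro x _ y _
        rw [Real.norm_eq_abs, Real.norm_eq_abs]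
        rcases le_total x y with h | h
        · have := hS2 x y p h
          rw [abs_of_nonpos (by linarith)]
          refine le_trans ?_ (le_abs_self _)
          linarith
        · have := hS2 y x p h
          rw [abs_of_nonneg (by linarith)]
          refine le_trans ?_ (neg_le_abs _)
          linarith)
    rw [Module.finrank_self, pow_one] at this
    refine this.trans ?_
    dsimp only
    gcongr
    rintro _ ⟨x, hx, rfl⟩
    exact hx
  calc volume E ≤ _ := step1
    _ ≤ ENNReal.ofReal (M⁻¹ ^ d) * (ENNReal.ofReal M⁻¹ * volume H') := by gcongr
    _ = _ := by
      rw [hH', measure_toMeasurable, ← mul_assoc, ← ENNReal.ofReal_mul (by positivity), pow_succ]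
end

open MeasureTheory ENNReal Set

noncomputable section

/-- Legendre transform in the future -/
lemma exists_leg {d : ℕ} {w : ZZ d → ℝ} (hw : Continuous w) {t0 t1 R : ℝ} (ht : t0 ≤ t1) (hR : 0 < R) :
    ∃ W : ℝ → EE d → ℝ,
      (∀ t p, ∀ z ∈ QQ d t0 t1 R, min t t1 ≤ z.1 → inner ℝ p z.2 - w z ≤ W t p) ∧
      (∀ t p, ∃ z ∈ QQ d t0 t1 R, min t t1 ≤ z.1 ∧ W t p = inner ℝ p z.2 - w z) := by
  have : ∀ t p, ∃ r : ℝ, (∀ z ∈ QQ d t0 t1 R, min t t1 ≤ z.1 → inner ℝ p z.2 - w z ≤ r) ∧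
      ∃ z ∈ QQ d t0 t1 R, min t t1 ≤ z.1 ∧ r = inner ℝ p z.2 - w z := by
    intro t p
    have hc : IsClosed {z : ZZ d | min t t1 ≤ z.1} := isClosed_le (by fun_prop) (by fun_prop)
    have hcomp := (QQ_compact d t0 t1 R).inter_right hc
    have hne : (QQ d t0 t1 R ∩ {z : ZZ d | min t t1 ≤ z.1}).Nonempty :=
      ⟨(t1, 0), ⟨⟨ht, le_rfl⟩, by simpa using hR.le⟩, (min_le_right _ _ : min t t1 ≤ t1)⟩
    obtain ⟨z, hz, hmax⟩ := hcomp.exists_isMaxOn hne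
      (f := fun z => inner ℝ p z.2 - w z) (by fun_prop)
    exact ⟨_, fun z' hz' hz'' => hmax ⟨hz', hz''⟩, z, hz.1, hz.2, rfl⟩
  choose W h1 h2 using this
  exact ⟨W, h1, h2⟩

section
variable {d : ℕ} {w : ZZ d → ℝ} {t0 t1 R : ℝ} {W : ℝ → EE d → ℝ}

lemma leg_lip (hW1 : ∀ t p, ∀ z ∈ QQ d t0 t1 R, min t t1 ≤ z.1 → inner ℝ p z.2 - w z ≤ W t p)
    (hW2 : ∀ t p, ∃ z ∈ QQ d t0 t1 R, min t t1 ≤ z.1 ∧ W t p = inner ℝ p z.2 - w z)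
    (t : ℝ) (p p' : EE d) : W t p ≤ W t p' + R * ‖p - p'‖ := by
  obtain ⟨z, hz, hzt, e⟩ := hW2 t p
  have h1 := hW1 t p' z hz hzt
  have h2 : inner ℝ (p - p') z.2 ≤ ‖p - p'‖ * ‖z.2‖ := real_inner_le_norm _ _
  have h3 : ‖z.2‖ ≤ R := by simpa using hz.2
  rw [inner_sub_left] at h2
  have := mul_le_mul_of_nonneg_left h3 (norm_nonneg (p - p'))
  rw [e]; linarith

lemma leg_cont (hR : 0 < R)
    (hW1 : ∀ t p, ∀ z ∈ QQ d t0 t1 R, min t t1 ≤ z.1 → inner ℝ p z.2 - w z ≤ W t p)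
    (hW2 : ∀ t p, ∃ z ∈ QQ d t0 t1 R, min t t1 ≤ z.1 ∧ W t p = inner ℝ p z.2 - w z)
    (t : ℝ) : Continuous (W t) := by
  have : LipschitzWith (Real.toNNReal R) (W t) := by
    apply LipschitzWith.of_dist_le_mul
    intro p p'
    rw [Real.coe_toNNReal _ hR.le, Real.dist_eq, dist_eq_norm, abs_sub_le_iff]
    have h1 := leg_lip hW1 hW2 t p p'
    have h2 := leg_lip hW1 hW2 t p' p
    rw [norm_sub_rev] at h2
    constructor <;> linarith
  exact this.continuous

lemma leg_anti (hW1 : ∀ t p, ∀ z ∈ QQ d t0 t1 R, min t t1 ≤ z.1 → inner ℝ p z.2 - w z ≤ W t p)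
    (hW2 : ∀ t p, ∃ z ∈ QQ d t0 t1 R, min t t1 ≤ z.1 ∧ W t p = inner ℝ p z.2 - w z)
    (t t' : ℝ) (htt : t ≤ t') (p : EE d) : W t' p ≤ W t p := by
  obtain ⟨z, hz, hzt, e⟩ := hW2 t' p
  rw [e]
  exact hW1 t p z hz ((min_le_min_right _ htt).trans hzt)

/-- a maximizer for the second Legendre transform exists -/
lemma leg_max (hw : Continuous w) (ht : t0 ≤ t1) (hR : 0 < R)
    (hW1 : ∀ t p, ∀ z ∈ QQ d t0 t1 R, min t t1 ≤ z.1 → inner ℝ p z.2 - w z ≤ W t p)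
    (hW2 : ∀ t p, ∃ z ∈ QQ d t0 t1 R, min t t1 ≤ z.1 ∧ W t p = inner ℝ p z.2 - w z)
    (t : ℝ) (x : EE d) (hx : ‖x‖ < R) :
    ∃ p0, ∀ q, inner ℝ q x - W t q ≤ inner ℝ p0 x - W t p0 := by
  have hWc := leg_cont hR hW1 hW2 t
  obtain ⟨B, hB⟩ : ∃ B, ∀ z ∈ QQ d t0 t1 R, w z ≤ B := by
    obtain ⟨B, hB⟩ := ((QQ_compact d t0 t1 R).bddAbove_image hw.continuousOn)
    exact ⟨B, fun z hz => hB ⟨z, hz, rfl⟩⟩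
  have hlow : ∀ p, R * ‖p‖ - B ≤ W t p := by
    intro p
    have hz : ((t1, (R * ‖p‖⁻¹) • p) : ZZ d) ∈ QQ d t0 t1 R := by
      refine ⟨⟨ht, le_rfl⟩, ?_⟩
      simp only [mem_closedBall_zero_iff, norm_smul, norm_mul, norm_inv, norm_norm,
        Real.norm_of_nonneg hR.le]
      by_cases hp : ‖p‖ = 0
      · simp [hp, hR.le]
      · rw [mul_assoc, inv_mul_cancel₀ hp, mul_one]
    have h1 := hW1 t p _ hz (min_le_right _ _)
    have h2 := hB _ hz
    simp only [inner_smul_right, real_inner_self_eq_norm_sq] at h1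
    have : R * ‖p‖⁻¹ * ‖p‖ ^ 2 = R * ‖p‖ := by
      by_cases hp : ‖p‖ = 0
      · simp [hp]
      · field_simp
    linarith
  obtain ⟨p0, hp0⟩ := Continuous.exists_forall_le_of_isBounded
    (f := fun q : EE d => W t q - inner ℝ q x) (by fun_prop) 0 (by
      apply (Metric.isBounded_closedBall (x := (0 : EE d)) (r := (W t 0 + B) / (R - ‖x‖))).subset
      intro q hq
      simp only [mem_ofPred_eq, inner_zero_left, sub_zero] at hq
      rw [mem_closedBall_zero_iff, le_div_iff₀ (by linarith)]
      have h1 := hlow q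
      have h2 : inner ℝ q x ≤ ‖q‖ * ‖x‖ := real_inner_le_norm _ _
      nlinarith)
  refine ⟨p0, fun q => ?_⟩
  have := hp0 q
  linarith

lemma leg_S (ht : t0 ≤ t1) (hR : 0 < R) {M : ℝ} (hM : 0 < M)
    (hW1 : ∀ t p, ∀ z ∈ QQ d t0 t1 R, min t t1 ≤ z.1 → inner ℝ p z.2 - w z ≤ W t p)
    (hW2 : ∀ t p, ∃ z ∈ QQ d t0 t1 R, min t t1 ≤ z.1 ∧ W t p = inner ℝ p z.2 - w z) :
    ∃ S : ℝ → EE d → ℝ, (∀ t p q, S t p ≤ W t q + ‖p - q‖ ^ 2 / (2 * M) - M * t) ∧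
      (∀ t p, ∃ q, S t p = W t q + ‖p - q‖ ^ 2 / (2 * M) - M * t) := by
  have : ∀ t p, ∃ q0, ∀ q, W t q0 + ‖p - q0‖ ^ 2 / (2 * M) ≤ W t q + ‖p - q‖ ^ 2 / (2 * M) := by
    intro t p
    have hWc := leg_cont hR hW1 hW2 t
    have hlow : ∀ q, - w (t1, 0) ≤ W t q := by
      intro q
      have := hW1 t q (t1, 0) ⟨⟨ht, le_rfl⟩, by simpa using hR.le⟩ (min_le_right _ _)
      simpa using this
    apply Continuous.exists_forall_le_of_isBounded
      (f := fun q : EE d => W t q + ‖p - q‖ ^ 2 / (2 * M)) (by fun_prop) p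
    apply (Metric.isBounded_closedBall (x := p)
      (r := (W t p + w (t1, 0)) * (2 * M) + 1)).subset
    intro q hq
    simp only [mem_ofPred_eq, sub_self, norm_zero] at hq
    rw [Metric.mem_closedBall, dist_comm, dist_eq_norm]
    have h1 := hlow q
    have h2 : ‖p - q‖ ^ 2 / (2 * M) ≤ W t p + w (t1, 0) := by
      have : (0:ℝ) ^ 2 / (2 * M) = 0 := by simp
      linarith
    rw [div_le_iff₀ (by positivity)] at h2
    nlinarith [sq_nonneg (‖p - q‖ - 1), norm_nonneg (p - q)]
  choose q0 hq0 using this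
  exact ⟨fun t p => W t (q0 t p) + ‖p - q0 t p‖ ^ 2 / (2 * M) - M * t,
    fun t p q => by have := hq0 t p q; linarith, fun t p => ⟨_, rfl⟩⟩


lemma grad_eq {wt : ZZ d → ℝ} {G : ZZ d → EE d} {m : ZZ d → Matrix (Fin d) (Fin d) ℝ}
    {k : ZZ d → EE d} (h : Sm w wt G m k) (z : ZZ d) (hz : ‖z.2‖ < R) (p : EE d)
    (hp : ∀ x', ‖x'‖ ≤ R → w z + inner ℝ p (x' - z.2) ≤ w (z.1, x')) : G z = p := by
  set η := G z - p with hη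
  have h1 := h.derivx z.1 z.2 η 0
  have h2 : HasDerivAt (fun s : ℝ => s * inner ℝ p η) (inner ℝ p η) 0 := by
    simpa using (hasDerivAt_id (0:ℝ)).mul_const (inner ℝ p η)
  have h3 := h1.sub h2
  have hmin : IsLocalMin ((fun s : ℝ => w (z.1, z.2 + s • η)) - (fun s : ℝ => s * inner ℝ p η)) 0 := by
    have hc : Continuous (fun s : ℝ => ‖z.2 + s • η‖) := by fun_prop
    have : ∀ᶠ s in nhds (0:ℝ), ‖z.2 + s • η‖ < R := by
      apply hc.continuousAt.eventually_lt_const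
      simpa using hz
    filter_upwards [this] with s hs
    have := hp _ hs.le
    simp only [add_sub_cancel_left, inner_smul_right] at this
    simp only [Pi.sub_apply, zero_smul, add_zero, zero_mul, sub_zero]
    linarith
  have h4 := hmin.hasDerivAt_eq_zero h3
  simp only [zero_smul, add_zero, ← inner_sub_left] at h4
  have h5 : inner ℝ η η = 0 := h4
  rw [inner_self_eq_zero] at h5
  exact sub_eq_zero.1 h5

/-- `v + M (|x|²/2 + t)` -/
def wM (v : ZZ d → ℝ) (M : ℝ) (z : ZZ d) : ℝ := v z + M * (‖z.2‖ ^ 2 / 2 + z.1)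

def gM (G : ZZ d → EE d) (M : ℝ) (z : ZZ d) : EE d := G z + M • z.2

lemma sm_wM {v vt : ZZ d → ℝ} {G : ZZ d → EE d} {m : ZZ d → Matrix (Fin d) (Fin d) ℝ}
    {k : ZZ d → EE d} (h : Sm v vt G m k) (M : ℝ) : Sm (wM v M) (fun z => vt z + M) (gM G M)
      (fun z => m z + M • (1 : Matrix (Fin d) (Fin d) ℝ)) k := h.para M

lemma core_geom {v vt : ZZ d → ℝ} {G : ZZ d → EE d} {m : ZZ d → Matrix (Fin d) (Fin d) ℝ}
    {k : ZZ d → EE d} (h : Sm v vt G m k) (ht : t0 ≤ t1) (hR : 0 < R) {M : ℝ} (hM : 0 < M)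
    (hv : ∀ z ∈ QQ d t0 t1 R, 0 ≤ v z ∧ v z ≤ 1) :
    ∃ (S : ℝ → EE d → ℝ) (P : ZZ d → EE d),
      (∀ t p p', S t p ≤ S t p' + R * ‖p - p'‖) ∧
      (∀ t t' p, t ≤ t' → S t' p + M * (t' - t) ≤ S t p) ∧
      (∀ z ∈ DD d t0 t1 R, z ∉ Ct (wM v M) (gM G M) t0 t1 R → t0 + 1 / M < z.1 →
        ‖z.2‖ < R - 4 / √M → (S z.1 (P z), P z) ∈ Phi (wM v (2 * M)) (gM G (2 * M)) ''
          ((Ct (wM v (2 * M)) (gM G (2 * M)) t0 t1 R \ Ct (wM v M) (gM G M) t0 t1 R) ∩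
            {y | ‖y.2‖ < R - 2 / √M})) ∧
      (∀ t x x', ‖x‖ < R → ‖x'‖ < R → M * ‖x - x'‖ ≤ ‖P (t, x) - P (t, x')‖) := by
  have hsm1 := sm_wM h M
  have hsm2 := sm_wM h (2 * M)
  obtain ⟨W, hW1, hW2⟩ := exists_leg hsm1.cont ht hR
  obtain ⟨S, hS1, hS2⟩ := leg_S ht hR hM hW1 hW2
  have hex : ∀ z : ZZ d, ∃ p0, ‖z.2‖ < R → ∀ q, inner ℝ q z.2 - W z.1 q ≤ inner ℝ p0 z.2 - W z.1 p0 := by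
    intro z
    by_cases hz : ‖z.2‖ < R
    · obtain ⟨p0, hp0⟩ := leg_max hsm1.cont ht hR hW1 hW2 z.1 z.2 hz
      exact ⟨p0, fun _ => hp0⟩
    · exact ⟨0, fun h => absurd h hz⟩
  choose p0 hp0 using hex
  refine ⟨S, fun z => p0 z + M • z.2, ?_, ?_, ?_, ?_⟩
  · intro t p p'
    obtain ⟨q, hq⟩ := hS2 t p'
    have h1 := hS1 t p (q + (p - p'))
    have h2 := leg_lip hW1 hW2 t (q + (p - p')) q
    have e1 : q + (p - p') - q = p - p' := by abel
    have e2 : p - (q + (p - p')) = p' - q := by abel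
    rw [e1] at h2
    rw [e2] at h1
    linarith
  · intro t t' p htt
    obtain ⟨q, hq⟩ := hS2 t p
    have h1 := hS1 t' p q
    have h2 := leg_anti hW1 hW2 t t' htt q
    linarith
  · intro z hzD hzC hzt hzx
    obtain ⟨t, x⟩ := z
    simp only at hzt hzx
    have hsq : 0 < √M := Real.sqrt_pos.2 hM
    have hsqM : √M ^ 2 = M := Real.sq_sqrt hM.le
    have hxR : ‖x‖ < R := by
      have : 0 < 4 / √M := by positivity
      linarith
    have htt1 : t < t1 := hzD.1.2
    have htt0 : t0 ≤ t := hzD.1.1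
    have hmin : min t t1 = t := min_eq_left htt1.le
    set q0 := p0 (t, x) with hq0
    have hopt : ∀ q, inner ℝ q x - W t q ≤ inner ℝ q0 x - W t q0 := hp0 (t, x) hxR
    set p := q0 + M • x with hp
    set hh := W t q0 + M * ‖x‖ ^ 2 / 2 - M * t with hhh
    -- value of S
    have hSval : S t p = hh := by
      apply le_antisymm
      · have := hS1 t p q0
        have e : p - q0 = M • x := by rw [hp]; abel
        rw [e, norm_smul, Real.norm_of_nonneg hM.le, mul_pow] at this
        have e2 : M ^ 2 * ‖x‖ ^ 2 / (2 * M) = M * ‖x‖ ^ 2 / 2 := by field_simp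
        rw [e2] at this
        exact this
      · obtain ⟨q, hq⟩ := hS2 t p
        rw [hq]
        have h1 := hopt q
        have e : p - q = M • x - (q - q0) := by rw [hp]; abel
        have e2 : ‖p - q‖ ^ 2 = M ^ 2 * ‖x‖ ^ 2 - 2 * (M * (inner ℝ q x - inner ℝ q0 x)) + ‖q - q0‖ ^ 2 := by
          rw [e, norm_sub_sq_real, norm_smul, Real.norm_of_nonneg hM.le, mul_pow, inner_smul_left,
            inner_sub_right, real_inner_comm, real_inner_comm q0 x]
          simp
        have e3 : ‖p - q‖ ^ 2 / (2 * M) = M * ‖x‖ ^ 2 / 2 - (inner ℝ q x - inner ℝ q0 x) +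
            ‖q - q0‖ ^ 2 / (2 * M) := by
          rw [e2]; field_simp
        have : 0 ≤ ‖q - q0‖ ^ 2 / (2 * M) := by positivity
        rw [e3]
        linarith
    -- (a)
    have ha : ∀ z' : ZZ d, wM v (2 * M) z' - (inner ℝ p z'.2 - hh) =
        (wM v M z' - inner ℝ q0 z'.2 + W t q0) + M / 2 * ‖z'.2 - x‖ ^ 2 + M * (z'.1 - t) := by
      intro z'
      rw [norm_sub_sq_real, hp, hhh, inner_add_left, inner_smul_left, real_inner_comm x z'.2]
      simp only [wM, conj_trivial]
      ring
    have hbr : ∀ z' ∈ QQ d t0 t1 R, t ≤ z'.1 → 0 ≤ wM v M z' - inner ℝ q0 z'.2 + W t q0 := by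
      intro z' hz' hle
      have := hW1 t q0 z' hz' (by rw [hmin]; exact hle)
      linarith
    have hzQ : ((t, x) : ZZ d) ∈ QQ d t0 t1 R := DD_sub _ _ _ _ hzD
    have hbz : 0 < wM v M (t, x) - inner ℝ q0 x + W t q0 := by
      by_contra hcon
      push Not at hcon
      apply hzC
      have hcont : ∀ z' ∈ QQ d t0 t1 R, t ≤ z'.1 →
          wM v M (t, x) + inner ℝ q0 (z'.2 - x) ≤ wM v M z' := by
        intro z' hz' hle
        have := hbr z' hz' hle
        rw [inner_sub_right]
        linarith
      have hG : gM G M (t, x) = q0 := by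
        apply grad_eq hsm1 (t, x) hxR
        intro x' hx'
        exact hcont (t, x') ⟨⟨htt0, htt1.le⟩, by simpa using hx'⟩ le_rfl
      refine ⟨hzD, fun z' hz' hlt => ?_⟩
      rw [hG]
      exact hcont z' hz' hlt.le
    have hpos : ∀ z' ∈ QQ d t0 t1 R, t ≤ z'.1 → 0 < wM v (2 * M) z' - (inner ℝ p z'.2 - hh) := by
      intro z' hz' hle
      rw [ha z']
      have h1 := hbr z' hz' hle
      have h2 : 0 ≤ M / 2 * ‖z'.2 - x‖ ^ 2 := by positivity
      have h3 : 0 ≤ M * (z'.1 - t) := mul_nonneg hM.le (by linarith)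
      rcases hle.lt_or_eq with hlt | heq
      · have : 0 < M * (z'.1 - t) := mul_pos hM (by linarith)
        linarith
      · by_cases hx' : z'.2 = x
        · have : z' = (t, x) := Prod.ext heq.symm hx'
          rw [this] at h2 h3 ⊢
          simp only at h2 h3 ⊢
          linarith
        · have : 0 < M / 2 * ‖z'.2 - x‖ ^ 2 := by
            have : 0 < ‖z'.2 - x‖ := norm_pos_iff.2 (sub_ne_zero.2 hx')
            positivity
          linarith
    -- (c)
    have hWMx : W t (M • x) ≤ M * ‖x‖ ^ 2 / 2 - M * t := by
      obtain ⟨z', hz', hle, e⟩ := hW2 t (M • x)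
      rw [hmin] at hle
      rw [e, inner_smul_left]
      simp only [wM, conj_trivial]
      have h1 := (hv z' hz').1
      have h2 : 0 ≤ M * ‖z'.2 - x‖ ^ 2 := by positivity
      rw [norm_sub_sq_real, real_inner_comm] at h2
      have h3 : M * t ≤ M * z'.1 := mul_le_mul_of_nonneg_left hle hM.le
      linarith
    have hc : ∀ t', wM v (2 * M) (t', x) - (inner ℝ p x - hh) ≤ v (t', x) + 2 * M * (t' - t) := by
      intro t'
      have h1 := hopt (M • x)
      rw [inner_smul_left, real_inner_self_eq_norm_sq] at h1
      rw [hp, hhh, inner_add_left, inner_smul_left, real_inner_self_eq_norm_sq]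
      simp only [wM, conj_trivial] at h1 ⊢
      linarith
    have hM2 : 2 * M * (1 / (2 * M)) = 1 := by field_simp
    have hM3 : 1 / (2 * M) < 1 / M := by
      apply one_div_lt_one_div_of_lt hM; linarith
    have hM4 : 0 < 1 / (2 * M) := by positivity
    have hz0Q : ((t - 1 / (2 * M), x) : ZZ d) ∈ QQ d t0 t1 R :=
      ⟨⟨by simp only; linarith, by simp only; linarith⟩, hzQ.2⟩
    have hlow : ∀ z' ∈ QQ d t0 t1 R, t - 1 / (2 * M) ≤ z'.1 → z'.1 < t →
        M / 2 * ‖z'.2 - x‖ ^ 2 - 2 ≤ wM v (2 * M) z' - (inner ℝ p z'.2 - hh) := by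
      intro z' hz' hge hlt
      have hzt : ((t, z'.2) : ZZ d) ∈ QQ d t0 t1 R := ⟨⟨htt0, htt1.le⟩, hz'.2⟩
      have h1 := ha (t, z'.2)
      have h2 := hbr (t, z'.2) hzt le_rfl
      have h3 := hv _ hzt
      have h4 := hv _ hz'
      have h5 := mul_le_mul_of_nonneg_left hge hM.le
      simp only [wM, sub_self, mul_zero] at h1 h2 h3 ⊢
      linarith
    have hfar : ∀ y : EE d, 2 / √M < ‖y - x‖ → 0 < M / 2 * ‖y - x‖ ^ 2 - 2 := by
      intro y hy
      have h1 : (2 / √M) ^ 2 < ‖y - x‖ ^ 2 := pow_lt_pow_left₀ hy (by positivity) two_ne_zero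
      rw [div_pow, hsqM, div_lt_iff₀ hM] at h1
      linarith
    obtain ⟨y, hyC, hyt, hyP⟩ := touch hsm2 p hh hz0Q (by
        have := hc (t - 1 / (2 * M))
        have := (hv _ hz0Q).2
        simp only
        have e : 2 * M * (t - 1 / (2 * M) - t) = -1 := by
          linear_combination -hM2
        linarith) (by
        intro z' hz' hge hb
        rcases le_or_gt t z'.1 with hle | hlt
        · linarith [hpos z' hz' hle]
        · rcases hb with hb | hb
          · linarith
          · have h1 := hlow z' hz' hge hlt
            have h2 := hfar z'.2 (by
              have h3 : ‖z'.2‖ ≤ ‖z'.2 - x‖ + ‖x‖ := by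
                simpa using norm_add_le (z'.2 - x) x
              have h4 : 2 / √M ≤ 4 / √M := by gcongr; norm_num
              linarith)
            linarith)
    have hyQ := DD_sub _ _ _ _ hyC.1
    have hGy : gM G (2 * M) y = p := congrArg Prod.snd hyP
    have hwy : inner ℝ y.2 (gM G (2 * M) y) - wM v (2 * M) y = hh := congrArg Prod.fst hyP
    rw [hGy, real_inner_comm] at hwy
    have hyt' : y.1 < t := by
      by_contra hcon
      push Not at hcon
      linarith [hpos y hyQ hcon]
    have hyx : ‖y.2 - x‖ ≤ 2 / √M := by
      by_contra hcon
      push Not at hcon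
      have h1 := hfar y.2 hcon
      have h2 := hlow y hyQ hyt hyt'
      linarith
    refine ⟨y, ⟨⟨hyC, ?_⟩, ?_⟩, ?_⟩
    · intro hyM
      have hle := Ct_le hsm1 hyM
      have hG1 : gM G M y = p - M • y.2 := by
        rw [← hGy]
        simp only [gM]
        rw [two_mul, add_smul]
        abel
      have h1 : W t (p - M • y.2) ≤ inner ℝ (p - M • y.2) y.2 - wM v M y := by
        obtain ⟨z', hz', hle', e⟩ := hW2 t (p - M • y.2)
        rw [hmin] at hle'
        have := hle z' hz' (by linarith)
        rw [hG1, inner_sub_right] at this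
        rw [e]; linarith
      have h2 := hopt (p - M • y.2)
      have hwy2 : wM v M y = wM v (2 * M) y - M * (‖y.2‖ ^ 2 / 2 + y.1) := by
        simp only [wM]; ring
      have e5 : q0 = p - M • x := by rw [hp]; abel
      have e6 : W t q0 = hh - M * ‖x‖ ^ 2 / 2 + M * t := by rw [hhh]; ring
      rw [e6, e5] at h2
      rw [hwy2] at h1
      simp only [inner_sub_left, inner_smul_left, real_inner_self_eq_norm_sq, conj_trivial] at h1 h2
      have h7 : 0 ≤ M * ‖y.2 - x‖ ^ 2 := by positivity
      rw [norm_sub_sq_real] at h7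
      have h8 : M * y.1 < M * t := mul_lt_mul_of_pos_left hyt' hM
      linarith
    · have h3 : ‖y.2‖ ≤ ‖y.2 - x‖ + ‖x‖ := by
        simpa using norm_add_le (y.2 - x) x
      have h4 : 4 / √M = 2 / √M + 2 / √M := by ring
      show ‖y.2‖ < R - 2 / √M
      linarith
    · rw [hyP]
      simp only
      rw [← hq0, ← hp, hSval]
  · intro t x x' hx hx'
    have h1 := hp0 (t, x) hx (p0 (t, x'))
    have h2 := hp0 (t, x') hx' (p0 (t, x))
    simp only at h1 h2 ⊢
    set a := p0 (t, x)
    set b := p0 (t, x')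
    have h3 : 0 ≤ inner ℝ (a - b) (x - x') := by
      simp only [inner_sub_left, inner_sub_right]
      linarith
    have e : a + M • x - (b + M • x') = (a - b) + M • (x - x') := by
      rw [smul_sub]; abel
    have h4 : M * ‖x - x'‖ ^ 2 ≤ inner ℝ (a + M • x - (b + M • x')) (x - x') := by
      rw [e, inner_add_left, inner_smul_left, real_inner_self_eq_norm_sq]
      simp only [conj_trivial]
      linarith
    have h5 := real_inner_le_norm (a + M • x - (b + M • x')) (x - x')
    by_cases h0 : ‖x - x'‖ = 0
    · rw [h0]; simp
    · have : 0 < ‖x - x'‖ := lt_of_le_of_ne (norm_nonneg _) (Ne.symm h0)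
      apply le_of_mul_le_mul_right _ this
      calc M * ‖x - x'‖ * ‖x - x'‖ = M * ‖x - x'‖ ^ 2 := by ring
        _ ≤ _ := h4.trans h5
end
end

open MeasureTheory ENNReal Set

noncomputable section

lemma pow_sub_pow_le_mul (n : ℕ) {s R : ℝ} (hs : 0 ≤ s) (hsR : s ≤ R) (hR : R ≤ 1) :
    R ^ n - s ^ n ≤ n * (R - s) := by
  induction n with
  | zero => simp
  | succ n ih =>
    have e : R ^ (n + 1) - s ^ (n + 1) = R * (R ^ n - s ^ n) + s ^ n * (R - s) := by ring
    have h1 : s ^ n ≤ 1 := pow_le_one₀ hs (hsR.trans hR)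
    have h2 : s ^ n ≤ R ^ n := pow_le_pow_left₀ hs hsR n
    rw [e]; push_cast
    have h3 : R * (R ^ n - s ^ n) ≤ 1 * (R ^ n - s ^ n) :=
      mul_le_mul_of_nonneg_right hR (by linarith)
    have h4 : s ^ n * (R - s) ≤ 1 * (R - s) := mul_le_mul_of_nonneg_right h1 (by linarith)
    linarith

lemma vol_shell {d : ℕ} (hd : 1 ≤ d) {t0 t1 R η : ℝ} (ht1 : t1 - t0 ≤ 1) (hR : 0 < R)
    (hR1 : R ≤ 1) (hη : 0 < η) :
    volume {z : ZZ d | z ∈ DD d t0 t1 R ∧ R - η ≤ ‖z.2‖} ≤ ENNReal.ofReal (d * om d * η) := by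
  have hprod : (volume : Measure (ZZ d)) = (volume : Measure ℝ).prod volume := rfl
  have hom := om_pos d
  have hd1 : (1 : ℝ) ≤ d := by exact_mod_cast hd
  have e : {z : ZZ d | z ∈ DD d t0 t1 R ∧ R - η ≤ ‖z.2‖} =
      Ico t0 t1 ×ˢ (Metric.ball (0 : EE d) R \ Metric.ball (0 : EE d) (R - η)) := by
    ext z
    simp [DD, and_assoc]
  rw [e, hprod, Measure.prod_prod, Real.volume_Ico]
  have h1 : volume (Metric.ball (0 : EE d) R \ Metric.ball (0 : EE d) (R - η)) ≤
      ENNReal.ofReal (d * om d * η) := by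
    rcases le_or_gt (R - η) 0 with h | h
    · refine (measure_mono sdiff_subset).trans ?_
      rw [vol_ball d hR]
      apply ENNReal.ofReal_le_ofReal
      have : R ^ d ≤ R := pow_le_of_le_one hR.le hR1 (by omega)
      calc R ^ d * om d ≤ η * om d := by gcongr; linarith
        _ = 1 * om d * η := by ring
        _ ≤ _ := by gcongr
    · rw [measure_sdiff (Metric.ball_subset_ball (by linarith)) measurableSet_ball.nullMeasurableSet
        measure_ball_lt_top.ne, vol_ball d hR, vol_ball d h, ← ENNReal.ofReal_sub _ (by positivity)]
      apply ENNReal.ofReal_le_ofReal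
      have := pow_sub_pow_le_mul d h.le (by linarith) hR1
      calc R ^ d * om d - (R - η) ^ d * om d = (R ^ d - (R - η) ^ d) * om d := by ring
        _ ≤ (d * (R - (R - η))) * om d := by gcongr
        _ = _ := by ring
  calc ENNReal.ofReal (t1 - t0) * _ ≤ 1 * ENNReal.ofReal (d * om d * η) := by
        gcongr
        rw [← ENNReal.ofReal_one]
        exact ENNReal.ofReal_le_ofReal ht1
    _ = _ := one_mul _

lemma vol_bottom {d : ℕ} {t0 t1 R η : ℝ} (hR : 0 < R) (hR1 : R ≤ 1) :
    volume {z : ZZ d | z ∈ DD d t0 t1 R ∧ z.1 ≤ t0 + η} ≤ ENNReal.ofReal (om d * η) := by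
  have hprod : (volume : Measure (ZZ d)) = (volume : Measure ℝ).prod volume := rfl
  have hom := om_pos d
  have e : {z : ZZ d | z ∈ DD d t0 t1 R ∧ z.1 ≤ t0 + η} ⊆
      Icc t0 (t0 + η) ×ˢ (Metric.ball (0 : EE d) R) := by
    rintro z ⟨h1, h2⟩
    exact ⟨⟨h1.1.1, h2⟩, h1.2⟩
  refine (measure_mono e).trans ?_
  rw [hprod, Measure.prod_prod, Real.volume_Icc, vol_ball d hR, ← ENNReal.ofReal_mul' (by positivity)]
  have : R ^ d ≤ 1 := pow_le_one₀ hR.le hR1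
  rcases le_or_gt 0 η with h | h
  · apply ENNReal.ofReal_le_ofReal
    calc (t0 + η - t0) * (R ^ d * om d) = η * (R ^ d * om d) := by ring
      _ ≤ η * (1 * om d) := by gcongr
      _ = _ := by ring
  · rw [ENNReal.ofReal_of_nonpos]
    · simp
    · have : 0 ≤ R ^ d * om d := by positivity
      nlinarith

section
variable {d : ℕ} {t0 t1 R : ℝ} {v vt : ZZ d → ℝ} {G : ZZ d → EE d}
  {m : ZZ d → Matrix (Fin d) (Fin d) ℝ} {k : ZZ d → EE d}

lemma grad_bd (h : Sm v vt G m k) (hv : ∀ z ∈ QQ d t0 t1 R, 0 ≤ v z ∧ v z ≤ 1) {L r : ℝ}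
    (hL : 0 ≤ L) (hr : 0 < r) {z : ZZ d} (hz : z ∈ Ct (wM v L) (gM G L) t0 t1 R) (hzr : ‖z.2‖ + r ≤ R) :
    r * ‖G z‖ ≤ 1 + L * r ^ 2 / 2 := by
  by_cases h0 : ‖G z‖ = 0
  · rw [h0, mul_zero]; positivity
  · set e : EE d := (r * ‖G z‖⁻¹) • G z with he
    have hen : ‖e‖ = r := by
      rw [he, norm_smul, norm_mul, norm_inv, norm_norm, Real.norm_of_nonneg hr.le, mul_assoc,
        inv_mul_cancel₀ h0, mul_one]
    have hQ : ((z.1, z.2 + e) : ZZ d) ∈ QQ d t0 t1 R := by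
      refine ⟨⟨hz.1.1.1, hz.1.1.2.le⟩, ?_⟩
      rw [mem_closedBall_zero_iff]
      refine (norm_add_le _ _).trans ?_
      rw [hen]; exact hzr
    have h1 := Ct_le (sm_wM h L) hz _ hQ le_rfl
    simp only [wM, gM, add_sub_cancel_left, inner_add_left, inner_smul_left, conj_trivial,
      norm_add_sq_real] at h1
    have h2 : inner ℝ (G z) e = r * ‖G z‖ := by
      rw [he, inner_smul_right, real_inner_self_eq_norm_sq]
      field_simp
    rw [h2, hen] at h1
    have h3 := hv _ hQ
    have h4 := hv z (DD_sub _ _ _ _ hz.1)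
    linarith

lemma Ell.sum_shift {δ : ℝ} {a : Matrix (Fin d) (Fin d) ℝ} (ha : Ell δ a)
    (B : Matrix (Fin d) (Fin d) ℝ) {M : ℝ} (hM : 0 ≤ M) :
    ∑ i, ∑ j, a i j * (B + M • (1 : Matrix (Fin d) (Fin d) ℝ)) i j ≤
      (∑ i, ∑ j, a i j * B i j) + M * (d * δ⁻¹) := by
  have h1 : ∀ i, ∑ j, a i j * (B + M • (1 : Matrix (Fin d) (Fin d) ℝ)) i j =
      (∑ j, a i j * B i j) + M * a i i := by
    intro i
    simp only [Matrix.add_apply, Matrix.smul_apply, Matrix.one_apply, mul_add, Finset.sum_add_distrib,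
      smul_eq_mul, mul_ite, mul_one, mul_zero, Finset.sum_ite_eq, Finset.mem_univ, if_true]
    ring
  simp_rw [h1, Finset.sum_add_distrib]
  gcongr
  rw [← Finset.mul_sum]
  gcongr
  calc ∑ i, a i i ≤ ∑ _i : Fin d, δ⁻¹ := Finset.sum_le_sum fun i _ => ha.diag_le i
    _ = _ := by simp

lemma core_step (hd : 1 ≤ d) {δ K : ℝ} (hδ : 0 < δ) (hK : 0 ≤ K) :
    ∃ C : ℝ, 1 ≤ C ∧ ∀ (v vt : ZZ d → ℝ) (G : ZZ d → EE d) (m : ZZ d → Matrix (Fin d) (Fin d) ℝ)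
      (k : ZZ d → EE d) (t0 t1 R : ℝ) (g : ZZ d → ℝ), Sm v vt G m k → t0 ≤ t1 → t1 - t0 ≤ 1 →
      0 < R → R ≤ 1 → (∀ z ∈ QQ d t0 t1 R, 0 ≤ v z ∧ v z ≤ 1) →
      (∀ z ∈ DD d t0 t1 R, ∃ a, Ell δ a ∧
        vt z + ∑ i, ∑ j, a i j * m z i j ≤ g z + K * (1 + ‖G z‖)) →
      (∫⁻ z in DD d t0 t1 R, ENNReal.ofReal (g z) ^ (d + 1)) ≤ 1 →
      ∀ M : ℝ, 1 ≤ M → volume (DD d t0 t1 R \ Ct (wM v M) (gM G M) t0 t1 R) ≤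
        ENNReal.ofReal (C / √M) + ENNReal.ofReal C *
          volume (Ct (wM v (2 * M)) (gM G (2 * M)) t0 t1 R \ Ct (wM v M) (gM G M) t0 t1 R) := by
  have hom := om_pos d
  set C1 : ℝ := 3 * K + 2 + 2 * (d * δ⁻¹) with hC1
  have hC10 : 0 < C1 := by positivity
  set C2 : ℝ := δ⁻¹ ^ d * 2 ^ (d + 1) * (1 + C1 ^ (d + 1)) with hC2
  have hC20 : 0 < C2 := by positivity
  refine ⟨1 + C2 + om d + d * om d * 4, by have : 0 ≤ d * om d * 4 := by positivity
                                           linarith, ?_⟩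
  intro v vt G m k t0 t1 R g h ht ht1 hR hR1 hv heq hI M hM
  have hM0 : 0 < M := by linarith
  have hsq : 0 < √M := Real.sqrt_pos.2 hM0
  have hsq1 : 1 ≤ √M := Real.one_le_sqrt.2 hM
  have hsqM : √M * √M = M := Real.mul_self_sqrt hM0.le
  have hsqle : √M ≤ M := by nlinarith
  set AM := Ct (wM v M) (gM G M) t0 t1 R with hAM
  set A2 := Ct (wM v (2 * M)) (gM G (2 * M)) t0 t1 R with hA2
  have hAMm : MeasurableSet AM := Ct_meas (sm_wM h M)
  have hA2m : MeasurableSet A2 := Ct_meas (sm_wM h (2 * M))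
  obtain ⟨S, P, hS1, hS2, hP1, hP2⟩ := core_geom h ht hR hM0 hv
  set S0 : Set (ZZ d) := (A2 \ AM) ∩ {y | ‖y.2‖ < R - 2 / √M} with hS0
  have hS0m : MeasurableSet S0 := by
    have e : MeasurableSet {y : ZZ d | ‖y.2‖ < R - 2 / √M} :=
      (isOpen_lt (by fun_prop) (by fun_prop)).measurableSet
    exact (hA2m.diff hAMm).inter e
  set E : Set (ZZ d) := (DD d t0 t1 R \ AM) ∩ ({z | t0 + 1 / M < z.1} ∩ {z | ‖z.2‖ < R - 4 / √M}) with hE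
  have hEm : MeasurableSet E := by
    have e : MeasurableSet {y : ZZ d | ‖y.2‖ < R - 4 / √M} :=
      (isOpen_lt (by fun_prop) (by fun_prop)).measurableSet
    have e' : MeasurableSet {z : ZZ d | t0 + 1 / M < z.1} :=
      (isOpen_lt (by fun_prop) (by fun_prop)).measurableSet
    exact ((DD_meas _ _ _ _).diff hAMm).inter (e'.inter e)
  have hER : ∀ t x, (t, x) ∈ E → ‖x‖ < R := by
    intro t x hx
    have := hx.1.1.2
    simpa using this
  have h1 := meas_core hM0 hR.le E (Phi (wM v (2 * M)) (gM G (2 * M)) '' S0) hEm S hS1 hS2 P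
    (fun z hz => hP1 z hz.1.1 hz.1.2 hz.2.1 hz.2.2)
    (fun t x x' hx hx' => hP2 t x x' (hER t x hx) (hER t x' hx'))
  have h2 := area (sm_wM h (2 * M)) hδ hS0m (fun z => g z + C1 * M)
    (fun z hz => Ct_wt (sm_wM h (2 * M)) hz.1.1) (fun z hz => Ct_psd (sm_wM h (2 * M)) hz.1.1) (by
      intro z hz
      obtain ⟨a, ha, hle⟩ := heq z hz.1.1.1
      refine ⟨a, ha, ?_⟩
      have hsh := ha.sum_shift (m z) (M := 2 * M) (by positivity)
      have hz2 : ‖z.2‖ < R - 2 / √M := hz.2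
      have hgr := grad_bd h hv (L := 2 * M) (r := 1 / √M) (by positivity) (by positivity) hz.1.1 (by
        have : 1 / √M ≤ 2 / √M := by gcongr; norm_num
        linarith)
      have hgr2 : ‖G z‖ ≤ 2 * √M := by
        have e1 : 2 * M * (1 / √M) ^ 2 / 2 = 1 := by
          rw [div_pow, pow_two √M, hsqM]; field_simp
        rw [e1, one_div, inv_mul_eq_div, div_le_iff₀ hsq] at hgr
        linarith
      have h5 : K * (1 + ‖G z‖) ≤ K * (3 * M) := by
        gcongr; linarith
      have h6 : C1 * M = K * (3 * M) + 2 * M + 2 * M * (d * δ⁻¹) := by rw [hC1]; ring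
      linarith)
  have h3 := lint_add_const (S := S0) (D := DD d t0 t1 R) (fun z hz => hz.1.1.1) g (C1 * M) (d + 1)
  have hEvol : volume E ≤ ENNReal.ofReal (C2 / √M) + ENNReal.ofReal C2 * volume (A2 \ AM) := by
    have hMp : M⁻¹ ^ (d + 1) ≤ 1 / √M := by
      calc M⁻¹ ^ (d + 1) ≤ M⁻¹ := pow_le_of_le_one (by positivity) (inv_le_one_of_one_le₀ hM) (by omega)
        _ = 1 / M := by rw [one_div]
        _ ≤ 1 / √M := by gcongr
    have hMC : M⁻¹ ^ (d + 1) * (C1 * M) ^ (d + 1) = C1 ^ (d + 1) := by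
      rw [← mul_pow]; congr 1; field_simp
    calc volume E ≤ _ := h1
      _ ≤ ENNReal.ofReal (M⁻¹ ^ (d + 1)) * (ENNReal.ofReal (δ⁻¹ ^ d) * (2 ^ (d + 1) * (1 +
          ENNReal.ofReal (C1 * M) ^ (d + 1) * volume (A2 \ AM)))) := by
          gcongr
          refine h2.trans ?_
          gcongr
          refine h3.trans ?_
          gcongr
          exact inter_subset_left
      _ = ENNReal.ofReal (δ⁻¹ ^ d * 2 ^ (d + 1) * M⁻¹ ^ (d + 1)) +
          ENNReal.ofReal (δ⁻¹ ^ d * 2 ^ (d + 1) * (M⁻¹ ^ (d + 1) * (C1 * M) ^ (d + 1))) *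
            volume (A2 \ AM) := by
          rw [ENNReal.ofReal_mul (p := δ⁻¹ ^ d * 2 ^ (d + 1)) (by positivity),
            ENNReal.ofReal_mul (p := δ⁻¹ ^ d) (by positivity),
            ENNReal.ofReal_mul (p := δ⁻¹ ^ d * 2 ^ (d + 1)) (by positivity),
            ENNReal.ofReal_mul (p := δ⁻¹ ^ d) (by positivity),
            ENNReal.ofReal_mul (p := M⁻¹ ^ (d + 1)) (by positivity),
            ENNReal.ofReal_pow (p := C1 * M) (by positivity) (d + 1),
            ENNReal.ofReal_pow (p := 2) (by norm_num) (d + 1), ENNReal.ofReal_ofNat]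
          ring
      _ ≤ _ := by
          rw [hMC]
          have e0 : δ⁻¹ ^ d * 2 ^ (d + 1) ≤ C2 := by
            rw [hC2]
            apply le_mul_of_one_le_right (by positivity)
            have : 0 ≤ C1 ^ (d + 1) := by positivity
            linarith
          gcongr
          · calc _ ≤ C2 * (1 / √M) := by gcongr
              _ = _ := by ring
          · rw [hC2]
            gcongr
            linarith
  have hbot := vol_bottom (d := d) (t0 := t0) (t1 := t1) (η := 1 / M) hR hR1
  have hsh := vol_shell (d := d) (t0 := t0) (t1 := t1) (η := 4 / √M) hd ht1 hR hR1 (by positivity)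
  have hsub : DD d t0 t1 R \ AM ⊆ E ∪ ({z : ZZ d | z ∈ DD d t0 t1 R ∧ z.1 ≤ t0 + 1 / M} ∪
      {z : ZZ d | z ∈ DD d t0 t1 R ∧ R - 4 / √M ≤ ‖z.2‖}) := by
    intro z hz
    by_cases h4 : t0 + 1 / M < z.1
    · by_cases h5 : ‖z.2‖ < R - 4 / √M
      · exact Or.inl ⟨hz, h4, h5⟩
      · exact Or.inr (Or.inr ⟨hz.1, not_lt.1 h5⟩)
    · exact Or.inr (Or.inl ⟨hz.1, not_lt.1 h4⟩)
  calc volume (DD d t0 t1 R \ AM) ≤ _ := measure_mono hsub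
    _ ≤ volume E + (volume _ + volume _) :=
      (measure_union_le _ _).trans (by gcongr; exact measure_union_le _ _)
    _ ≤ (ENNReal.ofReal (C2 / √M) + ENNReal.ofReal C2 * volume (A2 \ AM)) +
        (ENNReal.ofReal (om d * (1 / M)) + ENNReal.ofReal (d * om d * (4 / √M))) := by
        gcongr
    _ = (ENNReal.ofReal (C2 / √M) + (ENNReal.ofReal (om d * (1 / M)) +
        ENNReal.ofReal (d * om d * (4 / √M)))) + ENNReal.ofReal C2 * volume (A2 \ AM) := by ring
    _ ≤ _ := by
        rw [← ENNReal.ofReal_add (by positivity) (by positivity),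
          ← ENNReal.ofReal_add (by positivity) (by positivity)]
        have : 0 ≤ d * om d * 4 := by positivity
        gcongr
        · calc C2 / √M + (om d * (1 / M) + d * om d * (4 / √M))
              ≤ C2 / √M + (om d * (1 / √M) + d * om d * (4 / √M)) := by gcongr
            _ = (C2 + om d + d * om d * 4) / √M := by ring
            _ ≤ _ := by gcongr; linarith
        · linarith
end
end

open MeasureTheory ENNReal Set

noncomputable section

lemma exists_gamma {θ : ℝ} (hθ1 : θ < 1) : ∃ γ : ℝ, 0 < γ ∧ γ ≤ 1 ∧ 2 ^ γ * θ < 1 := by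
  have h1 : ContinuousAt (fun γ : ℝ => (2:ℝ) ^ γ * θ) 0 :=
    (Real.continuousAt_const_rpow two_ne_zero).mul_const θ
  have h2 : ∀ᶠ γ in nhds (0:ℝ), (2:ℝ) ^ γ * θ < 1 := by
    apply h1.eventually_lt_const
    simpa using hθ1
  have h3 : ∀ᶠ γ in nhdsWithin (0:ℝ) (Ioi 0), (2:ℝ) ^ γ * θ < 1 := h2.filter_mono nhdsWithin_le_nhds
  have h4 : Ioc (0:ℝ) 1 ∈ nhdsWithin (0:ℝ) (Ioi 0) := Ioc_mem_nhdsGT one_pos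
  obtain ⟨γ, h5, h6⟩ := (h3.and h4).exists
  exact ⟨γ, h6.1, h6.2, h5⟩

lemma layer {d : ℕ} {γ θ : ℝ} (hγ : 0 < γ) (hγ1 : γ ≤ 1) (hθ : 0 < θ) (hγθ : 2 ^ γ * θ < 1)
    {C B V : ℝ} (hC : 0 < C) (hB : 0 ≤ B) (hV : 0 ≤ V) (D : Set (ZZ d)) (F : ZZ d → ℝ)
    (T : ℕ → Set (ZZ d))
    (hT : ∀ k, MeasurableSet (T k)) (hF : ∀ z ∈ D, ∀ k, z ∉ T k → F z ≤ C * 2 ^ k)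
    (hDm : MeasurableSet D)
    (hTv : ∀ k, volume (T k) ≤ ENNReal.ofReal (B * θ ^ k)) (hDv : volume D ≤ ENNReal.ofReal V) :
    ∫⁻ z in D, ENNReal.ofReal (F z) ^ γ ≤
      ENNReal.ofReal (C ^ γ * (V + 2 * B * (1 - 2 ^ γ * θ)⁻¹)) := by
  set ρ : ℝ := 2 ^ γ * θ with hρ
  have hρ0 : 0 < ρ := by positivity
  have hpt : ∀ z ∈ D, ENNReal.ofReal (F z) ^ γ ≤ ENNReal.ofReal (C ^ γ) *
      (1 + ∑' k, (T k).indicator (fun _ => ENNReal.ofReal (2 * (2 ^ γ) ^ k)) z) := by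
    intro z hz
    have hex : ∃ k : ℕ, F z ≤ C * 2 ^ k := by
      obtain ⟨k, hk⟩ := pow_unbounded_of_one_lt (F z / C) (one_lt_two)
      refine ⟨k, ?_⟩
      rw [div_lt_iff₀ hC] at hk
      linarith
    classical
    have hk := Nat.find_spec hex
    have hmin := fun j (hj : j < Nat.find hex) => Nat.find_min hex hj
    set k0 := Nat.find hex with hk0
    rcases Nat.eq_zero_or_pos k0 with h0 | h0
    · rw [h0, pow_zero, mul_one] at hk
      calc ENNReal.ofReal (F z) ^ γ ≤ ENNReal.ofReal C ^ γ := by gcongr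
        _ = ENNReal.ofReal (C ^ γ) * 1 := by
            rw [mul_one, ENNReal.ofReal_rpow_of_nonneg hC.le hγ.le]
        _ ≤ _ := by gcongr; exact le_self_add
    · obtain ⟨j, hj⟩ : ∃ j, k0 = j + 1 := ⟨k0 - 1, by omega⟩
      have hjT : z ∈ T j := by
        by_contra hcon
        exact hmin j (by omega) (hF z hz j hcon)
      rw [hj] at hk
      calc ENNReal.ofReal (F z) ^ γ ≤ ENNReal.ofReal (C * 2 ^ (j + 1)) ^ γ := by gcongr
        _ = ENNReal.ofReal (C ^ γ * (2 ^ γ * (2 ^ γ) ^ j)) := by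
            rw [ENNReal.ofReal_rpow_of_nonneg (by positivity) hγ.le,
              Real.mul_rpow hC.le (by positivity), ← Real.rpow_natCast 2 (j + 1),
              ← Real.rpow_mul (by norm_num), mul_comm ((j + 1 : ℕ) : ℝ), Real.rpow_mul (by norm_num),
              Real.rpow_natCast, pow_succ']
        _ ≤ ENNReal.ofReal (C ^ γ * (2 * (2 ^ γ) ^ j)) := by
            gcongr
            calc (2:ℝ) ^ γ ≤ 2 ^ (1:ℝ) := by gcongr; norm_num
              _ = 2 := Real.rpow_one _
        _ = ENNReal.ofReal (C ^ γ) * (T j).indicator (fun _ => ENNReal.ofReal (2 * (2 ^ γ) ^ j)) z := by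
            rw [indicator_of_mem hjT, ENNReal.ofReal_mul (by positivity)]
        _ ≤ _ := by
            gcongr
            refine le_trans ?_ le_add_self
            exact ENNReal.le_tsum (f := fun k => (T k).indicator
              (fun _ => ENNReal.ofReal (2 * (2 ^ γ) ^ k)) z) j
  calc ∫⁻ z in D, ENNReal.ofReal (F z) ^ γ
      ≤ ∫⁻ z in D, ENNReal.ofReal (C ^ γ) *
      (1 + ∑' k, (T k).indicator (fun _ => ENNReal.ofReal (2 * (2 ^ γ) ^ k)) z) :=
        setLIntegral_mono' hDm hpt
    _ = ENNReal.ofReal (C ^ γ) * (volume D + ∑' k, ∫⁻ z in D,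
        (T k).indicator (fun _ => ENNReal.ofReal (2 * (2 ^ γ) ^ k)) z) := by
        rw [lintegral_const_mul' _ _ ENNReal.ofReal_ne_top, lintegral_add_left measurable_const,
          lintegral_tsum (fun k => (measurable_const.indicator (hT k)).aemeasurable)]
        simp
    _ ≤ ENNReal.ofReal (C ^ γ) * (ENNReal.ofReal V + ∑' k, ENNReal.ofReal (2 * B * ρ ^ k)) := by
        gcongr with k
        rw [lintegral_indicator_const (hT k)]
        calc _ ≤ ENNReal.ofReal (2 * (2 ^ γ) ^ k) * ENNReal.ofReal (B * θ ^ k) := by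
              gcongr
              exact (Measure.restrict_le_self _).trans (hTv k)
          _ = _ := by
              rw [← ENNReal.ofReal_mul (by positivity), hρ, mul_pow]
              congr 1; ring
    _ = _ := by
        have hs : HasSum (fun k : ℕ => 2 * B * ρ ^ k) (2 * B * (1 - ρ)⁻¹) :=
          (hasSum_geometric_of_lt_one hρ0.le hγθ).mul_left _
        rw [← ENNReal.ofReal_tsum_of_nonneg (fun k => by positivity) hs.summable, hs.tsum_eq,
          ← ENNReal.ofReal_add hV, ← ENNReal.ofReal_mul (by positivity)]
        have : 0 < (1 - ρ)⁻¹ := inv_pos.2 (by linarith)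
        positivity

lemma seq_decay {C : ℝ} (hC : 1 ≤ C) (V : ℝ) (hV : 0 ≤ V) :
    ∃ θ B : ℝ, 0 < θ ∧ θ < 1 ∧ 0 ≤ B ∧ (∀ k : ℕ, (√2)⁻¹ ^ k ≤ θ ^ k) ∧
    ∀ a : ℕ → ℝ, a 0 ≤ V → (∀ k, a k ≤ C * (√2)⁻¹ ^ k + C * (a k - a (k + 1))) →
      ∀ k, a k ≤ B * θ ^ k := by
  have hs : 0 < (√2)⁻¹ := by positivity
  have hs1 : (√2)⁻¹ < 1 := inv_lt_one_of_one_lt₀ (Real.one_lt_sqrt_two)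
  set θ := max (1 - 1 / (2 * C)) (√2)⁻¹ with hθ
  have hC0 : 0 < C := by linarith
  have hsθ : (√2)⁻¹ ≤ θ := le_max_right _ _
  have hθ0 : 0 < θ := lt_of_lt_of_le hs hsθ
  refine ⟨θ, 2 * C + V, hθ0, ?_, by linarith, fun k => by gcongr, ?_⟩
  · apply max_lt _ hs1
    have : 0 < 1 / (2 * C) := by positivity
    linarith
  · intro a ha0 ha k
    induction k with
    | zero => simp; linarith
    | succ k ih =>
      have h1 := ha k
      have h2 : a (k + 1) ≤ (√2)⁻¹ ^ k + (1 - 1 / C) * a k := by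
        have : C * a (k + 1) ≤ C * ((√2)⁻¹ ^ k + (1 - 1 / C) * a k) := by
          have e : C * ((√2)⁻¹ ^ k + (1 - 1 / C) * a k) = C * (√2)⁻¹ ^ k + C * a k - a k := by
            field_simp
            ring
          rw [e]; linarith
        exact le_of_mul_le_mul_left this hC0
      have h3 : 0 ≤ 1 - 1 / C := by
        have : 1 / C ≤ 1 := by rw [div_le_one hC0]; exact hC
        linarith
      have h4 : (√2)⁻¹ ^ k ≤ θ ^ k := by gcongr
      have h5 : 1 - 1 / (2 * C) ≤ θ := le_max_left _ _
      have h6 := mul_le_mul_of_nonneg_left ih h3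
      have hθk : 0 < θ ^ k := by positivity
      have e1 : 1 / (2 * C) * (2 * C) = 1 := by field_simp
      have e2 : 1 / C = 2 * (1 / (2 * C)) := by field_simp
      set x := 1 / (2 * C) with hx
      have hx0 : 0 < x := by positivity
      rw [e2] at h2 h3 h6
      calc a (k + 1) ≤ θ ^ k + (1 - 2 * x) * ((2 * C + V) * θ ^ k) := by linarith
        _ = (1 + (1 - 2 * x) * (2 * C + V)) * θ ^ k := by ring
        _ ≤ ((2 * C + V) * θ) * θ ^ k := by
            gcongr
            nlinarith [mul_nonneg hx0.le hV]
        _ = _ := by ring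
end

open MeasureTheory ENNReal Set

noncomputable section

section
variable {d : ℕ}

lemma Ct_mono {v : ZZ d → ℝ} {G : ZZ d → EE d} {t0 t1 R M M' : ℝ} (hM : M ≤ M') :
    Ct (wM v M) (gM G M) t0 t1 R ⊆ Ct (wM v M') (gM G M') t0 t1 R := by
  rintro z ⟨hz, hc⟩
  refine ⟨hz, fun z' hz' hlt => ?_⟩
  have h1 := hc z' hz' hlt
  simp only [wM, gM, inner_add_left, inner_smul_left, conj_trivial, inner_sub_right,
    real_inner_self_eq_norm_sq] at h1 ⊢
  have h2 : 0 ≤ (M' - M) * ‖z'.2 - z.2‖ ^ 2 := mul_nonneg (by linarith) (by positivity)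
  rw [norm_sub_sq_real, real_inner_comm] at h2
  have h3 : 0 ≤ (M' - M) * (z'.1 - z.1) := mul_nonneg (by linarith) (by linarith)
  linarith

lemma smooth_est (hd : 1 ≤ d) {δ K : ℝ} (hδ : 0 < δ) (hK : 0 ≤ K) :
    ∃ γ N : ℝ, 0 < γ ∧ γ ≤ 1 ∧ 0 < N ∧ ∀ (v vt : ZZ d → ℝ) (G : ZZ d → EE d)
      (m : ZZ d → Matrix (Fin d) (Fin d) ℝ)
      (k : ZZ d → EE d) (t0 t1 R : ℝ) (g : ZZ d → ℝ), Sm v vt G m k → t0 ≤ t1 → t1 - t0 ≤ 1 →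
      0 < R → R ≤ 1 → (∀ z ∈ QQ d t0 t1 R, 0 ≤ v z ∧ v z ≤ 1) →
      Measurable g →
      (∀ z ∈ DD d t0 t1 R, ∃ a, Ell δ a ∧
        vt z + ∑ i, ∑ j, a i j * m z i j ≤ g z + K * (1 + ‖G z‖)) →
      (∫⁻ z in DD d t0 t1 R, ENNReal.ofReal (g z) ^ (d + 1)) ≤ 1 →
      ∫⁻ z in DD d t0 t1 R, ENNReal.ofReal (frobNorm (m z)) ^ γ ≤ ENNReal.ofReal N := by
  have hom := om_pos d
  obtain ⟨C, hC1, hstep⟩ := core_step (d := d) hd hδ hK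
  obtain ⟨θ, B, hθ0, hθ1, hB, hsθ, hdec⟩ := seq_decay hC1 (om d) hom.le
  obtain ⟨γ, hγ0, hγ1, hγθ⟩ := exists_gamma hθ1
  set C3 : ℝ := δ⁻¹ * (2 + 3 * K + d * δ⁻¹) with hC3
  have hC30 : 0 < C3 := by positivity
  set C4 : ℝ := d * (C3 + 1) with hC4
  have hd0 : (0:ℝ) < d := by exact_mod_cast hd
  have hC40 : 0 < C4 := by positivity
  set B' : ℝ := B + d * om d * 2 + 1 with hB'
  have hB'0 : 0 < B' := by positivity
  have hN0 : 0 < C4 ^ γ * (om d + 2 * B' * (1 - 2 ^ γ * θ)⁻¹) := by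
    have : 0 < (1 - 2 ^ γ * θ)⁻¹ := inv_pos.2 (by linarith)
    positivity
  refine ⟨γ, _, hγ0, hγ1, hN0, ?_⟩
  intro v vt G m k t0 t1 R g h ht ht1 hR hR1 hv hg heq hI
  set D := DD d t0 t1 R with hD
  have hDm : MeasurableSet D := DD_meas _ _ _ _
  have hDv : volume D ≤ ENNReal.ofReal (om d) := by
    rw [hD, vol_DD d hR ht]
    apply ENNReal.ofReal_le_ofReal
    have : R ^ d ≤ 1 := pow_le_one₀ hR.le hR1
    have h0 : 0 ≤ t1 - t0 := by linarith
    calc (t1 - t0) * (R ^ d * om d) ≤ 1 * (1 * om d) := by gcongr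
      _ = _ := by ring
  set A : ℕ → Set (ZZ d) := fun n => Ct (wM v (2 ^ n)) (gM G (2 ^ n)) t0 t1 R with hA
  have hAm : ∀ n, MeasurableSet (A n) := fun n => Ct_meas (sm_wM h _)
  have hAD : ∀ n, A n ⊆ D := fun n z hz => hz.1
  have hmono : ∀ n, A n ⊆ A (n + 1) := fun n => Ct_mono (by
    rw [pow_succ]; have : (0:ℝ) < 2 ^ n := by positivity
    linarith)
  have hfin : ∀ n, volume (D \ A n) ≠ ⊤ := fun n =>
    ne_top_of_le_ne_top ENNReal.ofReal_ne_top ((measure_mono sdiff_subset).trans hDv)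
  have hfin' : ∀ n, volume (A (n + 1) \ A n) ≠ ⊤ := fun n =>
    ne_top_of_le_ne_top ENNReal.ofReal_ne_top
      ((measure_mono (sdiff_subset.trans (hAD _))).trans hDv)
  have hsqrt : ∀ n : ℕ, √((2:ℝ) ^ n) = √2 ^ n := by
    intro n
    rw [Real.sqrt_eq_iff_mul_self_eq (by positivity) (by positivity), ← mul_pow,
      Real.mul_self_sqrt (by norm_num)]
  have hone : ∀ n : ℕ, (1:ℝ) ≤ 2 ^ n := fun n => one_le_pow₀ (by norm_num)
  have hdec' := hdec (fun n => (volume (D \ A n)).toReal)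
    (ENNReal.toReal_le_of_le_ofReal hom.le ((measure_mono sdiff_subset).trans hDv)) (by
      intro n
      have h1 := hstep v vt G m k t0 t1 R g h ht ht1 hR hR1 hv heq hI (2 ^ n) (hone n)
      rw [← pow_succ'] at h1
      have h2 : volume (D \ A n) = volume (D \ A (n + 1)) + volume (A (n + 1) \ A n) := by
        rw [← measure_union _ ((hAm _).diff (hAm _))]
        · congr 1
          ext z
          have := @hmono n z
          have := @hAD (n + 1) z
          simp only [mem_sdiff, mem_union]
          tauto
        · rw [disjoint_left]
          rintro z hz hz'
          exact hz.2 hz'.1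
      have h3 : volume (A (n + 1) \ A n) =
          ENNReal.ofReal ((volume (D \ A n)).toReal - (volume (D \ A (n + 1))).toReal) := by
        rw [h2, ENNReal.toReal_add (hfin _) (hfin' _), add_sub_cancel_left,
          ENNReal.ofReal_toReal (hfin' _)]
      have h4 : 0 ≤ (volume (D \ A n)).toReal - (volume (D \ A (n + 1))).toReal := by
        rw [h2, ENNReal.toReal_add (hfin _) (hfin' _), add_sub_cancel_left]
        exact ENNReal.toReal_nonneg
      have h5 : volume (D \ A n) ≤ ENNReal.ofReal (C / √(2 ^ n)) +
          ENNReal.ofReal C * volume (A (n + 1) \ A n) := h1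
      rw [h3, ← ENNReal.ofReal_mul (by linarith), ← ENNReal.ofReal_add (by positivity)
        (mul_nonneg (by linarith) h4)] at h5
      have h6 := ENNReal.toReal_le_of_le_ofReal (by
        have := mul_nonneg (by linarith : 0 ≤ C) h4
        positivity) h5
      rw [hsqrt, div_eq_mul_inv, ← inv_pow] at h6
      exact h6)
  set T : ℕ → Set (ZZ d) := fun n => (D \ A n) ∪
    ({z : ZZ d | z ∈ DD d t0 t1 R ∧ R - 2 / √(2 ^ n) ≤ ‖z.2‖} ∪ (D ∩ {z | 2 ^ n < g z})) with hT
  have hgm : ∀ n : ℕ, MeasurableSet {z : ZZ d | 2 ^ n < g z} := fun n =>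
    measurableSet_lt measurable_const hg
  have hTm : ∀ n, MeasurableSet (T n) := by
    intro n
    apply (hDm.diff (hAm n)).union
    apply MeasurableSet.union _ (hDm.inter (hgm n))
    have e : MeasurableSet {z : ZZ d | R - 2 / √(2 ^ n) ≤ ‖z.2‖} :=
      (isClosed_le (by fun_prop) (by fun_prop)).measurableSet
    exact hDm.inter e
  refine layer hγ0 hγ1 hθ0 hγθ hC40 hB'0.le hom.le D (fun z => frobNorm (m z)) T hTm ?_ hDm ?_ hDv
  · intro z hz n hzT
    have hzA : z ∈ A n := by
      by_contra hcon
      exact hzT (Or.inl ⟨hz, hcon⟩)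
    have hzR : ‖z.2‖ < R - 2 / √(2 ^ n) := by
      by_contra hcon
      exact hzT (Or.inr (Or.inl ⟨hz, not_lt.1 hcon⟩))
    have hzg : g z ≤ 2 ^ n := by
      by_contra hcon
      exact hzT (Or.inr (Or.inr ⟨hz, not_le.1 hcon⟩))
    set M : ℝ := 2 ^ n with hM
    have hM1 : 1 ≤ M := hone n
    have hM0 : 0 < M := by linarith
    have hsq : 0 < √M := Real.sqrt_pos.2 hM0
    have hsqM : √M * √M = M := Real.mul_self_sqrt hM0.le
    have hsq1 : 1 ≤ √M := Real.one_le_sqrt.2 hM1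
    have hsqle : √M ≤ M := by nlinarith
    have hgr := grad_bd h hv (L := M) (r := 1 / √M) (by positivity) (by positivity) hzA (by
        have : 1 / √M ≤ 2 / √M := by gcongr; norm_num
        linarith)
    have hgr2 : ‖G z‖ ≤ 2 * M := by
      have e1 : M * (1 / √M) ^ 2 / 2 = 1 / 2 := by
        rw [div_pow, pow_two √M, hsqM]; field_simp
      rw [e1, one_div, inv_mul_eq_div, div_le_iff₀ hsq] at hgr
      linarith
    have hpsd := Ct_psd (sm_wM h M) hzA
    have hwt := Ct_wt (sm_wM h M) hzA
    obtain ⟨a, ha, hle⟩ := heq z hz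
    have hsh := ha.sum_shift (m z) hM0.le
    have htr := ha.trace_mul hpsd
    have hK2 : K * (1 + ‖G z‖) ≤ K * (3 * M) := by gcongr; linarith
    have htr2 : (m z + M • (1 : Matrix (Fin d) (Fin d) ℝ)).trace ≤ C3 * M := by
      have e : C3 * M = (M * (2 + 3 * K + d * δ⁻¹)) / δ := by rw [hC3]; ring
      rw [e, le_div_iff₀ hδ]
      linarith
    have hent : ∀ i j, |m z i j| ≤ (C3 + 1) * M := by
      intro i j
      have h1 := (psd_entry hpsd i j).trans htr2
      have h2 : m z i j = (m z + M • (1 : Matrix (Fin d) (Fin d) ℝ)) i j -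
          M * (1 : Matrix (Fin d) (Fin d) ℝ) i j := by
        simp [Matrix.add_apply, Matrix.smul_apply]
      have h3 : |M * (1 : Matrix (Fin d) (Fin d) ℝ) i j| ≤ M := by
        rw [Matrix.one_apply]
        split_ifs <;> simp [abs_of_pos hM0, hM0.le]
      rw [h2]
      refine (abs_sub _ _).trans ?_
      linarith
    calc frobNorm (m z) ≤ d * ((C3 + 1) * M) := frobNorm_le (by positivity) hent
      _ = _ := by rw [hC4]; ring
  · intro n
    have h1 : volume (D \ A n) ≤ ENNReal.ofReal (B * θ ^ n) := by
      rw [← ENNReal.ofReal_toReal (hfin n)]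
      exact ENNReal.ofReal_le_ofReal (hdec' n)
    have h2 := vol_shell (d := d) (t0 := t0) (t1 := t1) (η := 2 / √(2 ^ n)) hd ht1 hR hR1
      (by positivity)
    have h2' : 2 / √((2:ℝ) ^ n) = 2 * (√2)⁻¹ ^ n := by
      rw [hsqrt, div_eq_mul_inv, ← inv_pow]
    have h3 : volume (D ∩ {z | 2 ^ n < g z}) ≤ ENNReal.ofReal ((√2)⁻¹ ^ n) := by
      have hm' := meas_ge_le_lintegral_div (μ := volume.restrict D)
        (f := fun z => ENNReal.ofReal (g z) ^ (d + 1))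
        ((hg.ennreal_ofReal.pow_const _).aemeasurable)
        (ε := ENNReal.ofReal ((2 ^ n) ^ (d + 1)))
        (by simp only [ne_eq, ENNReal.ofReal_eq_zero, not_le]; positivity) ENNReal.ofReal_ne_top
      rw [Measure.restrict_apply (measurableSet_le measurable_const
        (hg.ennreal_ofReal.pow_const _))] at hm'
      calc volume (D ∩ {z | 2 ^ n < g z}) ≤ _ := by
            refine measure_mono ?_
            rintro z ⟨hz, hz'⟩
            refine ⟨?_, hz⟩
            have hz'' : (2:ℝ) ^ n < g z := hz'
            show ENNReal.ofReal ((2 ^ n) ^ (d + 1)) ≤ ENNReal.ofReal (g z) ^ (d + 1)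
            rw [ENNReal.ofReal_pow (p := 2 ^ n) (by positivity)]
            gcongr
        _ ≤ _ := hm'
        _ ≤ 1 / ENNReal.ofReal ((2 ^ n) ^ (d + 1)) := by gcongr
        _ = ENNReal.ofReal ((2 ^ n) ^ (d + 1))⁻¹ := by
            rw [one_div, ENNReal.ofReal_inv_of_pos (by positivity)]
        _ ≤ _ := by
            apply ENNReal.ofReal_le_ofReal
            rw [inv_pow]
            apply inv_anti₀ (by positivity)
            rw [← hsqrt]
            have hM1 := hone n
            set M : ℝ := 2 ^ n
            have hM0 : 0 < M := by linarith
            have hsqM : √M * √M = M := Real.mul_self_sqrt hM0.le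
            have hsq1 : 1 ≤ √M := Real.one_le_sqrt.2 hM1
            have hsqle : √M ≤ M := by nlinarith
            exact hsqle.trans (le_self_pow₀ hM1 (by omega))
    calc volume (T n) ≤ volume (D \ A n) + (volume _ + volume _) :=
          (measure_union_le _ _).trans (by gcongr; exact measure_union_le _ _)
      _ ≤ ENNReal.ofReal (B * θ ^ n) + (ENNReal.ofReal (d * om d * (2 * (√2)⁻¹ ^ n)) +
          ENNReal.ofReal ((√2)⁻¹ ^ n)) := by
          gcongr
          rw [← h2']
          exact h2
      _ ≤ _ := by
          rw [← ENNReal.ofReal_add (by positivity) (by positivity),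
            ← ENNReal.ofReal_add (by positivity) (by positivity)]
          apply ENNReal.ofReal_le_ofReal
          have := hsθ n
          calc B * θ ^ n + (d * om d * (2 * (√2)⁻¹ ^ n) + (√2)⁻¹ ^ n)
              ≤ B * θ ^ n + (d * om d * (2 * θ ^ n) + θ ^ n) := by gcongr
            _ = _ := by rw [hB']; ring
end
end

open MeasureTheory ENNReal Set

noncomputable section

lemma frobNorm_smul {d : ℕ} (α : ℝ) (m : Matrix (Fin d) (Fin d) ℝ) :
    frobNorm (α • m) = |α| * frobNorm m := by
  unfold frobNorm
  have : (∑ i, ∑ j, ((α • m) i j) ^ 2) = α ^ 2 * ∑ i, ∑ j, (m i j) ^ 2 := by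
    simp only [Matrix.smul_apply, smul_eq_mul, mul_pow, Finset.mul_sum]
  rw [this, Real.sqrt_mul (sq_nonneg _), Real.sqrt_sq_eq_abs]

lemma drift_le {d : ℕ} (b g : EE d) {K : ℝ} (h : ‖b‖ ≤ K) : |∑ i, b i * g i| ≤ K * ‖g‖ := by
  have h1 : inner ℝ g b = ∑ i, b i * g i := by
    simp [PiLp.inner_apply]
  rw [← h1]
  calc |inner ℝ g b| ≤ ‖g‖ * ‖b‖ := abs_real_inner_le_norm _ _
    _ ≤ K * ‖g‖ := by nlinarith [norm_nonneg g]

/-- The estimate for smooth functions with general data. -/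
lemma norm_est {d : ℕ} (hd : 1 ≤ d) {δ K : ℝ} (hδ : 0 < δ) (hK : 0 ≤ K) :
    ∃ γ N : ℝ, 0 < γ ∧ γ ≤ 1 ∧ 0 < N ∧ ∀ (u ut : ZZ d → ℝ) (G : ZZ d → EE d)
      (m : ZZ d → Matrix (Fin d) (Fin d) ℝ) (k : ZZ d → EE d) (t0 t1 R : ℝ)
      (a : ZZ d → Matrix (Fin d) (Fin d) ℝ) (b : ZZ d → EE d) (c : ZZ d → ℝ)
      (f : ZZ d → ℝ) (Λ m0 : ℝ),
      Sm u ut G m k → t0 ≤ t1 → t1 - t0 ≤ 1 → 0 < R → R ≤ 1 →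
      (∀ z, Ell δ (a z)) → (∀ z, ‖b z‖ + c z ≤ K) → (∀ z, 0 ≤ c z) →
      Measurable f → (∀ z, 0 ≤ f z) →
      (∀ z ∈ DD d t0 t1 R,
        |ut z + (∑ i, ∑ j, a z i j * m z i j) + (∑ i, b z i * G z i) - c z * u z| ≤ f z) →
      0 < Λ → 0 ≤ m0 →
      (∀ z ∈ QQ d t0 t1 R, (z.1 = t1 ∨ ‖z.2‖ = R) → |u z| ≤ m0) →
      (∫⁻ z in DD d t0 t1 R, ENNReal.ofReal (f z) ^ (d + 1)) ≤ ENNReal.ofReal (Λ ^ (d + 1)) →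
      ∫⁻ z in DD d t0 t1 R, ENNReal.ofReal (frobNorm (m z)) ^ γ
        ≤ ENNReal.ofReal (N * (m0 + Λ) ^ γ) := by
  obtain ⟨N0, hN0, habp⟩ := abp d δ K hδ hK
  obtain ⟨γ, N1, hγ0, hγ1, hN1, hsm⟩ := smooth_est hd hδ hK
  refine ⟨γ, N1 * (2 * (1 + N0)) ^ γ, hγ0, hγ1, by positivity, ?_⟩
  intro u ut G m k t0 t1 R a b c f Λ m0 hS ht ht1 hR0 hR1 ha hbc hc hfm hf0 hL hΛ hm0 hbd hIntg
  have hb : ∀ z, ‖b z‖ ≤ K := fun z => by linarith [hbc z, hc z]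
  have hcK : ∀ z, c z ≤ K := fun z => by linarith [hbc z, norm_nonneg (b z)]
  set S := m0 + N0 * Λ with hSdef
  have hSpos : 0 < S := by positivity
  have h1 : ∀ z ∈ QQ d t0 t1 R, -S ≤ u z := by
    refine habp u ut G m k t0 t1 R f Λ m0 hS ht ht1 hR0 hR1 hf0 hΛ.le hm0 ?_ ?_ hIntg
    · intro z hz h; exact (abs_le.1 (hbd z hz h)).1
    · intro z hz hneg
      refine ⟨a z, ha z, ?_⟩
      have e1 := (abs_le.1 (hL z hz)).2
      have e2 := (abs_le.1 (drift_le (b z) (G z) (hb z))).1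
      nlinarith [mul_nonneg (hc z) (neg_pos.2 hneg).le]
  have h2 : ∀ z ∈ QQ d t0 t1 R, u z ≤ S := by
    have := habp _ _ _ _ _ t0 t1 R f Λ m0 (hS.aff (-1) 0) ht ht1 hR0 hR1 hf0 hΛ.le hm0 ?_ ?_ hIntg
    · intro z hz
      have := this z hz
      linarith
    · intro z hz h
      have := (abs_le.1 (hbd z hz h)).2
      linarith
    · intro z hz hneg
      refine ⟨a z, ha z, ?_⟩
      have e1 := (abs_le.1 (hL z hz)).1
      have e2 := (abs_le.1 (drift_le (b z) (G z) (hb z))).2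
      have e3 : (∑ i, ∑ j, a z i j * ((-1 : ℝ) • m z) i j) = - ∑ i, ∑ j, a z i j * m z i j := by
        simp [Finset.sum_neg_distrib]
      rw [e3, norm_smul]
      simp only [norm_neg, norm_one, one_mul]
      nlinarith [mul_nonneg (hc z) (show 0 ≤ u z by linarith)]
  set T := 2 * (1 + N0) * (m0 + Λ) with hT
  have hTpos : 0 < T := by positivity
  have hST : 2 * S ≤ T := by rw [hT, hSdef]; nlinarith [mul_nonneg hN0.le hm0]
  have hΛT : Λ ≤ T := by rw [hT]; nlinarith [mul_nonneg hN0.le hm0, mul_nonneg hN0.le hΛ.le]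
  have key := hsm _ _ _ _ _ t0 t1 R (fun z => T⁻¹ * f z) (hS.aff T⁻¹ (T⁻¹ * S)) ht ht1 hR0 hR1
    ?_ (hfm.const_mul _) ?_ ?_
  · have e : ∀ z, ENNReal.ofReal (frobNorm (T⁻¹ • m z)) ^ γ =
        ENNReal.ofReal (T⁻¹ ^ γ) * ENNReal.ofReal (frobNorm (m z)) ^ γ := by
      intro z
      rw [frobNorm_smul, abs_of_pos (by positivity), ENNReal.ofReal_mul (by positivity),
        ENNReal.mul_rpow_of_nonneg _ _ hγ0.le, ENNReal.ofReal_rpow_of_pos (by positivity)]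
    simp only [e] at key
    rw [lintegral_const_mul' _ _ ENNReal.ofReal_ne_top] at key
    have hTg : ENNReal.ofReal (T ^ γ) * ENNReal.ofReal (T⁻¹ ^ γ) = 1 := by
      rw [← ENNReal.ofReal_mul (by positivity), ← Real.mul_rpow hTpos.le (by positivity),
        mul_inv_cancel₀ hTpos.ne']
      simp
    calc ∫⁻ z in DD d t0 t1 R, ENNReal.ofReal (frobNorm (m z)) ^ γ
        = ENNReal.ofReal (T ^ γ) * (ENNReal.ofReal (T⁻¹ ^ γ) *
          ∫⁻ z in DD d t0 t1 R, ENNReal.ofReal (frobNorm (m z)) ^ γ) := by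
          rw [← mul_assoc, hTg, one_mul]
      _ ≤ ENNReal.ofReal (T ^ γ) * ENNReal.ofReal N1 := by gcongr
      _ = _ := by
          rw [← ENNReal.ofReal_mul (by positivity), hT, Real.mul_rpow (by positivity) (by positivity)]
          congr 1; ring
  · intro z hz
    have e1 := h1 z hz
    have e2 := h2 z hz
    have e : T⁻¹ * u z + T⁻¹ * S = T⁻¹ * (u z + S) := by ring
    have hTi : 0 < T⁻¹ := by positivity
    constructor
    · show 0 ≤ T⁻¹ * u z + T⁻¹ * S
      rw [e]; exact mul_nonneg hTi.le (by linarith)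
    · show T⁻¹ * u z + T⁻¹ * S ≤ 1
      rw [e, inv_mul_le_iff₀ hTpos]; linarith
  · intro z hz
    refine ⟨a z, ha z, ?_⟩
    have hTi : 0 < T⁻¹ := by positivity
    have e3 : (∑ i, ∑ j, a z i j * (T⁻¹ • m z) i j) = T⁻¹ * ∑ i, ∑ j, a z i j * m z i j := by
      simp only [Matrix.smul_apply, smul_eq_mul, Finset.mul_sum]
      refine Finset.sum_congr rfl fun i _ => Finset.sum_congr rfl fun j _ => by ring
    have e1 := (abs_le.1 (hL z hz)).2
    have e2 := (abs_le.1 (drift_le (b z) (G z) (hb z))).1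
    have e4 := h2 z (DD_sub _ _ _ _ hz)
    have e5 : c z * u z ≤ K * T := by
      calc c z * u z ≤ c z * T := mul_le_mul_of_nonneg_left (by linarith) (hc z)
        _ ≤ K * T := mul_le_mul_of_nonneg_right (hcK z) hTpos.le
    rw [e3, norm_smul, Real.norm_eq_abs, abs_of_pos hTi]
    have e6 : ut z + (∑ i, ∑ j, a z i j * m z i j) ≤ f z + K * (T + ‖G z‖) := by
      nlinarith
    calc T⁻¹ * ut z + T⁻¹ * (∑ i, ∑ j, a z i j * m z i j)
        = T⁻¹ * (ut z + (∑ i, ∑ j, a z i j * m z i j)) := by ring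
      _ ≤ T⁻¹ * (f z + K * (T + ‖G z‖)) := mul_le_mul_of_nonneg_left e6 hTi.le
      _ = _ := by field_simp
  · have e : ∀ z, ENNReal.ofReal (T⁻¹ * f z) ^ (d + 1) =
        ENNReal.ofReal (T⁻¹ ^ (d + 1)) * ENNReal.ofReal (f z) ^ (d + 1) := by
      intro z
      rw [ENNReal.ofReal_mul (by positivity), mul_pow, ENNReal.ofReal_pow (by positivity)]
    simp only [e]
    rw [lintegral_const_mul' _ _ ENNReal.ofReal_ne_top]
    calc _ ≤ ENNReal.ofReal (T⁻¹ ^ (d + 1)) * ENNReal.ofReal (Λ ^ (d + 1)) := by gcongr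
      _ = ENNReal.ofReal ((T⁻¹ * Λ) ^ (d + 1)) := by
        rw [← ENNReal.ofReal_mul (by positivity), mul_pow]
      _ ≤ ENNReal.ofReal 1 := by
        apply ENNReal.ofReal_le_ofReal
        apply pow_le_one₀ (by positivity)
        rw [inv_mul_le_iff₀ hTpos]; linarith
      _ = 1 := by simp

end

open MeasureTheory ENNReal Set

noncomputable section

/-- mollification -/
def moll {d : ℕ} (φ : ContDiffBump (0 : ZZ d)) (g : ZZ d → ℝ) : ZZ d → ℝ :=
  MeasureTheory.convolution (φ.normed volume) g (ContinuousLinearMap.lsmul ℝ ℝ) volume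

lemma moll_apply {d : ℕ} (φ : ContDiffBump (0 : ZZ d)) (g : ZZ d → ℝ) (z : ZZ d) :
    moll φ g z = ∫ y, φ.normed volume y * g (z - y) := rfl

lemma moll_apply' {d : ℕ} (φ : ContDiffBump (0 : ZZ d)) (g : ZZ d → ℝ) (z : ZZ d) :
    moll φ g z = ∫ y, φ.normed volume (z - y) * g y := by
  unfold moll
  rw [convolution_eq_swap]; rfl

lemma moll_int {d : ℕ} (φ : ContDiffBump (0 : ZZ d)) {g : ZZ d → ℝ} (hg : LocallyIntegrable g)
    (z : ZZ d) : Integrable (fun y => φ.normed volume y * g (z - y)) :=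
  φ.hasCompactSupport_normed.convolutionExists_left (ContinuousLinearMap.lsmul ℝ ℝ)
    φ.continuous_normed hg z

/-- continuity of translations -/
lemma trans_lp {d : ℕ} {g : ZZ d → ℝ} {p : ℝ≥0∞} (hp1 : 1 ≤ p) (hp : p ≠ ∞) (hg : MemLp g p)
    {ε : ℝ} (hε : 0 < ε) :
    ∃ r > 0, ∀ y : ZZ d, ‖y‖ < r →
      eLpNorm (fun z => g (z - y) - g z) p volume ≤ ENNReal.ofReal ε := by
  have : Fact (1 ≤ p) := ⟨hp1⟩
  have : Fact (p ≠ ∞) := ⟨hp⟩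
  let T : C(ZZ d, C(ZZ d, ZZ d)) :=
    (ContinuousMap.mk (fun x : ZZ d × ZZ d => x.2 - x.1) (by fun_prop)).curry
  have hT : ∀ y : ZZ d, MeasurePreserving (T y) volume volume := fun y =>
    measurePreserving_sub_right volume y
  have hc : Continuous fun y : ZZ d => Lp.compMeasurePreserving (T y) (hT y) (hg.toLp g) :=
    (continuous_const (y := hg.toLp g)).compMeasurePreservingLp T.continuous hT hp
  obtain ⟨r, hr, h⟩ := Metric.continuousAt_iff.1 (hc.continuousAt (x := 0)) ε hε
  refine ⟨r, hr, fun y hy => ?_⟩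
  have h1 := @h y (by simpa using hy)
  rw [Lp.dist_def] at h1
  have e1 : eLpNorm (fun z => g (z - y) - g z) p volume =
      eLpNorm ((⇑(Lp.compMeasurePreserving (T y) (hT y) (hg.toLp g))) -
        ⇑(Lp.compMeasurePreserving (T 0) (hT 0) (hg.toLp g))) p volume := by
    apply eLpNorm_congr_ae
    filter_upwards [Lp.coeFn_compMeasurePreserving (hg.toLp g) (hT y),
      Lp.coeFn_compMeasurePreserving (hg.toLp g) (hT 0),
      (hT y).quasiMeasurePreserving.ae hg.coeFn_toLp,
      (hT 0).quasiMeasurePreserving.ae hg.coeFn_toLp] with z h1 h2 h3 h4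
    simp only [Pi.sub_apply]
    rw [h2, h1]
    simp only [Function.comp_apply]
    rw [h3, h4]
    simp [T]
  rw [e1, ← ENNReal.ofReal_toReal (a := eLpNorm _ p volume)]
  · exact ENNReal.ofReal_le_ofReal h1.le
  · exact (((Lp.memLp _).sub (Lp.memLp _)).eLpNorm_lt_top).ne

lemma moll_lp {d : ℕ} {g : ZZ d → ℝ} {q : ℝ} (hq : 1 ≤ q) (hgm : Measurable g)
    (hg : MemLp g (ENNReal.ofReal q)) {ε : ℝ} (hε : 0 < ε) :
    ∃ r > 0, ∀ φ : ContDiffBump (0 : ZZ d), φ.rOut ≤ r →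
      eLpNorm (fun z => moll φ g z - g z) (ENNReal.ofReal q) volume ≤ ENNReal.ofReal ε := by
  have hq0 : 0 < q := by linarith
  have hp1 : 1 ≤ ENNReal.ofReal q := by simpa using hq
  obtain ⟨r, hr, h⟩ := trans_lp hp1 ENNReal.ofReal_ne_top hg hε
  refine ⟨r, hr, fun φ hφ => ?_⟩
  have hloc : LocallyIntegrable g := hg.locallyIntegrable hp1
  have hpt : (ENNReal.ofReal q).toReal = q := ENNReal.toReal_ofReal hq0.le
  have hpne : ENNReal.ofReal q ≠ 0 := by simpa using hq0
  set ψ := φ.normed (volume : Measure (ZZ d)) with hψ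
  have hψm : Measurable ψ := φ.continuous_normed.measurable
  have hψ1 : ∫⁻ y, ENNReal.ofReal (ψ y) = 1 := by
    rw [← ofReal_integral_eq_lintegral_ofReal φ.integrable_normed
      (Filter.Eventually.of_forall φ.nonneg_normed), φ.integral_normed]
    simp
  set ν : Measure (ZZ d) := volume.withDensity fun y => ENNReal.ofReal (ψ y) with hν
  have : IsProbabilityMeasure ν := ⟨by rw [hν, withDensity_apply _ MeasurableSet.univ]; simpa using hψ1⟩
  have hsub : Measurable fun x : ZZ d × ZZ d => ‖g (x.1 - x.2) - g x.1‖ₑ ^ q := by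
    have h1 : Measurable fun x : ZZ d × ZZ d => g (x.1 - x.2) := hgm.comp (measurable_fst.sub measurable_snd)
    have h2 : Measurable fun x : ZZ d × ZZ d => g x.1 := hgm.comp measurable_fst
    exact (h1.sub h2).enorm.pow_const q
  have hpt1 : ∀ z, ‖moll φ g z - g z‖ₑ ^ q ≤
      ∫⁻ y, ENNReal.ofReal (ψ y) * ‖g (z - y) - g z‖ₑ ^ q := by
    intro z
    have hm : Measurable fun y => g (z - y) - g z := (hgm.comp (measurable_const.sub measurable_id)).sub_const _
    have e1 : moll φ g z - g z = ∫ y, ψ y * (g (z - y) - g z) := by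
      simp only [mul_sub]
      rw [integral_sub (moll_int φ hloc z) (φ.integrable_normed.mul_const _), integral_mul_const,
        φ.integral_normed, one_mul, moll_apply]
    have e2 : ‖moll φ g z - g z‖ₑ ≤ eLpNorm (fun y => g (z - y) - g z) 1 ν := by
      rw [e1, eLpNorm_one_eq_lintegral_enorm, hν,
        lintegral_withDensity_eq_lintegral_mul _ hψm.ennreal_ofReal hm.enorm]
      refine (enorm_integral_le_lintegral_enorm _).trans (le_of_eq ?_)
      congr 1; ext y
      simp only [Pi.mul_apply, enorm_mul]
      rw [Real.enorm_of_nonneg (φ.nonneg_normed y)]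
    have e3 := e2.trans (eLpNorm_le_eLpNorm_of_exponent_le hp1 hm.aestronglyMeasurable)
    rw [eLpNorm_eq_lintegral_rpow_enorm_toReal hpne ENNReal.ofReal_ne_top, hpt] at e3
    have e4 := ENNReal.rpow_le_rpow e3 hq0.le
    rw [← ENNReal.rpow_mul, one_div, inv_mul_cancel₀ hq0.ne', ENNReal.rpow_one, hν,
      lintegral_withDensity_eq_lintegral_mul _ hψm.ennreal_ofReal (hm.enorm.pow_const q)] at e4
    exact e4
  rw [eLpNorm_eq_lintegral_rpow_enorm_toReal hpne ENNReal.ofReal_ne_top, hpt]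
  have key : ∫⁻ z, ‖moll φ g z - g z‖ₑ ^ q ≤ ENNReal.ofReal ε ^ q := by
    calc ∫⁻ z, ‖moll φ g z - g z‖ₑ ^ q
        ≤ ∫⁻ z, ∫⁻ y, ENNReal.ofReal (ψ y) * ‖g (z - y) - g z‖ₑ ^ q := lintegral_mono hpt1
      _ = ∫⁻ y, ∫⁻ z, ENNReal.ofReal (ψ y) * ‖g (z - y) - g z‖ₑ ^ q := by
          apply lintegral_lintegral_swap
          exact (((hψm.comp measurable_snd).ennreal_ofReal).mul hsub).aemeasurable
      _ ≤ ∫⁻ y, ENNReal.ofReal (ψ y) * ENNReal.ofReal ε ^ q := by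
          apply lintegral_mono
          intro y
          show ∫⁻ z, ENNReal.ofReal (ψ y) * ‖g (z - y) - g z‖ₑ ^ q ≤ _
          rw [lintegral_const_mul' _ _ ENNReal.ofReal_ne_top]
          by_cases hy : ‖y‖ < r
          · refine mul_le_mul_right ?_ _
            have h2 := h y hy
            rw [eLpNorm_eq_lintegral_rpow_enorm_toReal hpne ENNReal.ofReal_ne_top, hpt] at h2
            have e4 := ENNReal.rpow_le_rpow h2 hq0.le
            rwa [← ENNReal.rpow_mul, one_div, inv_mul_cancel₀ hq0.ne', ENNReal.rpow_one] at e4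
          · have : ψ y = 0 := by
              have : y ∉ Function.support ψ := by
                rw [hψ, φ.support_normed_eq]
                simp only [Metric.mem_ball, dist_zero_right, not_lt]
                linarith [not_lt.1 hy]
              simpa using this
            simp [this]
      _ = ENNReal.ofReal ε ^ q := by
          rw [lintegral_mul_const _ hψm.ennreal_ofReal, hψ1, one_mul]
  calc _ ≤ (ENNReal.ofReal ε ^ q) ^ (1 / q) := by gcongr
    _ = ENNReal.ofReal ε := by rw [← ENNReal.rpow_mul, mul_one_div_cancel hq0.ne', ENNReal.rpow_one]

end

open MeasureTheory ENNReal Set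

noncomputable section

/-- spatial directions -/
def dirx (d : ℕ) (i : Fin d) : ZZ d := (0, EuclideanSpace.single i (1 : ℝ))
/-- time direction -/
def dirt (d : ℕ) : ZZ d := (1, 0)

/-- `∂ₜ w` -/
def smt {d : ℕ} (w : ZZ d → ℝ) (z : ZZ d) : ℝ := fderiv ℝ w z (dirt d)
/-- `Dw` -/
def smG {d : ℕ} (w : ZZ d → ℝ) (z : ZZ d) : EE d := WithLp.toLp 2 fun i => fderiv ℝ w z (dirx d i)
/-- `D²w` -/
def smm {d : ℕ} (w : ZZ d → ℝ) (z : ZZ d) : Matrix (Fin d) (Fin d) ℝ :=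
  Matrix.of fun i j => fderiv ℝ (fun z => fderiv ℝ w z (dirx d i)) z (dirx d j)
/-- `∂ₜ Dw` -/
def smk {d : ℕ} (w : ZZ d → ℝ) (z : ZZ d) : EE d :=
  WithLp.toLp 2 fun i => fderiv ℝ (fun z => fderiv ℝ w z (dirx d i)) z (dirt d)

lemma decomp {d : ℕ} (y : ZZ d) : y = y.1 • dirt d + ∑ i, y.2 i • dirx d i := by
  unfold dirt dirx
  refine Prod.ext ?_ ?_
  · simp [Prod.fst_sum]
  · ext j
    simp [Prod.snd_sum, Finset.sum_apply, Pi.single_apply]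

lemma sm_of_contDiff {d : ℕ} {w : ZZ d → ℝ} (hw : ContDiff ℝ 2 w) :
    Sm w (smt w) (smG w) (smm w) (smk w) ∧ Continuous (smt w) ∧
      ∀ i j, Continuous fun z => smm w z i j := by
  have hd : ∀ v, ContDiff ℝ 1 fun z => fderiv ℝ w z v := fun v =>
    (hw.fderiv_right (m := 1) (by norm_num)).clm_apply contDiff_const
  refine ⟨⟨fun z => ?_, fun z => ?_, fun z => ?_⟩, (hd _).continuous, fun i j => ?_⟩
  · have h := (hw.differentiable (by norm_num) z).hasFDerivAt
    refine h.congr_fderiv ?_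
    refine ContinuousLinearMap.ext fun y => ?_
    conv_lhs => rw [decomp y]
    simp only [map_add, map_smul, map_sum, smul_eq_mul]
    simp [smt, smG, PiLp.inner_apply, mul_comm]
  · rw [← hasFDerivWithinAt_univ, hasFDerivWithinAt_euclidean]
    intro i
    rw [hasFDerivWithinAt_univ]
    have h := ((hd (dirx d i)).differentiable (by norm_num) z).hasFDerivAt
    refine h.congr_fderiv ?_
    refine ContinuousLinearMap.ext fun y => ?_
    conv_lhs => rw [decomp y]
    simp only [map_add, map_smul, map_sum, smul_eq_mul]
    simp [smm, smk, Matrix.toEuclideanLin, Matrix.mulVec, dotProduct, mul_comm, add_comm]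
  · have hs : IsSymmSndFDerivAt ℝ w z :=
      (hw.contDiffAt).isSymmSndFDerivAt (by simp)
    have e : ∀ v v', fderiv ℝ (fun z => fderiv ℝ w z v) z v' = fderiv ℝ (fderiv ℝ w) z v' v := by
      intro v v'
      have h1 : HasFDerivAt (fderiv ℝ w) (fderiv ℝ (fderiv ℝ w) z) z :=
        ((hw.fderiv_right (m := 1) (by norm_num)).differentiable (by norm_num) z).hasFDerivAt
      have h2 := h1.clm_apply (hasFDerivAt_const v z)
      rw [h2.fderiv]
      simp
    ext i j
    simp only [smm, Matrix.transpose_apply, Matrix.of_apply, e]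
    exact hs.eq _ _
  · have := (hd (dirx d i)).continuous_fderiv (by norm_num)
    exact this.clm_apply continuous_const

lemma moll_contDiff {d : ℕ} (φ : ContDiffBump (0 : ZZ d)) {g : ZZ d → ℝ} (hg : LocallyIntegrable g) :
    ContDiff ℝ 2 (moll φ g) := by
  have := φ.hasCompactSupport_normed.contDiff_convolution_left (n := 2)
    (ContinuousLinearMap.lsmul ℝ ℝ) (φ.contDiff_normed (μ := volume)) hg
  exact_mod_cast this

lemma moll_fderiv {d : ℕ} (φ : ContDiffBump (0 : ZZ d)) {g : ZZ d → ℝ} (hg : LocallyIntegrable g)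
    (z v : ZZ d) : fderiv ℝ (moll φ g) z v =
      ∫ y, g y * fderiv ℝ (φ.normed volume) (z - y) v := by
  have hsm : ContDiff ℝ 1 (φ.normed (volume : Measure (ZZ d))) :=
    φ.contDiff_normed (n := 1)
  have h := (φ.hasCompactSupport_normed (μ := volume)).hasFDerivAt_convolution_right
    (ContinuousLinearMap.lsmul ℝ ℝ).flip hg hsm z
  rw [convolution_flip] at h
  have h2 : HasFDerivAt (moll φ g) _ z := h
  rw [h2.fderiv, convolution_precompR_apply _ hg (φ.hasCompactSupport_normed.fderiv ℝ)
    (hsm.continuous_fderiv (by norm_num))]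
  simp only [convolution_def]
  congr 1; ext y
  simp [mul_comm]

lemma moll_deriv {d : ℕ} (φ : ContDiffBump (0 : ZZ d)) {f f' : ZZ d → ℝ} {U : Set (ZZ d)} {v z : ZZ d}
    (hf : LocallyIntegrable (U.indicator f)) (hf' : LocallyIntegrable (U.indicator f'))
    (hz : Metric.closedBall z φ.rOut ⊆ U)
    (h : ∀ x ∈ Metric.closedBall z φ.rOut, HasLineDerivAt ℝ f (f' x) x v) :
    fderiv ℝ (moll φ (U.indicator f)) z v = moll φ (U.indicator f') z := by
  have hsm : ContDiff ℝ 1 (φ.normed (volume : Measure (ZZ d))) :=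
    φ.contDiff_normed (n := 1)
  set ψ := φ.normed (volume : Measure (ZZ d)) with hψ
  rw [moll_fderiv φ hf, moll_apply']
  have hg0 : ∀ y, y ∉ Metric.closedBall z φ.rOut → ψ (z - y) = 0 := by
    intro y hy
    have : z - y ∉ tsupport ψ := by
      rw [hψ, φ.tsupport_normed_eq]
      simpa [dist_eq_norm, norm_sub_rev] using hy
    exact image_eq_zero_of_notMem_tsupport this
  have hg0' : ∀ y, y ∉ Metric.closedBall z φ.rOut → fderiv ℝ ψ (z - y) = 0 := by
    intro y hy
    have : z - y ∉ tsupport ψ := by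
      rw [hψ, φ.tsupport_normed_eq]
      simpa [dist_eq_norm, norm_sub_rev] using hy
    exact image_eq_zero_of_notMem_tsupport (fun hh => this (tsupport_fderiv_subset ℝ hh))
  have e1 : ∀ y, U.indicator f y * fderiv ℝ ψ (z - y) v = f y * fderiv ℝ ψ (z - y) v := by
    intro y
    by_cases hy : y ∈ Metric.closedBall z φ.rOut
    · rw [indicator_of_mem (hz hy)]
    · simp [hg0' y hy]
  have e2 : ∀ y, U.indicator f y * ψ (z - y) = f y * ψ (z - y) := by
    intro y
    by_cases hy : y ∈ Metric.closedBall z φ.rOut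
    · rw [indicator_of_mem (hz hy)]
    · simp [hg0 y hy]
  have e3 : ∀ y, U.indicator f' y * ψ (z - y) = f' y * ψ (z - y) := by
    intro y
    by_cases hy : y ∈ Metric.closedBall z φ.rOut
    · rw [indicator_of_mem (hz hy)]
    · simp [hg0 y hy]
  have hcs : HasCompactSupport fun y => ψ (z - y) :=
    HasCompactSupport.intro (isCompact_closedBall z φ.rOut) hg0
  have hcs' : HasCompactSupport fun y => fderiv ℝ ψ (z - y) v :=
    HasCompactSupport.intro (isCompact_closedBall z φ.rOut) (fun y hy => by rw [hg0' y hy]; simp)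
  have hcont : Continuous fun y => ψ (z - y) := φ.continuous_normed.comp (by fun_prop)
  have hcont' : Continuous fun y => fderiv ℝ ψ (z - y) v :=
    ((hsm.continuous_fderiv (by norm_num)).comp (by fun_prop)).clm_apply continuous_const
  have key := integral_bilinear_hasLineDerivAt_right_eq_neg_left_of_integrable
    (μ := (volume : Measure (ZZ d))) (f := f) (f' := f')
    (g := fun y => ψ (z - y)) (g' := fun y => - fderiv ℝ ψ (z - y) v) (v := v)
    (B := ContinuousLinearMap.mul ℝ ℝ) ?_ ?_ ?_ ?_ ?_
  · simp only [ContinuousLinearMap.mul_apply', mul_neg] at key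
    rw [integral_neg, neg_inj] at key
    simp only [← hψ, e1]
    rw [key]
    congr 1; ext y
    rw [mul_comm (ψ (z - y)), e3]
  · simp only [ContinuousLinearMap.mul_apply', ← e3]
    have := hf'.integrable_smul_right_of_hasCompactSupport hcont hcs
    simpa [smul_eq_mul] using this
  · simp only [ContinuousLinearMap.mul_apply', mul_neg, ← e1]
    have := hf.integrable_smul_right_of_hasCompactSupport hcont' hcs'
    exact Integrable.neg (by simpa [smul_eq_mul] using this)
  · simp only [ContinuousLinearMap.mul_apply', ← e2]
    have := hf.integrable_smul_right_of_hasCompactSupport hcont hcs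
    simpa [smul_eq_mul] using this
  · intro x hx
    apply h x
    have hsub : tsupport (fun y => ψ (z - y)) ⊆ Metric.closedBall z φ.rOut := by
      apply closure_minimal _ Metric.isClosed_closedBall
      intro y hy
      by_contra hc
      exact hy (hg0 y hc)
    exact hsub hx
  · intro x _
    have h1 : HasFDerivAt ψ (fderiv ℝ ψ (z - x)) (z - x) :=
      (hsm.differentiable (by norm_num) (z - x)).hasFDerivAt
    have h2 : HasFDerivAt (fun y : ZZ d => z - y) (-ContinuousLinearMap.id ℝ (ZZ d)) x :=
      (hasFDerivAt_id x).const_sub z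
    have h3 := (h1.comp x h2).hasLineDerivAt v
    have e : (fderiv ℝ ψ (z - x) ∘SL (-ContinuousLinearMap.id ℝ (ZZ d))) v = -fderiv ℝ ψ (z - x) v := by
      simp
    rw [e] at h3
    exact h3

end

open MeasureTheory ENNReal Set

noncomputable section

lemma inner_sub {d : ℕ} {η : ℝ} {z x : ZZ d} (hz : z ∈ QQ d η (1 - η) (1 - η))
    (hx : dist x z < η / 2) : x ∈ QQ d (η / 2) (1 - η / 2) (1 - η / 2) := by
  obtain ⟨⟨h1, h2⟩, h3⟩ := hz
  rw [Prod.dist_eq, max_lt_iff, Real.dist_eq, abs_lt] at hx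
  obtain ⟨⟨h4, h5⟩, h6⟩ := hx
  refine ⟨⟨by linarith, by linarith⟩, ?_⟩
  rw [Metric.mem_closedBall] at *
  calc dist x.2 0 ≤ dist x.2 z.2 + dist z.2 0 := dist_triangle _ _ _
    _ ≤ _ := by linarith

lemma QQ_sub_C1 {d : ℕ} {η : ℝ} (hη : 0 < η) : QQ d η (1 - η) (1 - η) ⊆
    Ioo (0 : ℝ) 1 ×ˢ Metric.ball (0 : EuclideanSpace ℝ (Fin d)) 1 := by
  rintro z ⟨⟨h1, h2⟩, h3⟩
  refine ⟨⟨by linarith, by linarith⟩, ?_⟩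
  rw [Metric.mem_closedBall] at h3
  rw [Metric.mem_ball]; linarith

lemma memLp_of {d : ℕ} {q : ℝ} (hq : 1 ≤ q) {U : Set (ZZ d)} (hU : MeasurableSet U) {g F : ZZ d → ℝ}
    (hg : Measurable g) (hF : IntegrableOn F U) (h : ∀ z, |g z| ^ q ≤ F z) :
    MemLp (U.indicator g) (ENNReal.ofReal q) := by
  have hq0 : 0 < q := by linarith
  rw [memLp_indicator_iff_restrict hU]
  rw [← integrable_norm_rpow_iff hg.aestronglyMeasurable (by simpa using hq0) ENNReal.ofReal_ne_top,
    ENNReal.toReal_ofReal hq0.le]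
  refine Integrable.mono' hF (hg.norm.pow_const q).aestronglyMeasurable ?_
  refine Filter.Eventually.of_forall fun z => ?_
  rw [Real.norm_of_nonneg (by positivity)]
  exact h z

lemma ev_of {P : ℝ → Prop} (h : ∃ r > 0, ∀ s, s ≤ r → P s) :
    ∀ᶠ s in nhdsWithin (0 : ℝ) (Ioi 0), P s := by
  obtain ⟨r, hr, h⟩ := h
  filter_upwards [Ioo_mem_nhdsGT hr] with s hs using h s hs.2.le

lemma approx {d : ℕ} {q : ℝ} (hq : 1 ≤ q) (u ut : ZZ d → ℝ) (du : ZZ d → EE d)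
    (d2u : ZZ d → Matrix (Fin d) (Fin d) ℝ)
    (hum : Measurable u) (hutm : Measurable ut) (hdum : ∀ i, Measurable fun z => du z i)
    (hd2um : ∀ i j, Measurable fun z => d2u z i j)
    (huc : ContinuousOn u (Ioo (0 : ℝ) 1 ×ˢ Metric.ball (0 : EuclideanSpace ℝ (Fin d)) 1))
    (h1 : ∀ z ∈ Ioo (0 : ℝ) 1 ×ˢ Metric.ball (0 : EuclideanSpace ℝ (Fin d)) 1,
          HasDerivAt (fun s => u (s, z.2)) (ut z) z.1)
    (h2 : ∀ z ∈ Ioo (0 : ℝ) 1 ×ˢ Metric.ball (0 : EuclideanSpace ℝ (Fin d)) 1, ∀ i,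
          HasDerivAt (fun s : ℝ => u (z.1, z.2 + s • EuclideanSpace.single i (1 : ℝ))) (du z i) 0)
    (h3 : ∀ z ∈ Ioo (0 : ℝ) 1 ×ˢ Metric.ball (0 : EuclideanSpace ℝ (Fin d)) 1, ∀ i j,
          HasDerivAt (fun s : ℝ => du (z.1, z.2 + s • EuclideanSpace.single j (1 : ℝ)) i)
            (d2u z i j) 0)
    (hIntg : ∀ G : Set (ZZ d), IsCompact G →
          G ⊆ Ioo (0 : ℝ) 1 ×ˢ Metric.ball (0 : EuclideanSpace ℝ (Fin d)) 1 →
          IntegrableOn (fun z => |ut z| ^ q + ‖du z‖ ^ q + frobNorm (d2u z) ^ q) G volume)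
    {η ε : ℝ} (hη : 0 < η) (hε : 0 < ε) :
    ∃ (w wt : ZZ d → ℝ) (G : ZZ d → EE d) (m : ZZ d → Matrix (Fin d) (Fin d) ℝ) (k : ZZ d → EE d),
      Sm w wt G m k ∧ Continuous wt ∧ (∀ i j, Continuous fun z => m z i j) ∧
      (∀ z ∈ QQ d η (1 - η) (1 - η), |w z - u z| ≤ ε) ∧
      eLpNorm (fun z => wt z - ut z) (ENNReal.ofReal q)
        (volume.restrict (DD d η (1 - η) (1 - η))) ≤ ENNReal.ofReal ε ∧
      (∀ i, eLpNorm (fun z => G z i - du z i) (ENNReal.ofReal q)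
        (volume.restrict (DD d η (1 - η) (1 - η))) ≤ ENNReal.ofReal ε) ∧
      (∀ i j, eLpNorm (fun z => m z i j - d2u z i j) (ENNReal.ofReal q)
        (volume.restrict (DD d η (1 - η) (1 - η))) ≤ ENNReal.ofReal ε) := by
  have hq0 : 0 < q := by linarith
  have hp1 : 1 ≤ ENNReal.ofReal q := by simpa using hq
  set U := QQ d (η / 2) (1 - η / 2) (1 - η / 2) with hU
  have hUc : IsCompact U := QQ_compact _ _ _ _
  have hUm : MeasurableSet U := hUc.measurableSet
  have hUC : U ⊆ Ioo (0 : ℝ) 1 ×ˢ Metric.ball (0 : EuclideanSpace ℝ (Fin d)) 1 :=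
    QQ_sub_C1 (by positivity)
  have hI := hIntg U hUc hUC
  have hf0 : ∀ z, 0 ≤ frobNorm (d2u z) := fun z => frobNorm_nonneg _
  have Lut : MemLp (U.indicator ut) (ENNReal.ofReal q) := by
    refine memLp_of hq hUm hutm hI fun z => ?_
    have := hf0 z
    have e1 : 0 ≤ ‖du z‖ ^ q := by positivity
    have e2 : 0 ≤ frobNorm (d2u z) ^ q := by positivity
    linarith
  have Ldu : ∀ i, MemLp (U.indicator fun z => du z i) (ENNReal.ofReal q) := by
    intro i
    refine memLp_of hq hUm (hdum i) hI fun z => ?_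
    have := hf0 z
    have e1 : 0 ≤ |ut z| ^ q := by positivity
    have e2 : 0 ≤ frobNorm (d2u z) ^ q := by positivity
    have e3 : |du z i| ^ q ≤ ‖du z‖ ^ q :=
      Real.rpow_le_rpow (abs_nonneg _) (PiLp.norm_apply_le (du z) i) hq0.le
    linarith
  have Ld2u : ∀ i j, MemLp (U.indicator fun z => d2u z i j) (ENNReal.ofReal q) := by
    intro i j
    refine memLp_of hq hUm (hd2um i j) hI fun z => ?_
    have e1 : 0 ≤ |ut z| ^ q := by positivity
    have e2 : 0 ≤ ‖du z‖ ^ q := by positivity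
    have e3 : |d2u z i j| ^ q ≤ frobNorm (d2u z) ^ q :=
      Real.rpow_le_rpow (abs_nonneg _) (abs_entry_le_frobNorm _ i j) hq0.le
    linarith
  have lu : LocallyIntegrable (U.indicator u) :=
    ((integrable_indicator_iff hUm).2 ((huc.mono hUC).integrableOn_compact hUc)).locallyIntegrable
  have lut := Lut.locallyIntegrable hp1
  have ldu := fun i => (Ldu i).locallyIntegrable hp1
  have ld2u := fun i j => (Ld2u i j).locallyIntegrable hp1
  -- choose the mollification parameter
  have E1 : ∀ᶠ s in nhdsWithin (0 : ℝ) (Ioi 0), ∀ φ : ContDiffBump (0 : ZZ d), φ.rOut = s →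
      eLpNorm (fun z => moll φ (U.indicator ut) z - U.indicator ut z) (ENNReal.ofReal q) volume
        ≤ ENNReal.ofReal ε := by
    apply ev_of
    obtain ⟨r, hr, h⟩ := moll_lp hq (hutm.indicator hUm) Lut hε
    exact ⟨r, hr, fun s hs φ hφ => h φ (by linarith)⟩
  have E2 : ∀ᶠ s in nhdsWithin (0 : ℝ) (Ioi 0), ∀ i, ∀ φ : ContDiffBump (0 : ZZ d), φ.rOut = s →
      eLpNorm (fun z => moll φ (U.indicator fun z => du z i) z - U.indicator (fun z => du z i) z)
        (ENNReal.ofReal q) volume ≤ ENNReal.ofReal ε := by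
    rw [Filter.eventually_all]
    intro i
    apply ev_of
    obtain ⟨r, hr, h⟩ := moll_lp hq ((hdum i).indicator hUm) (Ldu i) hε
    exact ⟨r, hr, fun s hs φ hφ => h φ (by linarith)⟩
  have E3 : ∀ᶠ s in nhdsWithin (0 : ℝ) (Ioi 0), ∀ i j, ∀ φ : ContDiffBump (0 : ZZ d), φ.rOut = s →
      eLpNorm (fun z => moll φ (U.indicator fun z => d2u z i j) z -
        U.indicator (fun z => d2u z i j) z) (ENNReal.ofReal q) volume ≤ ENNReal.ofReal ε := by
    rw [Filter.eventually_all]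
    intro i
    rw [Filter.eventually_all]
    intro j
    apply ev_of
    obtain ⟨r, hr, h⟩ := moll_lp hq ((hd2um i j).indicator hUm) (Ld2u i j) hε
    exact ⟨r, hr, fun s hs φ hφ => h φ (by linarith)⟩
  obtain ⟨ρ, hρ, hunif⟩ := Metric.uniformContinuousOn_iff.1
    (hUc.uniformContinuousOn_of_continuous (huc.mono hUC)) ε hε
  have E4 : ∀ᶠ s in nhdsWithin (0 : ℝ) (Ioi 0), s ∈ Ioo (0 : ℝ) (η / 8) :=
    Ioo_mem_nhdsGT (show (0 : ℝ) < η / 8 by positivity)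
  have E5 : ∀ᶠ s in nhdsWithin (0 : ℝ) (Ioi 0), s ∈ Ioo (0 : ℝ) ρ := Ioo_mem_nhdsGT hρ
  obtain ⟨r, e1, e2, e3, hr, hrρ⟩ := (E1.and (E2.and (E3.and (E4.and E5)))).exists
  let φ : ContDiffBump (0 : ZZ d) := ⟨r / 2, r, by linarith [hr.1], by linarith [hr.1]⟩
  have hφr : φ.rOut = r := rfl
  have hnear : ∀ z ∈ QQ d η (1 - η) (1 - η), ∀ z' ∈ Metric.ball z (η / 8),
      Metric.closedBall z' φ.rOut ⊆ U := by
    intro z hz z' hz' x hx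
    rw [hφr, Metric.mem_closedBall] at hx
    rw [Metric.mem_ball] at hz'
    apply inner_sub hz
    calc dist x z ≤ dist x z' + dist z' z := dist_triangle _ _ _
      _ < η / 2 := by linarith [hr.2]
  have hself : ∀ z : ZZ d, z ∈ Metric.ball z (η / 8) := fun z =>
    Metric.mem_ball_self (by positivity)
  have D1 : ∀ z ∈ QQ d η (1 - η) (1 - η),
      fderiv ℝ (moll φ (U.indicator u)) z (dirt d) = moll φ (U.indicator ut) z := by
    intro z hz
    refine moll_deriv φ lu lut (hnear z hz z (hself z)) fun x hx => ?_
    have hxU := hUC (hnear z hz z (hself z) hx)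
    have := h1 x hxU
    unfold HasLineDerivAt
    have e : (fun t : ℝ => u (x + t • dirt d)) = (fun s => u (s, x.2)) ∘ fun t => t + x.1 := by
      ext t
      simp only [Function.comp_apply]
      congr 1
      refine Prod.ext ?_ ?_ <;> simp [dirt, add_comm]
    rw [e]
    have h0 : HasDerivAt (fun t : ℝ => t + x.1) 1 0 := (hasDerivAt_id 0).add_const _
    have := HasDerivAt.comp (h₂ := fun s => u (s, x.2)) (h := fun t : ℝ => t + x.1) 0
      (by simpa using this) h0
    simpa using this
  have D2 : ∀ i, ∀ z ∈ QQ d η (1 - η) (1 - η), ∀ z' ∈ Metric.ball z (η / 8),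
      fderiv ℝ (moll φ (U.indicator u)) z' (dirx d i) =
        moll φ (U.indicator fun z => du z i) z' := by
    intro i z hz z' hz'
    refine moll_deriv φ lu (ldu i) (hnear z hz z' hz') fun x hx => ?_
    have hxU := hUC (hnear z hz z' hz' hx)
    have := h2 x hxU i
    unfold HasLineDerivAt
    have e : (fun t : ℝ => u (x + t • dirx d i)) =
        fun s : ℝ => u (x.1, x.2 + s • EuclideanSpace.single i (1 : ℝ)) := by
      ext t
      congr 1
      refine Prod.ext ?_ ?_ <;> simp [dirx]
    rw [e]; exact this
  have D3 : ∀ i j, ∀ z ∈ QQ d η (1 - η) (1 - η),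
      fderiv ℝ (fun z => fderiv ℝ (moll φ (U.indicator u)) z (dirx d i)) z (dirx d j) =
        moll φ (U.indicator fun z => d2u z i j) z := by
    intro i j z hz
    have hev : (fun z => fderiv ℝ (moll φ (U.indicator u)) z (dirx d i)) =ᶠ[nhds z]
        moll φ (U.indicator fun z => du z i) := by
      filter_upwards [Metric.ball_mem_nhds z (show (0 : ℝ) < η / 8 by positivity)] with z' hz'
      exact D2 i z hz z' hz'
    rw [hev.fderiv_eq]
    refine moll_deriv φ (ldu i) (ld2u i j) (hnear z hz z (hself z)) fun x hx => ?_
    have hxU := hUC (hnear z hz z (hself z) hx)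
    have := h3 x hxU i j
    unfold HasLineDerivAt
    have e : (fun t : ℝ => du (x + t • dirx d j) i) =
        fun s : ℝ => du (x.1, x.2 + s • EuclideanSpace.single j (1 : ℝ)) i := by
      ext t
      have e' : x + t • dirx d j = (x.1, x.2 + t • EuclideanSpace.single j (1 : ℝ)) := by
        refine Prod.ext ?_ ?_ <;> simp [dirx]
      rw [e']
    rw [e]; exact this
  have hsub : ∀ z ∈ DD d η (1 - η) (1 - η), z ∈ QQ d η (1 - η) (1 - η) := fun z hz =>
    DD_sub _ _ _ _ hz
  have hQU : ∀ z ∈ QQ d η (1 - η) (1 - η), z ∈ U := fun z hz =>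
    inner_sub hz (by simpa using hη)
  have gen : ∀ (F f g : ZZ d → ℝ), (∀ z ∈ QQ d η (1 - η) (1 - η), F z = g z) →
      eLpNorm (fun z => g z - U.indicator f z) (ENNReal.ofReal q) volume ≤ ENNReal.ofReal ε →
      eLpNorm (fun z => F z - f z) (ENNReal.ofReal q)
        (volume.restrict (DD d η (1 - η) (1 - η))) ≤ ENNReal.ofReal ε := by
    intro F f g hFg h
    calc eLpNorm (fun z => F z - f z) (ENNReal.ofReal q)
          (volume.restrict (DD d η (1 - η) (1 - η)))
        = eLpNorm (fun z => g z - U.indicator f z) (ENNReal.ofReal q)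
          (volume.restrict (DD d η (1 - η) (1 - η))) := by
          apply eLpNorm_congr_ae
          filter_upwards [ae_restrict_mem (DD_meas _ _ _ _)] with z hz
          rw [hFg z (hsub z hz), indicator_of_mem (hQU z (hsub z hz))]
      _ ≤ eLpNorm (fun z => g z - U.indicator f z) (ENNReal.ofReal q) volume :=
          eLpNorm_restrict_le _ _ _ _
      _ ≤ _ := h
  obtain ⟨S1, S2, S3⟩ := sm_of_contDiff (moll_contDiff φ lu)
  refine ⟨_, _, _, _, _, S1, S2, S3, ?_, ?_, ?_, ?_⟩
  · intro z hz
    have := φ.dist_normed_convolution_le (μ := volume) (g := U.indicator u) (x₀ := z) (ε := ε)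
      (hum.indicator hUm).aestronglyMeasurable ?_
    · rw [indicator_of_mem (hQU z hz)] at this
      exact this
    · intro x hx
      have hxU := hnear z hz z (hself z) (Metric.ball_subset_closedBall hx)
      rw [indicator_of_mem hxU, indicator_of_mem (hQU z hz)]
      refine (hunif x hxU z (hQU z hz) ?_).le
      rw [Metric.mem_ball] at hx
      linarith [hrρ.2]
  · exact gen _ _ _ D1 (e1 φ hφr)
  · intro i
    exact gen _ _ _ (fun z hz => D2 i z hz z (hself z)) (e2 i φ hφr)
  · intro i j
    exact gen _ _ _ (D3 i j) (e3 i j φ hφr)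

end

open MeasureTheory ENNReal Set

noncomputable section

lemma ell_entry {d : ℕ} {δ : ℝ} (hδ : 0 < δ) {a : Matrix (Fin d) (Fin d) ℝ} (ha : Ell δ a)
    (hs : a.IsSymm) (i j : Fin d) : |a i j| ≤ d * δ⁻¹ := by
  have hp : a.PosSemidef := by
    apply Matrix.PosSemidef.of_dotProduct_mulVec_nonneg
    · unfold Matrix.IsSymm at hs
      unfold Matrix.IsHermitian
      rw [Matrix.conjTranspose_eq_transpose_of_trivial, hs]
    · intro x
      have h1 := (ha (WithLp.toLp 2 x)).1
      have h2 : 0 ≤ δ * ‖(WithLp.toLp 2 x : EE d)‖ ^ 2 := by positivity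
      have h3 : ∑ i, ∑ j, a i j * x i * x j = star x ⬝ᵥ a.mulVec x := by
        simp only [dotProduct, Matrix.mulVec, Finset.mul_sum, star_trivial]
        refine Finset.sum_congr rfl fun i _ => Finset.sum_congr rfl fun j _ => ?_
        ring
      rw [← h3]
      exact h2.trans h1
  refine (psd_entry hp i j).trans ?_
  rw [Matrix.trace]
  calc ∑ i, a.diag i ≤ ∑ _i : Fin d, δ⁻¹ := Finset.sum_le_sum fun i _ => ha.diag_le i
    _ = _ := by simp

lemma frobNorm_add {d : ℕ} (m n : Matrix (Fin d) (Fin d) ℝ) :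
    frobNorm (m + n) ≤ frobNorm m + frobNorm n := by
  have h : ∀ m : Matrix (Fin d) (Fin d) ℝ,
      frobNorm m = ‖(WithLp.toLp 2 (fun p : Fin d × Fin d => m p.1 p.2) :
        EuclideanSpace ℝ (Fin d × Fin d))‖ := by
    intro m
    rw [EuclideanSpace.norm_eq, frobNorm, Fintype.sum_prod_type]
    simp
  have e : (WithLp.toLp 2 (fun p : Fin d × Fin d => (m + n) p.1 p.2) :
        EuclideanSpace ℝ (Fin d × Fin d)) = WithLp.toLp 2 (fun p : Fin d × Fin d => m p.1 p.2) +
        WithLp.toLp 2 (fun p : Fin d × Fin d => n p.1 p.2) := by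
    ext p; simp
  rw [h (m + n), h m, h n, e]
  exact norm_add_le _ _

/-- measurable with bounded `L_p` norm -/
def Bd {d : ℕ} (p : ℝ≥0∞) (μ : Measure (ZZ d)) (g : ZZ d → ℝ) (C : ℝ) : Prop :=
  Measurable g ∧ 0 ≤ C ∧ eLpNorm g p μ ≤ ENNReal.ofReal C

lemma Bd.add {d : ℕ} {p : ℝ≥0∞} (hp : 1 ≤ p) {μ : Measure (ZZ d)} {f g : ZZ d → ℝ} {A B : ℝ}
    (hf : Bd p μ f A) (hg : Bd p μ g B) : Bd p μ (fun z => f z + g z) (A + B) := by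
  refine ⟨hf.1.add hg.1, add_nonneg hf.2.1 hg.2.1, ?_⟩
  rw [ENNReal.ofReal_add hf.2.1 hg.2.1]
  exact (eLpNorm_add_le hf.1.aestronglyMeasurable hg.1.aestronglyMeasurable hp).trans
    (add_le_add hf.2.2 hg.2.2)

lemma Bd.abs {d : ℕ} {p : ℝ≥0∞} {μ : Measure (ZZ d)} {f : ZZ d → ℝ} {A : ℝ}
    (hf : Bd p μ f A) : Bd p μ (fun z => |f z|) A := by
  refine ⟨hf.1.norm, hf.2.1, ?_⟩
  exact (eLpNorm_norm f).trans_le hf.2.2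

lemma Bd.mul {d : ℕ} {p : ℝ≥0∞} {μ : Measure (ZZ d)} {f : ZZ d → ℝ} {A c : ℝ} (hc : 0 ≤ c)
    (hf : Bd p μ f A) : Bd p μ (fun z => c * f z) (c * A) := by
  refine ⟨hf.1.const_mul c, mul_nonneg hc hf.2.1, ?_⟩
  have := eLpNorm_const_smul_le (c := c) (f := f) (p := p) (μ := μ)
  refine (show eLpNorm (fun z => c * f z) p μ ≤ _ from this).trans ?_
  rw [ENNReal.ofReal_mul hc, Real.enorm_eq_ofReal hc]
  gcongr
  exact hf.2.2

lemma Bd.sum {d : ℕ} {p : ℝ≥0∞} (hp : 1 ≤ p) {μ : Measure (ZZ d)} {n : ℕ} {f : Fin n → ZZ d → ℝ}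
    {A : ℝ} (hA : 0 ≤ A) (hf : ∀ i, Bd p μ (f i) A) : Bd p μ (fun z => ∑ i, f i z) (n * A) := by
  refine ⟨Finset.measurable_sum _ fun i _ => (hf i).1, by positivity, ?_⟩
  have h1 := eLpNorm_sum_le (s := Finset.univ) (f := f) (p := p) (μ := μ)
    (fun i _ => (hf i).1.aestronglyMeasurable) hp
  have h2 : (∑ i, f i) = fun z => ∑ i, f i z := by ext z; simp
  rw [h2] at h1
  refine h1.trans ?_
  calc ∑ i, eLpNorm (f i) p μ ≤ ∑ _i : Fin n, ENNReal.ofReal A := Finset.sum_le_sum fun i _ => (hf i).2.2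
    _ = _ := by
      rw [ENNReal.ofReal_mul (by positivity)]
      simp

/-- the `L_q` bound in integral form -/
lemma Bd.lint {d : ℕ} {q : ℝ} (hq : 0 < q) {μ : Measure (ZZ d)} {f : ZZ d → ℝ} {A : ℝ}
    (hf : Bd (ENNReal.ofReal q) μ f A) (h0 : ∀ z, 0 ≤ f z) :
    ∫⁻ z, ENNReal.ofReal (f z) ^ q ∂μ ≤ ENNReal.ofReal A ^ q := by
  have h := hf.2.2
  rw [eLpNorm_eq_lintegral_rpow_enorm_toReal (by simpa using hq) ENNReal.ofReal_ne_top,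
    ENNReal.toReal_ofReal hq.le, one_div] at h
  have h2 := ENNReal.rpow_le_rpow h hq.le
  rw [← ENNReal.rpow_mul, inv_mul_cancel₀ hq.ne', ENNReal.rpow_one] at h2
  refine le_trans (le_of_eq ?_) h2
  refine lintegral_congr fun z => ?_
  rw [Real.enorm_eq_ofReal (h0 z)]

/-- small exponent: Hölder -/
lemma Bd.small {d : ℕ} {q γ : ℝ} (hγ : 0 < γ) (hq : γ ≤ q) {μ : Measure (ZZ d)}
    (hμ : μ univ ≠ ⊤) {f : ZZ d → ℝ} {A : ℝ}
    (hf : Bd (ENNReal.ofReal q) μ f A) (h0 : ∀ z, 0 ≤ f z) :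
    ∫⁻ z, ENNReal.ofReal (f z) ^ γ ∂μ ≤
      ENNReal.ofReal ((A * (μ univ).toReal ^ (1 / γ - 1 / q)) ^ γ) := by
  have hq0 : 0 < q := by linarith
  have h := eLpNorm_le_eLpNorm_mul_rpow_measure_univ (p := ENNReal.ofReal γ) (q := ENNReal.ofReal q)
    (μ := μ) (f := f) (ENNReal.ofReal_le_ofReal hq) hf.1.aestronglyMeasurable
  rw [ENNReal.toReal_ofReal hq0.le, ENNReal.toReal_ofReal hγ.le] at h
  have he : 0 ≤ 1 / γ - 1 / q := by
    rw [sub_nonneg]; exact one_div_le_one_div_of_le hγ hq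
  have hB : Bd (ENNReal.ofReal γ) μ f (A * (μ univ).toReal ^ (1 / γ - 1 / q)) := by
    refine ⟨hf.1, mul_nonneg hf.2.1 (by positivity), h.trans ?_⟩
    rw [ENNReal.ofReal_mul hf.2.1, ← ENNReal.ofReal_rpow_of_nonneg (by positivity) he,
      ENNReal.ofReal_toReal hμ]
    gcongr
    exact hf.2.2
  refine (hB.lint hγ h0).trans (le_of_eq ?_)
  rw [ENNReal.ofReal_rpow_of_nonneg hB.2.1 hγ.le]
end

open MeasureTheory ENNReal Set

noncomputable section

/-- the operator applied to a tuple -/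
def LL {d : ℕ} (a : Matrix (Fin d) (Fin d) ℝ) (b : EE d) (c u ut : ℝ) (g : EE d)
    (m : Matrix (Fin d) (Fin d) ℝ) : ℝ :=
  ut + (∑ i, ∑ j, a i j * m i j) + (∑ i, b i * g i) - c * u

lemma LL_diff {d : ℕ} {δ K ε : ℝ} (hδ : 0 < δ) (a : Matrix (Fin d) (Fin d) ℝ) (b : EE d) (c : ℝ)
    (ha : Ell δ a) (hs : a.IsSymm) (hb : ‖b‖ + c ≤ K) (hc : 0 ≤ c)
    (u ut w wt : ℝ) (g G : EE d) (m M : Matrix (Fin d) (Fin d) ℝ) (hw : |w - u| ≤ ε) :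
    |LL a b c w wt G M| ≤ |LL a b c u ut g m| + (|wt - ut| +
      ((d * δ⁻¹) * ∑ i, ∑ j, |M i j - m i j| + (K * ∑ i, |G i - g i| + K * ε))) := by
  have hbK : ‖b‖ ≤ K := by linarith
  have hK : 0 ≤ K := by linarith [norm_nonneg b]
  have e : LL a b c w wt G M = LL a b c u ut g m + ((wt - ut) +
      ((∑ i, ∑ j, a i j * (M i j - m i j)) + ((∑ i, b i * (G i - g i)) - c * (w - u)))) := by
    simp only [LL, mul_sub, Finset.sum_sub_distrib]
    ring
  have e1 : |∑ i, ∑ j, a i j * (M i j - m i j)| ≤ (d * δ⁻¹) * ∑ i, ∑ j, |M i j - m i j| := by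
    rw [Finset.mul_sum]
    refine (Finset.abs_sum_le_sum_abs _ _).trans (Finset.sum_le_sum fun i _ => ?_)
    rw [Finset.mul_sum]
    refine (Finset.abs_sum_le_sum_abs _ _).trans (Finset.sum_le_sum fun j _ => ?_)
    rw [abs_mul]
    exact mul_le_mul_of_nonneg_right (ell_entry hδ ha hs i j) (abs_nonneg _)
  have e2 : |∑ i, b i * (G i - g i)| ≤ K * ∑ i, |G i - g i| := by
    rw [Finset.mul_sum]
    refine (Finset.abs_sum_le_sum_abs _ _).trans (Finset.sum_le_sum fun i _ => ?_)
    rw [abs_mul]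
    refine mul_le_mul_of_nonneg_right ?_ (abs_nonneg _)
    exact (PiLp.norm_apply_le b i).trans hbK
  have e3 : |c * (w - u)| ≤ K * ε := by
    rw [abs_mul, abs_of_nonneg hc]
    exact mul_le_mul (by linarith [norm_nonneg b]) hw (abs_nonneg _) hK
  rw [e]
  refine (abs_add_le _ _).trans (add_le_add le_rfl ?_)
  refine (abs_add_le _ _).trans (add_le_add le_rfl ?_)
  refine (abs_add_le _ _).trans (add_le_add e1 ?_)
  exact (abs_sub _ _).trans (add_le_add e2 e3)

lemma inner_est {d : ℕ} {δ K γ N : ℝ} (hδ : 0 < δ) (hK : 0 ≤ K) (hγ : 0 < γ)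
    (hγ1 : γ ≤ 1) (hN : 0 < N)
    (hne : ∀ (u ut : ZZ d → ℝ) (G : ZZ d → EE d)
      (m : ZZ d → Matrix (Fin d) (Fin d) ℝ) (k : ZZ d → EE d) (t0 t1 R : ℝ)
      (a : ZZ d → Matrix (Fin d) (Fin d) ℝ) (b : ZZ d → EE d) (c : ZZ d → ℝ)
      (f : ZZ d → ℝ) (Λ m0 : ℝ),
      Sm u ut G m k → t0 ≤ t1 → t1 - t0 ≤ 1 → 0 < R → R ≤ 1 →
      (∀ z, Ell δ (a z)) → (∀ z, ‖b z‖ + c z ≤ K) → (∀ z, 0 ≤ c z) →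
      Measurable f → (∀ z, 0 ≤ f z) →
      (∀ z ∈ DD d t0 t1 R,
        |ut z + (∑ i, ∑ j, a z i j * m z i j) + (∑ i, b z i * G z i) - c z * u z| ≤ f z) →
      0 < Λ → 0 ≤ m0 →
      (∀ z ∈ QQ d t0 t1 R, (z.1 = t1 ∨ ‖z.2‖ = R) → |u z| ≤ m0) →
      (∫⁻ z in DD d t0 t1 R, ENNReal.ofReal (f z) ^ (d + 1)) ≤ ENNReal.ofReal (Λ ^ (d + 1)) →
      ∫⁻ z in DD d t0 t1 R, ENNReal.ofReal (frobNorm (m z)) ^ γ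
        ≤ ENNReal.ofReal (N * (m0 + Λ) ^ γ))
    (a : ZZ d → Matrix (Fin d) (Fin d) ℝ) (b : ZZ d → EE d) (c : ZZ d → ℝ)
    (ham : ∀ i j, Measurable fun z => a z i j) (hbm : ∀ i, Measurable fun z => b z i)
    (hcm : Measurable c) (has : ∀ z, (a z).IsSymm) (ha : ∀ z, Ell δ (a z))
    (hb : ∀ z, ‖b z‖ + c z ≤ K) (hc : ∀ z, 0 ≤ c z)
    (u ut : ZZ d → ℝ) (du : ZZ d → EE d) (d2u : ZZ d → Matrix (Fin d) (Fin d) ℝ)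
    (hum : Measurable u) (hutm : Measurable ut) (hdum : ∀ i, Measurable fun z => du z i)
    (hd2um : ∀ i j, Measurable fun z => d2u z i j)
    {η Λ0 m0 : ℝ} (hη : 0 < η) (hη2 : η < 1 / 2) (hΛ0 : 0 ≤ Λ0) (hm0 : 0 ≤ m0)
    (happ : ∀ ε : ℝ, 0 < ε → 
      ∃ (w wt : ZZ d → ℝ) (G : ZZ d → EE d) (m : ZZ d → Matrix (Fin d) (Fin d) ℝ) (k : ZZ d → EE d),
      Sm w wt G m k ∧ Continuous wt ∧ (∀ i j, Continuous fun z => m z i j) ∧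
      (∀ z ∈ QQ d η (1 - η) (1 - η), |w z - u z| ≤ ε) ∧
      eLpNorm (fun z => wt z - ut z) (ENNReal.ofReal ((d : ℝ) + 1))
        (volume.restrict (DD d η (1 - η) (1 - η))) ≤ ENNReal.ofReal ε ∧
      (∀ i, eLpNorm (fun z => G z i - du z i) (ENNReal.ofReal ((d : ℝ) + 1))
        (volume.restrict (DD d η (1 - η) (1 - η))) ≤ ENNReal.ofReal ε) ∧
      (∀ i j, eLpNorm (fun z => m z i j - d2u z i j) (ENNReal.ofReal ((d : ℝ) + 1))
        (volume.restrict (DD d η (1 - η) (1 - η))) ≤ ENNReal.ofReal ε))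
    (hbd : ∀ z ∈ QQ d η (1 - η) (1 - η), (z.1 = 1 - η ∨ ‖z.2‖ = 1 - η) → |u z| ≤ m0)
    (hL : eLpNorm (fun z => LL (a z) (b z) (c z) (u z) (ut z) (du z) (d2u z))
      (ENNReal.ofReal ((d : ℝ) + 1)) (volume.restrict (DD d η (1 - η) (1 - η))) ≤ ENNReal.ofReal Λ0) :
    ∫⁻ z in DD d η (1 - η) (1 - η), ENNReal.ofReal (frobNorm (d2u z)) ^ γ
        ≤ ENNReal.ofReal (N * (m0 + Λ0) ^ γ) := by
  set D := DD d η (1 - η) (1 - η) with hD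
  set μ := (volume : Measure (ZZ d)).restrict D with hμ
  set q : ℝ := (d : ℝ) + 1 with hq
  have hq1 : 1 ≤ q := by simp [hq]
  have hq0 : 0 < q := by linarith
  have hp1 : (1 : ℝ≥0∞) ≤ ENNReal.ofReal q := by simpa using hq1
  have hμf : μ univ ≠ ⊤ := by
    rw [hμ, Measure.restrict_apply_univ, hD, vol_DD d (by linarith) (by linarith)]
    exact ENNReal.ofReal_ne_top
  set V := (μ univ).toReal with hV
  have hcst : ∀ C : ℝ, 0 ≤ C → Bd (ENNReal.ofReal q) μ (fun _ => C) (C * V ^ (1 / q)) := by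
    intro C hC
    refine ⟨measurable_const, mul_nonneg hC (by positivity), ?_⟩
    rw [eLpNorm_const' _ (by simpa using hq0) ENNReal.ofReal_ne_top, ENNReal.toReal_ofReal hq0.le,
      ENNReal.ofReal_mul hC, Real.enorm_eq_ofReal hC,
      ← ENNReal.ofReal_rpow_of_nonneg (by positivity) (by positivity), ENNReal.ofReal_toReal hμf]
  have hLm : Measurable (fun z => LL (a z) (b z) (c z) (u z) (ut z) (du z) (d2u z)) := by
    unfold LL
    refine ((hutm.add ?_).add ?_).sub (hcm.mul hum)
    · exact Finset.measurable_sum _ fun i _ => Finset.measurable_sum _ fun j _ =>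
        (ham i j).mul (hd2um i j)
    · exact Finset.measurable_sum _ fun i _ => (hbm i).mul (hdum i)
  have hδi : 0 ≤ d * δ⁻¹ := by positivity
  set C1 : ℝ := 1 + ((d * δ⁻¹) * (d * (d * 1)) + (K * (d * 1) + K * V ^ (1 / q))) with hC1
  set C2 : ℝ := (d * (d * (d * 1))) * V ^ (1 / γ - 1 / q) with hC2
  have hC10 : 0 < C1 := by positivity
  have hC20 : 0 ≤ C2 := by positivity
  have key : ∀ ε : ℝ, 0 < ε → ∫⁻ z, ENNReal.ofReal (frobNorm (d2u z)) ^ γ ∂μ ≤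
      ENNReal.ofReal (N * ((m0 + ε) + (Λ0 + C1 * ε)) ^ γ + (C2 * ε) ^ γ) := by
    intro ε hε
    obtain ⟨w, wt, G, m, k, hS, hwt, hm, hwu, n1, n2, n3⟩ := happ ε hε
    have B1 : Bd (ENNReal.ofReal q) μ (fun z => |wt z - ut z|) ε :=
      Bd.abs ⟨hwt.measurable.sub hutm, hε.le, n1⟩
    have hGm : ∀ i, Measurable fun z => G z i := fun i =>
      ((EuclideanSpace.proj (𝕜 := ℝ) i).continuous.comp hS.contG).measurable
    have B2 : ∀ i, Bd (ENNReal.ofReal q) μ (fun z => |G z i - du z i|) ε := fun i =>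
      Bd.abs ⟨(hGm i).sub (hdum i), hε.le, n2 i⟩
    have B3 : ∀ i j, Bd (ENNReal.ofReal q) μ (fun z => |m z i j - d2u z i j|) ε := fun i j =>
      Bd.abs ⟨(hm i j).measurable.sub (hd2um i j), hε.le, n3 i j⟩
    have B3s : Bd (ENNReal.ofReal q) μ (fun z => ∑ i, ∑ j, |m z i j - d2u z i j|) (d * (d * ε)) :=
      Bd.sum hp1 (by positivity) fun i => Bd.sum hp1 hε.le fun j => B3 i j
    have B2s := Bd.sum hp1 hε.le B2
    have BL : Bd (ENNReal.ofReal q) μ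
        (fun z => |LL (a z) (b z) (c z) (u z) (ut z) (du z) (d2u z)|) Λ0 :=
      Bd.abs ⟨hLm, hΛ0, hL⟩
    have Bf := BL.add hp1 (B1.add hp1 ((B3s.mul hδi).add hp1 ((B2s.mul hK).add hp1
      (hcst (K * ε) (by positivity)))))
    have hval : Λ0 + (ε + (d * δ⁻¹ * (d * (d * ε)) + (K * (d * ε) + K * ε * V ^ (1 / q)))) =
        Λ0 + C1 * ε := by rw [hC1]; ring
    rw [hval] at Bf
    set f : ZZ d → ℝ := fun z => |LL (a z) (b z) (c z) (u z) (ut z) (du z) (d2u z)| +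
      (|wt z - ut z| + (d * δ⁻¹ * ∑ i, ∑ j, |m z i j - d2u z i j| +
        (K * ∑ i, |G z i - du z i| + K * ε))) with hf
    have hf0 : ∀ z, 0 ≤ f z := fun z => by positivity
    have hmain := hne w wt G m k η (1 - η) (1 - η) a b c f (Λ0 + C1 * ε) (m0 + ε) hS (by linarith)
      (by linarith) (by linarith) (by linarith) ha hb hc Bf.1 hf0 ?_ (by positivity) (by positivity)
      ?_ ?_
    rotate_left
    · intro z hz
      exact LL_diff hδ (a z) (b z) (c z) (ha z) (has z) (hb z) (hc z) (u z) (ut z) (w z) (wt z)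
        (du z) (G z) (d2u z) (m z) (hwu z (DD_sub _ _ _ _ hz))
    · intro z hz hz2
      have e1 := hbd z hz hz2
      have e2 := hwu z hz
      have e3 := abs_add_le (w z - u z) (u z)
      rw [sub_add_cancel] at e3
      linarith
    · have h := Bf.lint hq0 hf0
      have hcast : ∀ x : ℝ≥0∞, x ^ q = x ^ (d + 1) := fun x => by
        rw [hq, ← ENNReal.rpow_natCast]; push_cast; rfl
      simp only [hcast] at h
      rwa [ENNReal.ofReal_pow (by positivity)]
    -- difference
    have hB4 := (B3s.mul (c := d) (by positivity)).small hγ (by linarith) hμf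
      (fun z => by positivity)
    have hpt : ∀ z, ENNReal.ofReal (frobNorm (d2u z)) ^ γ ≤ ENNReal.ofReal (frobNorm (m z)) ^ γ +
        ENNReal.ofReal (d * ∑ i, ∑ j, |m z i j - d2u z i j|) ^ γ := by
      intro z
      have e1 : frobNorm (d2u z) ≤ frobNorm (m z) + d * ∑ i, ∑ j, |m z i j - d2u z i j| := by
        have e2 := frobNorm_add (m z) (d2u z - m z)
        rw [add_sub_cancel] at e2
        refine e2.trans (add_le_add le_rfl (frobNorm_le (by positivity) fun i j => ?_))
        rw [Matrix.sub_apply, abs_sub_comm]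
        exact (Finset.single_le_sum (f := fun j => |m z i j - d2u z i j|)
          (fun j _ => abs_nonneg _) (Finset.mem_univ j)).trans
          (Finset.single_le_sum (f := fun i => ∑ j, |m z i j - d2u z i j|)
          (fun i _ => Finset.sum_nonneg fun j _ => abs_nonneg _) (Finset.mem_univ i))
      refine (ENNReal.rpow_le_rpow (ENNReal.ofReal_le_ofReal e1) hγ.le).trans ?_
      rw [ENNReal.ofReal_add (frobNorm_nonneg _) (by positivity)]
      exact ENNReal.rpow_add_le_add_rpow _ _ hγ.le hγ1
    have hmeas : Measurable fun z => ENNReal.ofReal (d * ∑ i, ∑ j, |m z i j - d2u z i j|) ^ γ :=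
      ((B3s.mul (c := d) (by positivity)).1.ennreal_ofReal).pow_const γ
    refine (lintegral_mono hpt).trans ?_
    rw [lintegral_add_right _ hmeas, ENNReal.ofReal_add (by positivity) (by positivity)]
    refine add_le_add hmain (hB4.trans (le_of_eq ?_))
    congr 2
    rw [hC2]; ring
  -- limit
  have hlim : Filter.Tendsto (fun ε : ℝ => ENNReal.ofReal
      (N * ((m0 + ε) + (Λ0 + C1 * ε)) ^ γ + (C2 * ε) ^ γ)) (nhdsWithin 0 (Ioi 0))
      (nhds (ENNReal.ofReal (N * (m0 + Λ0) ^ γ))) := by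
    have hcont : Continuous fun ε : ℝ => ENNReal.ofReal
      (N * ((m0 + ε) + (Λ0 + C1 * ε)) ^ γ + (C2 * ε) ^ γ) := by
      refine ENNReal.continuous_ofReal.comp ((continuous_const.mul ?_).add ?_)
      · exact Continuous.rpow_const (by fun_prop) fun _ => Or.inr hγ.le
      · exact Continuous.rpow_const (by fun_prop) fun _ => Or.inr hγ.le
    have := (hcont.tendsto 0).mono_left (nhdsWithin_le_nhds (s := Ioi 0))
    simpa [Real.zero_rpow hγ.ne'] using this
  refine ge_of_tendsto hlim ?_
  filter_upwards [self_mem_nhdsWithin] with ε hε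
  exact key ε hε
end

open MeasureTheory ENNReal Set

noncomputable section

/-- the parabolic boundary of `C₁` -/
abbrev PB (d : ℕ) : Set (ZZ d) :=
  Set.Icc (0 : ℝ) 1 ×ˢ Metric.sphere (0 : EuclideanSpace ℝ (Fin d)) 1 ∪
    {(1 : ℝ)} ×ˢ Metric.ball (0 : EuclideanSpace ℝ (Fin d)) 1

lemma closC1 (d : ℕ) : closure (Set.Ioo (0 : ℝ) 1 ×ˢ Metric.ball (0 : EuclideanSpace ℝ (Fin d)) 1) =
    QQ d 0 1 1 := by
  rw [closure_prod_eq, closure_Ioo (by norm_num), closure_ball _ (by norm_num)]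
  rfl

lemma PB_sub (d : ℕ) : PB d ⊆ QQ d 0 1 1 := by
  rintro z (⟨h1, h2⟩ | ⟨h1, h2⟩)
  · exact ⟨h1, Metric.sphere_subset_closedBall h2⟩
  · rw [mem_singleton_iff] at h1
    exact ⟨by rw [h1]; simp, Metric.ball_subset_closedBall h2⟩

lemma le_sup {d : ℕ} {u : ZZ d → ℝ} (hu : ContinuousOn u (QQ d 0 1 1)) {z : ZZ d} (hz : z ∈ PB d) :
    |u z| ≤ ⨆ z ∈ PB d, |u z| := by
  obtain ⟨M, hM⟩ := (QQ_compact d 0 1 1).exists_bound_of_continuousOn hu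
  have h1 : |u z| ≤ ⨆ (_ : z ∈ PB d), |u z| := by
    rw [ciSup_pos hz]
  refine h1.trans (le_ciSup (f := fun z => ⨆ (_ : z ∈ PB d), |u z|) ⟨max M 0, ?_⟩ z)
  rintro _ ⟨y, rfl⟩
  refine Real.iSup_le (fun hy => ?_) (le_max_right _ _)
  exact (hM y (PB_sub d hy)).trans (le_max_left _ _)

lemma near_bd {d : ℕ} {η : ℝ} (hη : 0 < η) (hη2 : η < 1 / 2) {z : ZZ d}
    (hz : z ∈ QQ d η (1 - η) (1 - η)) (h : z.1 = 1 - η ∨ ‖z.2‖ = 1 - η) :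
    ∃ y ∈ PB d, dist z y ≤ η := by
  obtain ⟨⟨h1, h2⟩, h3⟩ := hz
  rw [mem_closedBall_zero_iff] at h3
  rcases h with h | h
  · refine ⟨(1, z.2), Or.inr ⟨rfl, ?_⟩, ?_⟩
    · rw [mem_ball_zero_iff]; linarith
    · rw [Prod.dist_eq, Real.dist_eq, h]
      simp [abs_of_pos hη, hη.le]
  · have hp : 0 < 1 - η := by linarith
    refine ⟨(z.1, (1 - η)⁻¹ • z.2), Or.inl ⟨⟨by linarith, by linarith⟩, ?_⟩, ?_⟩
    · rw [mem_sphere_zero_iff_norm, norm_smul, h, Real.norm_of_nonneg (by positivity)]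
      exact inv_mul_cancel₀ hp.ne'
    · rw [Prod.dist_eq, dist_self, max_le_iff]
      refine ⟨hη.le, ?_⟩
      dsimp only
      rw [dist_comm, dist_eq_norm]
      have e : (1 - η)⁻¹ • z.2 - z.2 = ((1 - η)⁻¹ - 1) • z.2 := by rw [sub_smul, one_smul]
      have e2 : 0 ≤ (1 - η)⁻¹ - 1 := by
        rw [sub_nonneg]; exact (one_le_inv₀ hp).2 (by linarith)
      rw [e, norm_smul, h, Real.norm_of_nonneg e2, sub_mul, inv_mul_cancel₀ hp.ne']
      linarith

lemma exhaust {d : ℕ} {η0 : ℝ} (hη0 : 0 < η0) {F : ZZ d → ℝ≥0∞} {B : ℝ≥0∞}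
    (h : ∀ η, 0 < η → η < η0 → η < 1 / 2 → ∫⁻ z in DD d η (1 - η) (1 - η), F z ≤ B) :
    ∫⁻ z in Set.Ioo (0 : ℝ) 1 ×ˢ Metric.ball (0 : EuclideanSpace ℝ (Fin d)) 1, F z ≤ B := by
  set η1 := min η0 1
  have hη1 : 0 < η1 := lt_min hη0 one_pos
  set e : ℕ → ℝ := fun n => η1 / (n + 3) with he
  have hpos : ∀ n, 0 < e n := fun n => by positivity
  have hle : ∀ n, e n ≤ η1 / 3 := fun n => by
    apply div_le_div_of_nonneg_left hη1.le (by norm_num)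
    have : (0:ℝ) ≤ n := by positivity
    linarith
  have hanti : Antitone e := by
    intro m n hmn
    apply div_le_div_of_nonneg_left hη1.le (by positivity)
    have : (m : ℝ) ≤ n := by exact_mod_cast hmn
    linarith
  have hmono : Monotone fun n => DD d (e n) (1 - e n) (1 - e n) := by
    intro m n hmn
    have := hanti hmn
    exact prod_mono (Ico_subset_Ico this (by linarith)) (Metric.ball_subset_ball (by linarith))
  have hsub : Set.Ioo (0 : ℝ) 1 ×ˢ Metric.ball (0 : EuclideanSpace ℝ (Fin d)) 1 ⊆
      ⋃ n, DD d (e n) (1 - e n) (1 - e n) := by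
    rintro z ⟨⟨h1, h2⟩, h3⟩
    rw [mem_ball_zero_iff] at h3
    set r := min z.1 (min (1 - z.1) (1 - ‖z.2‖)) with hr
    have hr0 : 0 < r := lt_min h1 (lt_min (by linarith) (by linarith))
    obtain ⟨n, hn⟩ := exists_nat_gt (η1 / r)
    have hen : e n < r := by
      rw [he]
      rw [div_lt_iff₀ hr0] at hn
      dsimp only
      rw [div_lt_iff₀ (by positivity)]
      nlinarith
    have r1 : r ≤ z.1 := min_le_left _ _
    have r2 : r ≤ 1 - z.1 := (min_le_right _ _).trans (min_le_left _ _)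
    have r3 : r ≤ 1 - ‖z.2‖ := (min_le_right _ _).trans (min_le_right _ _)
    refine mem_iUnion.2 ⟨n, ⟨by linarith, by linarith⟩, ?_⟩
    rw [mem_ball_zero_iff]; linarith
  refine (lintegral_mono_set hsub).trans ?_
  rw [setLIntegral_iUnion_of_directed _ hmono.directed_le]
  refine iSup_le fun n => h _ (hpos n) ?_ ?_
  · have := hle n
    have : η1 ≤ η0 := min_le_left _ _
    linarith
  · have := hle n
    have : η1 ≤ 1 := min_le_right _ _
    linarith

theorem parabolic_second_derivative_estimate_C1
    (d : ℕ) (hd : 1 ≤ d) (δ K : ℝ) (hδ0 : 0 < δ) (hδ1 : δ < 1) (hK : 0 ≤ K) :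
    ∃ γ N : ℝ, γ ∈ Set.Ioc (0 : ℝ) 1 ∧ 0 < N ∧
      ∀ (a : ℝ × EuclideanSpace ℝ (Fin d) → Matrix (Fin d) (Fin d) ℝ)
        (b : ℝ × EuclideanSpace ℝ (Fin d) → EuclideanSpace ℝ (Fin d))
        (c : ℝ × EuclideanSpace ℝ (Fin d) → ℝ)
        (u ut : ℝ × EuclideanSpace ℝ (Fin d) → ℝ)
        (du : ℝ × EuclideanSpace ℝ (Fin d) → EuclideanSpace ℝ (Fin d))
        (d2u : ℝ × EuclideanSpace ℝ (Fin d) → Matrix (Fin d) (Fin d) ℝ),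
        -- measurability of the coefficients of `L`
        (∀ i j, Measurable fun z => a z i j) →
        (∀ i, Measurable fun z => b z i) →
        Measurable c →
        -- `a` is `S_δ`-valued
        (∀ z, (a z).IsSymm) →
        (∀ z (ξ : EuclideanSpace ℝ (Fin d)),
          δ * ‖ξ‖ ^ 2 ≤ ∑ i, ∑ j, a z i j * ξ i * ξ j ∧
          ∑ i, ∑ j, a z i j * ξ i * ξ j ≤ δ⁻¹ * ‖ξ‖ ^ 2) →
        -- `|b| + c ≤ K`, `c ≥ 0`
        (∀ z, ‖b z‖ + c z ≤ K) →
        (∀ z, 0 ≤ c z) →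
        -- measurability of `u` and its derivatives
        Measurable u → Measurable ut →
        (∀ i, Measurable fun z => du z i) →
        (∀ i j, Measurable fun z => d2u z i j) →
        -- `u ∈ C(C̄_{2,1})`
        ContinuousOn u (closure (Set.Ioo (0 : ℝ) 1 ×ˢ Metric.ball (0 : EuclideanSpace ℝ (Fin d)) 1)) →
        -- `ut = ∂ₜu`, `du = Du`, `d2u = D²u` pointwise in `C_{2,1}`
        (∀ z ∈ Set.Ioo (0 : ℝ) 1 ×ˢ Metric.ball (0 : EuclideanSpace ℝ (Fin d)) 1,
          HasDerivAt (fun s => u (s, z.2)) (ut z) z.1) →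
        (∀ z ∈ Set.Ioo (0 : ℝ) 1 ×ˢ Metric.ball (0 : EuclideanSpace ℝ (Fin d)) 1, ∀ i,
          HasDerivAt (fun s : ℝ => u (z.1, z.2 + s • EuclideanSpace.single i (1 : ℝ))) (du z i) 0) →
        (∀ z ∈ Set.Ioo (0 : ℝ) 1 ×ˢ Metric.ball (0 : EuclideanSpace ℝ (Fin d)) 1, ∀ i j,
          HasDerivAt (fun s : ℝ => du (z.1, z.2 + s • EuclideanSpace.single j (1 : ℝ)) i)
            (d2u z i j) 0) →
        -- local `L_{d+1}` integrability of the derivatives (`u ∈ W^{1,2}_{d+1,loc}`)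
        (∀ G : Set (ℝ × EuclideanSpace ℝ (Fin d)), IsCompact G →
          G ⊆ Set.Ioo (0 : ℝ) 1 ×ˢ Metric.ball (0 : EuclideanSpace ℝ (Fin d)) 1 →
          IntegrableOn (fun z => |ut z| ^ ((d : ℝ) + 1) + ‖du z‖ ^ ((d : ℝ) + 1) +
            frobNorm (d2u z) ^ ((d : ℝ) + 1)) G volume) →
        (∫⁻ z in Set.Ioo (0 : ℝ) 1 ×ˢ Metric.ball (0 : EuclideanSpace ℝ (Fin d)) 1,
            ENNReal.ofReal (frobNorm (d2u z)) ^ γ ∂volume)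
          ≤ ENNReal.ofReal N *
              (∫⁻ z in Set.Ioo (0 : ℝ) 1 ×ˢ Metric.ball (0 : EuclideanSpace ℝ (Fin d)) 1,
                ENNReal.ofReal
                  |ut z + (∑ i, ∑ j, a z i j * d2u z i j) + (∑ i, b z i * du z i) - c z * u z|
                  ^ ((d : ℝ) + 1) ∂volume) ^ (γ / ((d : ℝ) + 1))
            + ENNReal.ofReal N *
              ENNReal.ofReal
                ((⨆ z ∈ (Set.Icc (0 : ℝ) 1 ×ˢ Metric.sphere (0 : EuclideanSpace ℝ (Fin d)) 1 ∪
                    {(1 : ℝ)} ×ˢ Metric.ball (0 : EuclideanSpace ℝ (Fin d)) 1), |u z|) ^ γ) := by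
  obtain ⟨γ, N, hγ, hγ1, hN, hne⟩ := norm_est hd hδ0 hK
  refine ⟨γ, N, ⟨hγ, hγ1⟩, hN, ?_⟩
  intro a b c u ut du d2u ham hbm hcm has ha hb hc hum hutm hdum hd2um huc h1 h2 h3 hIntg
  have hucC := huc.mono subset_closure
  rw [closC1] at huc
  set q : ℝ := (d : ℝ) + 1 with hq
  have hq1 : 1 ≤ q := by simp [hq]
  have hq0 : 0 < q := by linarith
  set I := ∫⁻ z in Set.Ioo (0 : ℝ) 1 ×ˢ Metric.ball (0 : EuclideanSpace ℝ (Fin d)) 1,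
    ENNReal.ofReal
      |ut z + (∑ i, ∑ j, a z i j * d2u z i j) + (∑ i, b z i * du z i) - c z * u z| ^ q with hI
  set S := (⨆ z ∈ PB d, |u z|) with hS
  have hS0 : 0 ≤ S := Real.iSup_nonneg fun z => Real.iSup_nonneg fun _ => abs_nonneg _
  by_cases hIt : I = ⊤
  · rw [hIt, ENNReal.top_rpow_of_pos (by positivity), ENNReal.mul_top (by simpa using hN), top_add]
    exact le_top
  set Λ0 : ℝ := (I ^ (1 / q)).toReal with hΛ
  have hΛ0 : 0 ≤ Λ0 := ENNReal.toReal_nonneg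
  have hIf : I ^ (1 / q) ≠ ⊤ := ENNReal.rpow_ne_top_of_nonneg (by positivity) hIt
  have hΛe : ENNReal.ofReal Λ0 = I ^ (1 / q) := ENNReal.ofReal_toReal hIf
  have key : ∀ ε : ℝ, 0 < ε →
      (∫⁻ z in Set.Ioo (0 : ℝ) 1 ×ˢ Metric.ball (0 : EuclideanSpace ℝ (Fin d)) 1,
            ENNReal.ofReal (frobNorm (d2u z)) ^ γ ∂volume) ≤
        ENNReal.ofReal (N * ((S + ε) + Λ0) ^ γ) := by
    intro ε hε
    have hunif := (QQ_compact d 0 1 1).uniformContinuousOn_of_continuous huc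
    rw [Metric.uniformContinuousOn_iff] at hunif
    obtain ⟨η0, hη0, hη⟩ := hunif ε hε
    refine exhaust hη0 fun η e1 e2 e3 => ?_
    have hsubQ := QQ_sub_C1 (d := d) e1
    refine inner_est hδ0 hK hγ hγ1 hN hne a b c ham hbm hcm has ha hb hc u ut du d2u hum hutm hdum
      hd2um e1 e3 hΛ0 (by positivity) (fun ε' hε' => approx hq1 u ut du d2u hum hutm hdum hd2um
        hucC h1 h2 h3 hIntg e1 hε') ?_ ?_
    · intro z hz hzb
      obtain ⟨y, hy, hd⟩ := near_bd e1 e3 hz hzb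
      have f1 := le_sup huc hy
      have hzQ : z ∈ QQ d 0 1 1 := by
        rw [← closC1]; exact subset_closure (hsubQ hz)
      have f2 := hη z hzQ y (PB_sub d hy) (by linarith)
      rw [Real.dist_eq] at f2
      have f3 := abs_add_le (u z - u y) (u y)
      rw [sub_add_cancel] at f3
      linarith
    · rw [hΛe, eLpNorm_eq_lintegral_rpow_enorm_toReal (by simpa using hq0) ENNReal.ofReal_ne_top,
        ENNReal.toReal_ofReal hq0.le]
      refine ENNReal.rpow_le_rpow ?_ (by positivity)
      rw [hI]
      refine le_trans (lintegral_mono_set ((DD_sub _ _ _ _).trans hsubQ)) (le_of_eq ?_)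
      refine lintegral_congr fun z => ?_
      rw [← ofReal_norm]
      rfl
  have hfin : (∫⁻ z in Set.Ioo (0 : ℝ) 1 ×ˢ Metric.ball (0 : EuclideanSpace ℝ (Fin d)) 1,
            ENNReal.ofReal (frobNorm (d2u z)) ^ γ ∂volume) ≤
        ENNReal.ofReal (N * (S + Λ0) ^ γ) := by
    have hlim : Filter.Tendsto (fun ε : ℝ => ENNReal.ofReal (N * ((S + ε) + Λ0) ^ γ))
        (nhdsWithin 0 (Ioi 0)) (nhds (ENNReal.ofReal (N * (S + Λ0) ^ γ))) := by
      have hcont : Continuous fun ε : ℝ => ENNReal.ofReal (N * ((S + ε) + Λ0) ^ γ) := by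
        refine ENNReal.continuous_ofReal.comp (continuous_const.mul ?_)
        exact Continuous.rpow_const (by fun_prop) fun _ => Or.inr hγ.le
      have := (hcont.tendsto 0).mono_left (nhdsWithin_le_nhds (s := Ioi 0))
      simpa using this
    refine ge_of_tendsto hlim ?_
    filter_upwards [self_mem_nhdsWithin] with ε hε
    exact key ε hε
  refine hfin.trans ?_
  rw [ENNReal.ofReal_mul hN.le, ← mul_add]
  refine mul_le_mul_right ?_ _
  have hIγ : I ^ (γ / q) = ENNReal.ofReal Λ0 ^ γ := by
    rw [hΛe, ← ENNReal.rpow_mul]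
    congr 1
    ring
  rw [hIγ, add_comm S Λ0, ← ENNReal.ofReal_rpow_of_nonneg (by positivity) hγ.le,
    ← ENNReal.ofReal_rpow_of_nonneg hS0 hγ.le, ENNReal.ofReal_add hΛ0 hS0]
  exact ENNReal.rpow_add_le_add_rpow _ _ hγ.le hγ1
end
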